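/- Dimension form of the Józefiak–Weyman theorem: let K be a field of characteristic 0, N a positive integer, V = K^N, and A = T(V)/I the quotient of the tensor algebra by the two-sided ideal I generated by all [[x,y],z] with x,y,z ∈ V (ring commutators [a,b] = ab − ba). Let K be the A-module given by the augmentation ε : A → K sending each x ∈ V to 0. Then for every n ≥ 0, the Ext group Ext^n_A(K,K), computed in the category of A-modules and regarded as a K-vector space, has dimension Σ_λ (number of semistandard Young tableaux of shape λ with entries in {0,…,N−1}), where the sum runs over all self-conjugate Young diagrams λ with (|λ| + r(λ))/2 = n. -/

import Mathlib

open TensorAlgebra in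
/-- The relation on the tensor algebra `T(V)` identifying every iterated ring commutator
`[[x,y],z]` of generators `x, y, z ∈ V` with `0`; quotienting by the two-sided ideal it
generates yields the parastatistics algebra `T(V)/I`. -/
def psRel (K : Type) [Field K] (V : Type) [AddCommGroup V] [Module K V] :
    TensorAlgebra K V → TensorAlgebra K V → Prop := fun a b =>
  ∃ x y z : V, a = ⁅⁅ι K x, ι K y⁆, ι K z⁆ ∧ b = 0

/-- The parastatistics algebra `A = T(V)/⟨[[x,y],z] : x,y,z ∈ V⟩`. -/
abbrev PS (K : Type) [Field K] (V : Type) [AddCommGroup V] [Module K V] : Type :=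
  RingQuot (psRel K V)

/-- The augmentation `ε : A → K` sending every generator `x ∈ V` to `0`. -/
noncomputable def psAug (K : Type) [Field K] (V : Type) [AddCommGroup V] [Module K V] :
    PS K V →ₐ[K] K :=
  RingQuot.liftAlgHom K (s := psRel K V)
    ⟨TensorAlgebra.lift K (0 : V →ₗ[K] K), by
      rintro a b ⟨x, y, z, rfl, rfl⟩
      simp [Ring.lie_def]⟩

/-- `K` as a module over the parastatistics algebra, via the augmentation. -/
noncomputable instance psModuleK (K : Type) [Field K] (V : Type) [AddCommGroup V]
    [Module K V] : Module (PS K V) K :=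
  Module.compHom K (psAug K V).toRingHom

/-- The rank of a Young diagram: the number of diagonal cells. -/
def YoungDiagram.diagRank (lam : YoungDiagram) : ℕ :=
  (lam.cells.filter fun c => c.1 = c.2).card

/-- The number of semistandard Young tableaux of shape `lam` with entries in `{0, …, N-1}`. -/
noncomputable def ssytCount (N : ℕ) (lam : YoungDiagram) : ℕ :=
  Nat.card {T : SemistandardYoungTableau lam // ∀ i j : ℕ, (i, j) ∈ lam → T i j < N}


section
open Finset Matrix

namespace JW

section Fock
variable {E : Type} [Fintype E] [LinearOrder E]

/-- fermionic sign -/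
def sg (e : E) (S : Finset E) : ℤ := (-1) ^ (S.filter (· < e)).card

lemma sg_sq (e : E) (S : Finset E) : sg e S * sg e S = 1 := by
  unfold sg; rw [← pow_add, ← two_mul, pow_mul]; simp

lemma sg_insert (e f : E) (S : Finset E) (h : f ∉ S) :
    sg e (insert f S) = (if f < e then -1 else 1) * sg e S := by
  unfold sg
  rw [filter_insert]
  split_ifs with h1
  · rw [card_insert_of_notMem (by simp [h]), pow_succ]; ring
  · simp

/-- annihilation matrix -/
def cc (e : E) : Matrix (Finset E) (Finset E) ℤ :=
  Matrix.of fun S T => if e ∉ S ∧ T = insert e S then sg e S else 0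

lemma cc_mulVec (e : E) (v : Finset E → ℤ) (S : Finset E) :
    (cc e *ᵥ v) S = if e ∈ S then 0 else sg e S * v (insert e S) := by
  simp only [mulVec, dotProduct, cc, of_apply]
  by_cases h : e ∈ S <;> simp [h]

lemma ccT_mulVec (e : E) (v : Finset E → ℤ) (S : Finset E) :
    ((cc e)ᵀ *ᵥ v) S = if e ∈ S then sg e (S.erase e) * v (S.erase e) else 0 := by
  simp only [mulVec, dotProduct, cc, of_apply, transpose_apply]
  by_cases h : e ∈ S
  · rw [if_pos h, Finset.sum_eq_single (S.erase e)]
    · simp [h]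
    · intro T _ hT
      rw [if_neg, zero_mul]
      rintro ⟨h1, rfl⟩
      exact hT (by simp [h1])
    · simp
  · rw [if_neg h, Finset.sum_eq_zero]
    intro T _
    rw [if_neg, zero_mul]
    rintro ⟨h1, rfl⟩
    simp at h

lemma mat_ext {X : Type} [Fintype X] [DecidableEq X] {A B : Matrix X X ℤ}
    (h : ∀ v x, (A *ᵥ v) x = (B *ᵥ v) x) : A = B := by
  apply Matrix.mulVec_injective
  funext v x; exact h v x

lemma cc_anti (e f : E) : cc e * cc f + cc f * cc e = 0 := by
  apply mat_ext
  intro v S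
  rw [add_mulVec, ← mulVec_mulVec, ← mulVec_mulVec]
  simp only [Pi.add_apply, cc_mulVec, zero_mulVec, Pi.zero_apply, mem_insert]
  by_cases he : e ∈ S <;> by_cases hf : f ∈ S <;> simp [he, hf]
  by_cases hef : e = f
  · simp [hef]
  have hfe : f ≠ e := Ne.symm hef
  simp only [hef, hfe, if_false]
  rw [sg_insert _ _ _ hf, sg_insert _ _ _ he, Finset.insert_comm f e]
  rcases lt_or_gt_of_ne hef with h | h
  · simp [h, h.le, not_lt.2 h.le]; ring
  · simp [h, not_lt.2 h.le]; ring

lemma cc_mixed (e f : E) : cc e * (cc f)ᵀ + (cc f)ᵀ * cc e = if e = f then 1 else 0 := by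
  apply mat_ext
  intro v S
  rw [add_mulVec, ← mulVec_mulVec, ← mulVec_mulVec]
  simp only [Pi.add_apply, cc_mulVec, ccT_mulVec]
  by_cases hef : e = f
  · subst hef
    by_cases he : e ∈ S
    · simp [he, ← mul_assoc, sg_sq]
    · simp [he, ← mul_assoc, sg_sq]
  · have hfe : f ≠ e := Ne.symm hef
    by_cases he : e ∈ S <;> by_cases hf : f ∈ S <;> simp [he, hf, hef, hfe]
    have h1 : (insert e S).erase f = insert e (S.erase f) := by
      rw [erase_insert_of_ne hef]
    have h2 : sg e S = (if f < e then -1 else 1) * sg e (S.erase f) := by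
      rw [← sg_insert _ _ _ (by simp), insert_erase hf]
    rw [h1, h2, sg_insert _ _ _ (by simp [he])]
    rcases lt_or_gt_of_ne hef with h | h
    · simp [h, h.le, not_lt.2 h.le]; ring
    · simp [h, not_lt.2 h.le]; ring

lemma ccT_anti (e f : E) : (cc e)ᵀ * (cc f)ᵀ + (cc f)ᵀ * (cc e)ᵀ = 0 := by
  have := congrArg Matrix.transpose (cc_anti f e)
  simpa [transpose_mul, transpose_add] using this

/-- number operator of a single mode -/
lemma ccT_cc (e : E) : (cc e)ᵀ * cc e = Matrix.diagonal (fun S => if e ∈ S then (1:ℤ) else 0) := by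
  apply mat_ext
  intro v S
  rw [← mulVec_mulVec, ccT_mulVec, mulVec_diagonal]
  by_cases he : e ∈ S <;> simp [he, cc_mulVec, ← mul_assoc, sg_sq]

/-- card-degree of matrices -/
def Deg (A : Matrix (Finset E) (Finset E) ℤ) (a b : ℕ) : Prop :=
  ∀ S T, A S T ≠ 0 → S.card + b = T.card + a

lemma cc_deg (e : E) : Deg (cc e) 0 1 := by
  intro S T h
  simp only [cc, of_apply] at h
  have : e ∉ S ∧ T = insert e S := by by_contra h'; rw [if_neg h'] at h; exact h rfl
  rw [this.2, card_insert_of_notMem this.1]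

end Fock
end JW
end

section
open Finset

namespace JW

/-- abstract canonical anticommutation relations -/
structure CAR (R : Type) [Ring R] (N : ℕ) where
  a : Fin N → R
  a' : Fin N → R
  b : Fin N → Fin N → R
  b' : Fin N → Fin N → R
  aa : ∀ i j, a i * a j = - (a j * a i)
  a'a' : ∀ i j, a' i * a' j = - (a' j * a' i)
  aa' : ∀ i j, a i * a' j = (if i = j then 1 else 0) - a' j * a i
  bb : ∀ i j k l, b i j * b k l = - (b k l * b i j)
  b'b' : ∀ i j k l, b' i j * b' k l = - (b' k l * b' i j)
  bb' : ∀ i j k l, b i j * b' k l = (if i = k then if j = l then 1 else 0 else 0)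
      - (if i = l then if j = k then 1 else 0 else 0) - b' k l * b i j
  ba : ∀ i j k, b i j * a k = - (a k * b i j)
  ba' : ∀ i j k, b i j * a' k = - (a' k * b i j)
  b'a : ∀ i j k, b' i j * a k = - (a k * b' i j)
  b'a' : ∀ i j k, b' i j * a' k = - (a' k * b' i j)
  bsymm : ∀ i j, b i j = - b j i
  b'symm : ∀ i j, b' i j = - b' j i

namespace CAR
variable {R : Type} [Ring R] {N : ℕ} (c : CAR R N)

def Ee (i j : Fin N) : R := c.a' i * c.a j + ∑ k, c.b' i k * c.b j k

def D : R := ∑ i, ∑ j, c.b' i j * c.a j * c.a i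
def D' : R := ∑ i, ∑ j, c.a' i * c.a' j * c.b i j

def br (x y : R) : R := x * y - y * x
lemma add_br (x y z : R) : br (x + y) z = br x z + br y z := by simp only [br]; noncomm_ring
lemma br_add (x y z : R) : br x (y + z) = br x y + br x z := by simp only [br]; noncomm_ring
lemma sum_br {ι : Type} (s : Finset ι) (f : ι → R) (z : R) :
    br (∑ i ∈ s, f i) z = ∑ i ∈ s, br (f i) z := by
  simp only [br, sum_mul, mul_sum, sum_sub_distrib]
lemma br_sum {ι : Type} (s : Finset ι) (f : ι → R) (z : R) :
    br z (∑ i ∈ s, f i) = ∑ i ∈ s, br z (f i) := by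
  simp only [br, sum_mul, mul_sum, sum_sub_distrib]

lemma lie_mul' (x y z : R) : br (x) (y * z) = br (x) (y) * z + y * br (x) (z) := by
  simp only [br]; noncomm_ring

/-- `[pq, x]` through anticommutators -/
lemma lie_even (p q x : R) : br (p * q) (x) = p * (q * x + x * q) - (p * x + x * p) * q := by
  simp only [br]; noncomm_ring

lemma E_a' (i j k : Fin N) : br (c.Ee i j) (c.a' k) = if j = k then c.a' i else 0 := by
  unfold Ee
  rw [add_br, lie_even, sum_br]
  have h : ∀ m, br (c.b' i m * c.b j m) (c.a' k) = 0 := by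
    intro m; rw [lie_even, c.ba', c.b'a']; simp
  simp only [h, sum_const_zero]
  rw [c.aa', c.a'a' i k]
  split_ifs <;> simp

lemma E_a (i j k : Fin N) : br (c.Ee i j) (c.a k) = - if i = k then c.a j else 0 := by
  unfold Ee
  rw [add_br, lie_even, sum_br]
  have h : ∀ m, br (c.b' i m * c.b j m) (c.a k) = 0 := by
    intro m; rw [lie_even, c.ba, c.b'a]; simp
  simp only [h, sum_const_zero]
  rw [c.aa', c.aa j k]
  by_cases h : i = k
  · simp [h]
  · simp [h, Ne.symm h]

lemma E_b' (i j k l : Fin N) : br (c.Ee i j) (c.b' k l) =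
    (if j = k then c.b' i l else 0) + (if j = l then c.b' k i else 0) := by
  unfold Ee
  rw [add_br, lie_even, sum_br]
  have h : ∀ m, br (c.b' i m * c.b j m) (c.b' k l) =
     (if j = k then (if m = l then c.b' i m else 0) else 0)
      - (if j = l then (if m = k then c.b' i m else 0) else 0) := by
    intro m; rw [lie_even, c.bb', c.b'b' i m k l]
    split_ifs <;> simp
  simp only [h, sum_sub_distrib]
  rw [c.b'a, c.b'a', c.b'symm k i]
  split_ifs <;> simp [sub_eq_add_neg]

lemma E_b (i j k l : Fin N) : br (c.Ee i j) (c.b k l) =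
    - (if i = k then c.b j l else 0) - (if i = l then c.b k j else 0) := by
  unfold Ee
  rw [add_br, lie_even, sum_br]
  have h : ∀ m, br (c.b' i m * c.b j m) (c.b k l) =
     - (if k = i then (if l = m then c.b j m else 0) else 0)
      + (if l = i then (if k = m then c.b j m else 0) else 0) := by
    intro m; rw [lie_even, c.bb', c.bb j m k l]
    split_ifs <;> simp_all
  simp only [h, sum_add_distrib, sum_neg_distrib]
  rw [c.ba, c.ba', c.bsymm k j]
  simp only [eq_comm (a := k) (b := i), eq_comm (a := l) (b := i)]
  split_ifs <;> simp

lemma E_E (i j k l : Fin N) : br (c.Ee i j) (c.Ee k l) =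
    (if j = k then c.Ee i l else 0) - (if i = l then c.Ee k j else 0) := by
  conv_lhs => rw [Ee.eq_def c k l]
  rw [br_add, lie_mul', br_sum]
  simp only [lie_mul', E_a, E_a', E_b, E_b']
  have h : ∀ m, ((if j = k then c.b' i m else 0) + if j = m then c.b' k i else 0) * c.b l m +
        c.b' k m * ((-if i = l then c.b j m else 0) - if i = m then c.b l j else 0) =
      (if j = k then c.b' i m * c.b l m else 0) - (if i = l then c.b' k m * c.b j m else 0)
      + ((if j = m then c.b' k i * c.b l m else 0) - (if i = m then c.b' k m * c.b l j else 0)) := by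
    intro m
    split_ifs <;> noncomm_ring
  simp only [h, sum_add_distrib, sum_sub_distrib, sum_ite_eq, mem_univ, if_true, sub_self, add_zero]
  unfold Ee
  split_ifs <;> simp <;> abel

def Cas : R := ∑ i, ∑ j, c.Ee i j * c.Ee j i

lemma E_tr (k l : Fin N) : br (c.Ee k l) (∑ i, c.Ee i i) = 0 := by
  rw [br_sum]
  simp only [E_E, sum_sub_distrib]
  simp

lemma E_Cas (k l : Fin N) : br (c.Ee k l) (c.Cas) = 0 := by
  unfold Cas
  simp only [br_sum, lie_mul', E_E, sub_mul, mul_sub, ite_mul, mul_ite, zero_mul, mul_zero,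
    sum_add_distrib, sum_sub_distrib]
  have : ∀ f : Fin N → Fin N → R, ∑ i, ∑ j, (if l = i then f i j else 0) = ∑ j, f l j := by
    intro f; rw [sum_comm]; simp
  simp only [this, sum_ite_eq, mem_univ, if_true]
  have : ∀ f : Fin N → Fin N → R, ∑ i, ∑ j, (if k = i then f i j else 0) = ∑ j, f k j := by
    intro f; rw [sum_comm]; simp
  simp only [this]
  abel


lemma sum4_comm {X : Type} [Fintype X] (f : X → X → X → X → R) :
    ∑ i, ∑ j, ∑ k, ∑ l, f i j k l = ∑ i, ∑ j, ∑ k, ∑ l, f k l i j := by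
  have := Finset.sum_comm (s := univ) (t := univ) (f := fun (p q : X × X) => f p.1 p.2 q.1 q.2)
  simpa [Fintype.sum_prod_type] using this

lemma quartic_zero (h2 : ∀ x : R, x + x = 0 → x = 0) :
    ∑ i, ∑ j, ∑ k, ∑ l, c.b' i k * c.b' j l * (c.b j k * c.b i l) = 0 := by
  apply h2
  conv_lhs =>
    arg 2
    rw [sum4_comm]
  simp only [← sum_add_distrib]
  refine sum_eq_zero fun i _ => sum_eq_zero fun j _ => sum_eq_zero fun k _ => sum_eq_zero fun l _ => ?_
  rw [c.b'symm k i, c.b'symm l j, c.bsymm l i, c.bsymm k j, neg_mul_neg, neg_mul_neg, c.bb i l j k]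
  noncomm_ring

lemma even_comm {p q x : R} (h1 : x * p = -(p * x)) (h2 : x * q = -(q * x)) :
    (p * q) * x = x * (p * q) := by
  rw [← mul_assoc, h1, neg_mul, mul_assoc p x q, h2, mul_assoc]; simp

lemma normal_a (i j k l : Fin N) :
    c.a j * c.a i * (c.a' k * c.a' l) - c.a' k * c.a' l * (c.a j * c.a i) =
      (if i = k then if j = l then 1 else 0 else 0) - (if j = k then if i = l then 1 else 0 else 0)
      - (if i = k then c.a' l * c.a j else 0) + (if j = k then c.a' l * c.a i else 0)
      + (if i = l then c.a' k * c.a j else 0) - (if j = l then c.a' k * c.a i else 0) := by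
  have e : c.a j * c.a i * (c.a' k * c.a' l) =
     c.a j * (c.a i * c.a' k) * c.a' l := by noncomm_ring
  rw [e, c.aa' i k]
  have e : c.a j * ((if i = k then 1 else 0) - c.a' k * c.a i) * c.a' l =
    (if i = k then c.a j * c.a' l else 0) - (c.a j * c.a' k) * (c.a i * c.a' l) := by
    split_ifs <;> noncomm_ring
  rw [e, c.aa' j k, c.aa' i l, c.aa' j l]
  have e : ((if j = k then 1 else 0) - c.a' k * c.a j) * ((if i = l then 1 else 0) - c.a' l * c.a i)
    = (if j = k then if i = l then 1 else 0 else 0) - (if j = k then c.a' l * c.a i else 0)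
     - (if i = l then c.a' k * c.a j else 0) + c.a' k * (c.a j * c.a' l) * c.a i := by
    split_ifs <;> noncomm_ring
  rw [e, c.aa' j l]
  have e : c.a' k * ((if j = l then 1 else 0) - c.a' l * c.a j) * c.a i =
    (if j = l then c.a' k * c.a i else 0) - c.a' k * c.a' l * (c.a j * c.a i) := by
    split_ifs <;> noncomm_ring
  rw [e]
  split_ifs <;> simp <;> abel

lemma DD_term (i j k l : Fin N) :
    (c.b' i j * c.a j * c.a i) * (c.a' k * c.a' l * c.b k l) +
      (c.a' k * c.a' l * c.b k l) * (c.b' i j * c.a j * c.a i) =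
    c.b' i j * c.b k l * (c.a j * c.a i * (c.a' k * c.a' l) - c.a' k * c.a' l * (c.a j * c.a i))
     + ((if k = i then if l = j then c.a' k * c.a' l * (c.a j * c.a i) else 0 else 0)
        - (if k = j then if l = i then c.a' k * c.a' l * (c.a j * c.a i) else 0 else 0)) := by
  have h1 : c.a' k * c.a' l * c.b k l = c.b k l * (c.a' k * c.a' l) :=
    even_comm (c.ba' _ _ _) (c.ba' _ _ _)
  have h2 : c.a j * c.a i * c.b k l = c.b k l * (c.a j * c.a i) :=
    even_comm (c.ba _ _ _) (c.ba _ _ _)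
  have h3 : c.a' k * c.a' l * c.b' i j = c.b' i j * (c.a' k * c.a' l) :=
    even_comm (c.b'a' _ _ _) (c.b'a' _ _ _)
  have e1 : (c.b' i j * c.a j * c.a i) * (c.b k l * (c.a' k * c.a' l)) =
    c.b' i j * (c.a j * c.a i * c.b k l) * (c.a' k * c.a' l) := by noncomm_ring
  have e2 : c.b k l * (c.a' k * c.a' l) * (c.b' i j * c.a j * c.a i) =
    c.b k l * (c.a' k * c.a' l * c.b' i j) * (c.a j * c.a i) := by noncomm_ring
  rw [h1, e1, e2, h2, h3]
  have e3 : c.b k l * (c.b' i j * (c.a' k * c.a' l)) * (c.a j * c.a i) =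
    (c.b k l * c.b' i j) * (c.a' k * c.a' l * (c.a j * c.a i)) := by noncomm_ring
  rw [e3, c.bb' k l i j]
  split_ifs <;> noncomm_ring

lemma DD : c.D * c.D' + c.D' * c.D =
    2 * (∑ i, ∑ j, c.b' i j * c.b i j) - 4 * (∑ i, ∑ j, ∑ l, c.b' i j * c.b i l * (c.a' l * c.a j))
     + 2 * ∑ i, ∑ j, c.a' i * c.a' j * (c.a j * c.a i) := by
  have e : c.D * c.D' + c.D' * c.D = ∑ i, ∑ j, ∑ k, ∑ l,
     ((c.b' i j * c.a j * c.a i) * (c.a' k * c.a' l * c.b k l) +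
      (c.a' k * c.a' l * c.b k l) * (c.b' i j * c.a j * c.a i)) := by
    simp only [sum_add_distrib]
    congr 1
    · simp only [D, D', sum_mul]
      simp only [mul_sum]
    · rw [sum4_comm]
      simp only [D, D', sum_mul]
      simp only [mul_sum]
  rw [e]
  simp only [DD_term, normal_a]
  have ht : ∀ i j k l : Fin N, c.b' i j * c.b k l *
      ((if i = k then if j = l then 1 else 0 else 0) - (if j = k then if i = l then 1 else 0 else 0)
      - (if i = k then c.a' l * c.a j else 0) + (if j = k then c.a' l * c.a i else 0)
      + (if i = l then c.a' k * c.a j else 0) - (if j = l then c.a' k * c.a i else 0)) +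
       ((if k = i then if l = j then c.a' k * c.a' l * (c.a j * c.a i) else 0 else 0)
        - (if k = j then if l = i then c.a' k * c.a' l * (c.a j * c.a i) else 0 else 0)) =
      (if i = k then if j = l then c.b' i j * c.b k l else 0 else 0)
      + (if j = k then if i = l then c.b' i j * c.b l k else 0 else 0)
      - (if i = k then c.b' i j * c.b k l * (c.a' l * c.a j) else 0)
      - (if j = k then c.b' j i * c.b k l * (c.a' l * c.a i) else 0)
      - (if i = l then c.b' i j * c.b l k * (c.a' k * c.a j) else 0)
      - (if j = l then c.b' j i * c.b l k * (c.a' k * c.a i) else 0)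
      + (if i = k then if j = l then c.a' k * c.a' l * (c.a j * c.a i) else 0 else 0)
      + (if j = k then if i = l then c.a' l * c.a' k * (c.a j * c.a i) else 0 else 0) := by
    intro i j k l
    rw [c.bsymm l k, c.b'symm j i, c.a'a' l k]
    simp only [eq_comm (a := k), eq_comm (a := l)]
    split_ifs <;> noncomm_ring
  simp only [ht, sum_add_distrib, sum_sub_distrib]
  have s1 : ∀ f : Fin N → Fin N → Fin N → Fin N → R,
    (∑ i, ∑ j, ∑ k, ∑ l, if i = k then f i j k l else 0) = ∑ i, ∑ j, ∑ l, f i j i l := by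
    intro f
    refine sum_congr rfl fun i _ => sum_congr rfl fun j _ => ?_
    rw [sum_comm]; simp
  have s2 : ∀ f : Fin N → Fin N → Fin N → Fin N → R,
    (∑ i, ∑ j, ∑ k, ∑ l, if j = k then f i j k l else 0) = ∑ i, ∑ j, ∑ l, f i j j l := by
    intro f
    refine sum_congr rfl fun i _ => sum_congr rfl fun j _ => ?_
    rw [sum_comm]; simp
  simp only [s1, s2, sum_ite_eq, mem_univ, if_true]
  rw [sum_comm (f := fun i j => ∑ l, c.b' j i * c.b j l * (c.a' l * c.a i))]
  noncomm_ring

lemma AA : ∑ i, ∑ j, (c.a' i * c.a j) * (c.a' j * c.a i) =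
    N * (∑ i, c.a' i * c.a i) - ∑ i, ∑ j, c.a' i * c.a' j * (c.a j * c.a i) := by
  have : ∀ i j, (c.a' i * c.a j) * (c.a' j * c.a i) =
      c.a' i * c.a i - c.a' i * c.a' j * (c.a j * c.a i) := by
    intro i j
    have e : (c.a' i * c.a j) * (c.a' j * c.a i) = c.a' i * (c.a j * c.a' j) * c.a i := by
      noncomm_ring
    rw [e, c.aa', if_pos rfl]; noncomm_ring
  simp only [this, sum_sub_distrib]
  simp [mul_sum]

lemma BB (h2 : ∀ x : R, x + x = 0 → x = 0) :
    ∑ i, ∑ j, (∑ k, c.b' i k * c.b j k) * (∑ l, c.b' j l * c.b i l) =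
    (N - 1) * (∑ i, ∑ k, c.b' i k * c.b i k) := by
  have : ∀ i j k l, (c.b' i k * c.b j k) * (c.b' j l * c.b i l) =
      (if k = l then c.b' i k * c.b i l else 0)
       - (if j = l then if k = j then c.b' i k * c.b i l else 0 else 0)
       - c.b' i k * c.b' j l * (c.b j k * c.b i l) := by
    intro i j k l
    have e : (c.b' i k * c.b j k) * (c.b' j l * c.b i l) = 
       c.b' i k * (c.b j k * c.b' j l) * c.b i l := by
      noncomm_ring
    rw [e, c.bb', if_pos rfl]
    split_ifs <;> noncomm_ring
  simp only [sum_mul_sum]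
  simp only [this, sum_sub_distrib, c.quartic_zero h2, sub_zero]
  simp only [sum_ite_eq, mem_univ, if_true]
  simp [mul_sum, sub_mul]

lemma AB : ∑ i, ∑ j, (c.a' i * c.a j) * (∑ k, c.b' j k * c.b i k) =
    ∑ i, ∑ j, ∑ l, c.b' i j * c.b i l * (c.a' l * c.a j) := by
  rw [sum_comm]
  have : ∀ i j k, (c.a' i * c.a j) * (c.b' j k * c.b i k) =
      c.b' k j * c.b k i * (c.a' i * c.a j) := by
    intro i j k
    have h1 : c.a' i * c.a j * c.b i k = c.b i k * (c.a' i * c.a j) :=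
      even_comm (c.ba' _ _ _) (c.ba _ _ _)
    have h2 : c.a' i * c.a j * c.b' j k = c.b' j k * (c.a' i * c.a j) :=
      even_comm (c.b'a' _ _ _) (c.b'a _ _ _)
    rw [← mul_assoc, h2, mul_assoc, h1, c.b'symm k j, c.bsymm k i]; noncomm_ring
  simp only [mul_sum, this]
  conv_rhs => rw [sum_comm]
  refine sum_congr rfl fun j _ => ?_
  rw [sum_comm]

lemma BA : ∑ i, ∑ j, (∑ k, c.b' i k * c.b j k) * (c.a' j * c.a i) =
    ∑ i, ∑ j, ∑ l, c.b' i j * c.b i l * (c.a' l * c.a j) := by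
  rw [← AB, sum_comm]
  refine sum_congr rfl fun i _ => sum_congr rfl fun j _ => ?_
  rw [sum_mul, mul_sum]
  refine sum_congr rfl fun k _ => ?_
  have h1 : c.a' i * c.a j * c.b i k = c.b i k * (c.a' i * c.a j) :=
    even_comm (c.ba' _ _ _) (c.ba _ _ _)
  have h2 : c.a' i * c.a j * c.b' j k = c.b' j k * (c.a' i * c.a j) :=
    even_comm (c.b'a' _ _ _) (c.b'a _ _ _)
  rw [← mul_assoc (c.a' i * c.a j), h2, mul_assoc _ _ (c.b i k), h1, mul_assoc]

/-- The Laplacian is the Casimir. -/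
theorem casimir (h2 : ∀ x : R, x + x = 0 → x = 0) : c.D * c.D' + c.D' * c.D =
    2 * (N * (∑ i, c.Ee i i) - c.Cas) := by
  rw [DD]
  unfold Cas Ee
  simp only [add_mul, mul_add, sum_add_distrib, AA, BB c h2, AB, BA]
  noncomm_ring

end CAR
end JW
end

section
open Finset

namespace JW

set_option linter.unusedVariables false

/-- tableaux with row lengths `f`, entries `< N` -/
def tab (N : ℕ) (f : ℕ → ℕ) : Set (ℕ → ℕ → ℕ) :=
  {T | (∀ i j, f i ≤ j → T i j = 0) ∧ (∀ i j₁ j₂, j₁ < j₂ → j₂ < f i → T i j₁ ≤ T i j₂) ∧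
    (∀ i₁ i₂ j, i₁ < i₂ → j < f i₂ → T i₁ j < T i₂ j) ∧ (∀ i j, j < f i → T i j < N)}

def ext0 (N : ℕ) (g : Fin N → ℕ) (i : ℕ) : ℕ := if h : i < N then g ⟨i, h⟩ else 0

lemma downset_range (s : Finset ℕ) (h : ∀ i j, i ≤ j → j ∈ s → i ∈ s) (j : ℕ) :
    j < s.card ↔ j ∈ s := by
  constructor
  · intro hj
    by_contra hn
    have : s ⊆ range j := fun x hx => by
      rw [mem_range]; by_contra hx'; exact hn (h j x (not_lt.1 hx') hx)
    have := card_le_card this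
    simp at this; omega
  · intro hj
    have : range (j + 1) ⊆ s := fun x hx => h x j (by simp at hx; omega) hj
    have := card_le_card this
    simp at this; omega

lemma tab_empty (N : ℕ) (g : ℕ → ℕ) (hg : Antitone g) (h : g N ≠ 0) (T) (hT : T ∈ tab N g) :
    False := by
  obtain ⟨h1, h2, h3, h4⟩ := hT
  have key : ∀ i, i ≤ N → i ≤ T i 0 := by
    intro i
    induction i with
    | zero => simp
    | succ i ih =>
      intro hi
      have := ih (by omega)
      have := h3 i (i + 1) 0 (by omega) (by have := hg hi; omega)
      omega
  have := key N le_rfl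
  have := h4 N 0 (by omega)
  omega

def glue (N : ℕ) (f g : ℕ → ℕ) (T : ℕ → ℕ → ℕ) (i j : ℕ) : ℕ :=
  if j < g i then T i j else if j < f i then N else 0

def gs (N : ℕ) (f : ℕ → ℕ) : Finset (Fin N → ℕ) :=
  Fintype.piFinset (fun i : Fin N => Icc (f (i + 1)) (f i))

lemma ext0_inter {N : ℕ} {f : ℕ → ℕ} (hN : f (N + 1) = 0) (hf : Antitone f) {g} (hg : g ∈ gs N f)
    (i : ℕ) (hi : i < N) : f (i + 1) ≤ ext0 N g i ∧ ext0 N g i ≤ f i := by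
  simp only [gs, Fintype.mem_piFinset, mem_Icc] at hg
  simp [ext0, hi, hg ⟨i, hi⟩]

lemma ext0_zero {N : ℕ} (g : Fin N → ℕ) (i : ℕ) (hi : N ≤ i) : ext0 N g i = 0 := by
  simp [ext0, not_lt.2 hi]

lemma ext0_le {N : ℕ} {f : ℕ → ℕ} (hN : f (N + 1) = 0) (hf : Antitone f) {g} (hg : g ∈ gs N f)
    (i : ℕ) : ext0 N g i ≤ f i := by
  by_cases hi : i < N
  · exact (ext0_inter hN hf hg i hi).2
  · rw [ext0_zero g i (by omega)]; omega

lemma ext0_ge {N : ℕ} {f : ℕ → ℕ} (hN : f (N + 1) = 0) (hf : Antitone f) {g} (hg : g ∈ gs N f)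
    (i : ℕ) : f (i + 1) ≤ ext0 N g i := by
  by_cases hi : i < N
  · exact (ext0_inter hN hf hg i hi).1
  · rw [ext0_zero g i (by omega)]; have := hf (show N + 1 ≤ i + 1 by omega); omega

lemma ext0_anti {N : ℕ} {f : ℕ → ℕ} (hN : f (N + 1) = 0) (hf : Antitone f) {g} (hg : g ∈ gs N f) :
    Antitone (ext0 N g) :=
  antitone_nat_of_succ_le fun i => (ext0_le hN hf hg (i+1)).trans (ext0_ge hN hf hg i)

lemma glue_mem {N : ℕ} {f : ℕ → ℕ} (hN : f (N + 1) = 0) (hf : Antitone f) {g} (hg : g ∈ gs N f)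
    {T} (hT : T ∈ tab N (ext0 N g)) : glue N f (ext0 N g) T ∈ tab (N + 1) f := by
  obtain ⟨h1, h2, h3, h4⟩ := hT
  have le := ext0_le hN hf hg
  have ge := ext0_ge hN hf hg
  refine ⟨?_, ?_, ?_, ?_⟩
  · intro i j h
    have := le i
    simp [glue, show ¬ j < ext0 N g i by omega, show ¬ j < f i by omega]
  · intro i j₁ j₂ h hj
    unfold glue
    have e1 : j₁ < f i := by omega
    by_cases c2 : j₂ < ext0 N g i
    · simp [c2, h.trans c2, h2 i j₁ j₂ h c2]
    · simp only [c2, hj, e1, if_true, if_false]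
      split_ifs with c1
      · exact (h4 i j₁ c1).le
      · exact le_rfl
  · intro i₁ i₂ j h hj
    have a1 : j < ext0 N g i₁ := by
      have := ge i₁
      have := hf (show i₁ + 1 ≤ i₂ from h)
      omega
    unfold glue
    simp only [a1, if_true, hj]
    split_ifs with c
    · exact h3 i₁ i₂ j h c
    · exact h4 i₁ j a1
  · intro i j hj
    unfold glue
    simp only [hj, if_true]
    split_ifs with c
    · have := h4 i j c; omega
    · omega

lemma glue_lt {N : ℕ} {f : ℕ → ℕ} (hN : f (N + 1) = 0) (hf : Antitone f) {g} (hg : g ∈ gs N f)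
    {T} (hT : T ∈ tab N (ext0 N g)) (i j : ℕ) :
    j < ext0 N g i ↔ j < f i ∧ glue N f (ext0 N g) T i j < N := by
  have le := ext0_le hN hf hg i
  constructor
  · intro h
    refine ⟨by omega, ?_⟩
    simp [glue, h, hT.2.2.2 i j h]
  · rintro ⟨h, h'⟩
    by_contra hc
    simp [glue, hc, h] at h'

lemma glue_bij {N : ℕ} {f : ℕ → ℕ} (hN : f (N + 1) = 0) (hf : Antitone f) :
    Function.Bijective (fun p : (Σ g : {g // g ∈ gs N f}, tab N (ext0 N g.1)) =>
      (⟨glue N f (ext0 N p.1.1) p.2.1, glue_mem hN hf p.1.2 p.2.2⟩ : tab (N + 1) f)) := by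
  constructor
  · rintro ⟨⟨g, hg⟩, ⟨T, hT⟩⟩ ⟨⟨g', hg'⟩, ⟨T', hT'⟩⟩ h
    simp only [Subtype.mk.injEq] at h
    have e : g = g' := by
      funext i
      have k : ∀ j, j < ext0 N g i ↔ j < ext0 N g' i := by
        intro j
        rw [glue_lt hN hf hg hT, glue_lt hN hf hg' hT', h]
      have : ext0 N g i = ext0 N g' i := by
        have := k (ext0 N g i); have := k (ext0 N g' i); omega
      simpa [ext0] using this
    subst e
    have : T = T' := by
      funext i j
      have h' := congrFun (congrFun h i) j
      unfold glue at h'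
      by_cases c : j < ext0 N g i
      · simpa [c] using h'
      · rw [hT.1 i j (not_lt.1 c), hT'.1 i j (not_lt.1 c)]
    subst this
    rfl
  · rintro ⟨T, hT⟩
    obtain ⟨h1, h2, h3, h4⟩ := id hT
    set G : ℕ → ℕ := fun i => ((range (f i)).filter (fun j => T i j < N)).card with hG
    have hGm : ∀ i j, j < G i ↔ j < f i ∧ T i j < N := by
      intro i j
      rw [hG]
      simp only
      rw [downset_range]
      · simp
      · intro a b hab hb
        simp only [mem_filter, mem_range] at hb ⊢
        rcases hab.eq_or_lt with rfl | hab
        · exact hb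
        · have := h2 i a b hab hb.1; omega
    have hle : ∀ i, G i ≤ f i := by
      intro i; by_contra hc
      have := (hGm i (f i)).1 (by omega); omega
    have hge : ∀ i, f (i + 1) ≤ G i := by
      intro i; by_contra hc
      have hh : G i < f (i+1) := by omega
      have a1 := h3 i (i+1) (G i) (by omega) hh
      have a2 := h4 (i + 1) _ hh
      have := (hGm i (G i)).2 ⟨by have := hf (show i ≤ i + 1 by omega); omega, by omega⟩
      omega
    have hGanti : Antitone G := antitone_nat_of_succ_le fun i => (hle (i+1)).trans (hge i)
    have hmem : (fun i j => if j < G i then T i j else 0) ∈ tab N G := by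
      refine ⟨fun i j h => by simp [not_lt.2 h], ?_, ?_, ?_⟩
      · intro i j₁ j₂ h h'
        simp only [h', h.trans h', if_true]
        exact h2 i j₁ j₂ h (by have := hle i; omega)
      · intro i₁ i₂ j h h'
        have : j < G i₁ := lt_of_lt_of_le h' (hGanti h.le)
        simp only [h', this, if_true]
        exact h3 i₁ i₂ j h (by have := hle i₂; omega)
      · intro i j h
        simp only [h, if_true]
        exact ((hGm i j).1 h).2
    have hGN : G N = 0 := by
      by_contra hc
      exact tab_empty N G hGanti hc _ hmem
    have hext : ext0 N (fun i : Fin N => G i) = G := by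
      funext i
      unfold ext0
      split_ifs with c
      · rfl
      · have := hGanti (show N ≤ i by omega); omega
    refine ⟨⟨⟨fun i => G i, ?_⟩, ⟨fun i j => if j < G i then T i j else 0, by rw [hext]; exact hmem⟩⟩, ?_⟩
    · simp only [gs, Fintype.mem_piFinset, mem_Icc]
      exact fun i => ⟨hge i, hle i⟩
    · simp only [Subtype.mk.injEq]
      rw [hext]
      funext i j
      unfold glue
      by_cases c : j < G i
      · simp [c]
      · simp only [c, if_false]
        split_ifs with c2
        · have := h4 i j c2
          have := hGm i j
          simp [c, c2] at this
          omega
        · rw [h1 i j (by omega)]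

lemma tab_zero {f : ℕ → ℕ} (hN : f 0 = 0) (hf : Antitone f) : tab 0 f = {fun _ _ => 0} := by
  have : ∀ i, f i = 0 := fun i => by have := hf (Nat.zero_le i); omega
  ext T
  simp only [tab, Set.mem_ofPred_eq, Set.mem_singleton_iff, this]
  constructor
  · rintro ⟨h, -⟩; funext i j; exact h i j (by omega)
  · rintro rfl; simp

lemma tab_finite (N : ℕ) : ∀ f : ℕ → ℕ, f N = 0 → Antitone f → Finite (tab N f) := by
  induction N with
  | zero => intro f h hf; rw [tab_zero h hf]; infer_instance
  | succ N ih =>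
    intro f h hf
    have : ∀ g : {g // g ∈ gs N f}, Finite (tab N (ext0 N g.1)) := fun g =>
      ih _ (ext0_zero _ _ le_rfl) (ext0_anti h hf g.2)
    exact Finite.of_surjective _ (glue_bij h hf).2

lemma tab_rec (N : ℕ) (f : ℕ → ℕ) (h : f (N + 1) = 0) (hf : Antitone f) :
    Nat.card (tab (N + 1) f) = ∑ g ∈ gs N f, Nat.card (tab N (ext0 N g)) := by
  have : ∀ g : {g // g ∈ gs N f}, Finite (tab N (ext0 N g.1)) := fun g =>
      tab_finite N _ (ext0_zero _ _ le_rfl) (ext0_anti h hf g.2)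
  rw [← Nat.card_congr (Equiv.ofBijective _ (glue_bij h hf)), Nat.card_sigma,
    Finset.sum_coe_sort (gs N f) (fun g => Nat.card (tab N (ext0 N g)))]

def dt (N : ℕ) (l : Fin N → ℕ) : ℤ := (Matrix.of fun r s : Fin N => ((l r).choose s : ℤ)).det

lemma sum_choose (a b i : ℕ) (h : a ≤ b) :
    ∑ m ∈ Ico a b, (m.choose i : ℤ) = (b.choose (i + 1) : ℤ) - a.choose (i + 1) := by
  induction b, h using Nat.le_induction with
  | base => simp
  | succ b h ih => rw [Finset.sum_Ico_succ_top h, ih, Nat.choose_succ_succ]; push_cast; ring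

lemma dt_rec (N : ℕ) (l : Fin (N + 1) → ℕ) (hl : Monotone l) :
    dt (N + 1) l = ∑ m ∈ Fintype.piFinset (fun j : Fin N => Ico (l j.castSucc) (l j.succ)), dt N m := by
  have h1 : dt (N + 1) l = (Matrix.of fun r s : Fin N =>
      ((l r.succ).choose (s + 1) : ℤ) - ((l r.castSucc).choose (s + 1))).det := by
    unfold dt
    set B : Matrix (Fin (N+1)) (Fin (N+1)) ℤ := Matrix.of fun r s =>
      Fin.cases ((l 0).choose s : ℤ)
        (fun r' => ((l r'.succ).choose s : ℤ) - ((l r'.castSucc).choose s)) r with hB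
    rw [Matrix.det_eq_of_forall_row_eq_smul_add_pred (B := B) (fun _ => 1)]
    · rw [Matrix.det_succ_column_zero, Fin.sum_univ_succ, Finset.sum_eq_zero]
      · simp only [hB, Matrix.of_apply]
        simp
        rfl
      · intro i _
        simp [hB]
    · intro j; simp [hB]
    · intro i j; simp [hB]
  rw [h1, ← Matrix.det_transpose]
  have h2 : ∀ m : Fin N → ℕ, dt N m = ∑ σ : Equiv.Perm (Fin N), (Equiv.Perm.sign σ : ℤ) *
      ∏ i, ((m i).choose (σ i) : ℤ) := by
    intro m
    unfold dt
    rw [← Matrix.det_transpose, Matrix.det_apply']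
    rfl
  simp only [h2]
  rw [Finset.sum_comm, Matrix.det_apply']
  refine Finset.sum_congr rfl fun σ _ => ?_
  rw [← Finset.mul_sum, ← Finset.prod_univ_sum (fun j : Fin N => Ico (l j.castSucc) (l j.succ))
    (fun i m => (m.choose (σ i) : ℤ))]
  congr 1
  refine Finset.prod_congr rfl fun i _ => ?_
  rw [sum_choose _ _ _ (hl (Fin.castSucc_lt_succ).le)]
  rfl

theorem tab_card (N : ℕ) : ∀ f : ℕ → ℕ, f N = 0 → Antitone f →
    (Nat.card (tab N f) : ℤ) = dt N (fun j => f (N - 1 - j) + j) := by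
  induction N with
  | zero => intro f h hf; rw [tab_zero h hf]; simp [dt]
  | succ N ih =>
    intro f h hf
    rw [tab_rec N f h hf, dt_rec]
    · push_cast
      refine Finset.sum_nbij' (fun g j => g j.rev + j) (fun m i => m i.rev - i.rev) ?_ ?_ ?_ ?_ ?_
      · intro g hg
        simp only [gs, Fintype.mem_piFinset, mem_Icc, mem_Ico] at hg ⊢
        intro j
        have := hg j.rev
        simp only [Fin.val_rev, Fin.val_castSucc, Fin.val_succ] at this ⊢
        have e1 : N - (j:ℕ) = N - (j + 1) + 1 := by omega
        have e2 : N - ((j:ℕ) + 1) = N - (j + 1) := by omega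
        rw [e1]; omega
      · intro m hm
        simp only [gs, Fintype.mem_piFinset, mem_Icc, mem_Ico] at hm ⊢
        intro j
        have := hm j.rev
        simp only [Fin.val_rev, Fin.val_castSucc, Fin.val_succ] at this ⊢
        have e1 : N - (N - ((j:ℕ) + 1)) = j + 1 := by omega
        have e2 : N - ((N - ((j:ℕ) + 1)) + 1) = j := by omega
        rw [e1, e2] at this; omega
      · intro g hg
        funext i; simp
      · intro m hm
        simp only [Fintype.mem_piFinset, mem_Ico] at hm
        funext i
        have := hm i
        simp only [Fin.val_castSucc] at this
        simp only [Fin.rev_rev]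
        omega
      · intro g hg
        rw [ih _ (ext0_zero _ _ le_rfl) (ext0_anti h hf hg)]
        congr 1
        funext j
        have : N - 1 - (j:ℕ) < N := by omega
        simp only [ext0, this, dif_pos]
        congr 2
        ext
        simp only [Fin.val_rev]; omega
    · intro i j hij
      have := hf (show N + 1 - 1 - (j:ℕ) ≤ N + 1 - 1 - i by have : (i:ℕ) ≤ j := hij; omega)
      have : (i:ℕ) ≤ j := hij
      simp only; omega

lemma ssyt_eq (N : ℕ) (lam : YoungDiagram) : ssytCount N lam = Nat.card (tab N lam.rowLen) := by
  unfold ssytCount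
  refine Nat.card_congr ⟨fun T => ⟨fun i j => T.1 i j, ?_, ?_, ?_, ?_⟩,
    fun T => ⟨⟨T.1, ?_, ?_, ?_⟩, ?_⟩, ?_, ?_⟩
  · intro i j h
    exact T.1.zeros (by rw [YoungDiagram.mem_iff_lt_rowLen]; omega)
  · intro i j₁ j₂ h h'
    exact T.1.row_weak h (by rw [YoungDiagram.mem_iff_lt_rowLen]; omega)
  · intro i j₁ j₂ h h'
    exact T.1.col_strict h (by rw [YoungDiagram.mem_iff_lt_rowLen]; omega)
  · intro i j h
    exact T.2 i j (by rw [YoungDiagram.mem_iff_lt_rowLen]; omega)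
  · intro i j₁ j₂ h h'
    exact T.2.2.1 i _ _ h (by rw [YoungDiagram.mem_iff_lt_rowLen] at h'; omega)
  · intro i j₁ j₂ h h'
    exact T.2.2.2.1 _ _ _ h (by rw [YoungDiagram.mem_iff_lt_rowLen] at h'; omega)
  · intro i j h'
    exact T.2.1 _ _ (by rw [YoungDiagram.mem_iff_lt_rowLen] at h'; omega)
  · intro i j h'
    exact T.2.2.2.2 _ _ (by rw [YoungDiagram.mem_iff_lt_rowLen] at h'; omega)
  · intro T; rfl
  · intro T; rfl

lemma ssyt_zero (N : ℕ) (lam : YoungDiagram) (h : lam.rowLen N ≠ 0) : ssytCount N lam = 0 := by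
  rw [ssyt_eq]
  have : IsEmpty (tab N lam.rowLen) := ⟨fun T => tab_empty N _ (fun a b hab => lam.rowLen_anti a b hab) h T.1 T.2⟩
  simp

lemma ssyt_dt (N : ℕ) (lam : YoungDiagram) (h : lam.rowLen N = 0) :
    (ssytCount N lam : ℤ) = dt N (fun j => lam.rowLen (N - 1 - j) + j) := by
  rw [ssyt_eq, tab_card N _ h (fun a b hab => lam.rowLen_anti a b hab)]

end JW
end

section
open Finset Matrix

namespace JW

/-- unordered pairs -/
def Edge (N : ℕ) : Type := Sym2 (Fin N)

instance (N : ℕ) : Fintype (Edge N) := inferInstanceAs (Fintype (Sym2 (Fin N)))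

noncomputable instance (N : ℕ) : LinearOrder (Edge N) :=
  LinearOrder.lift' (Fintype.equivFin (Sym2 (Fin N))) (Fintype.equivFin (Sym2 (Fin N))).injective

def ed {N : ℕ} (i j : Fin N) : Edge N := s(i, j)

lemma ed_symm {N : ℕ} (i j : Fin N) : ed i j = ed j i := Sym2.eq_swap

lemma ed_eq {N : ℕ} {i j k l : Fin N} : ed i j = ed k l ↔ (i = k ∧ j = l) ∨ (i = l ∧ j = k) := by
  exact Sym2.eq_iff

lemma ed_ind {N : ℕ} {p : Edge N → Prop} (h : ∀ i j, i ≤ j → p (ed i j)) (e : Edge N) : p e := by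
  induction e using Sym2.ind with
  | _ i j =>
    rcases le_total i j with h' | h'
    · exact h i j h'
    · have := h j i h'
      rw [ed_symm] at this; exact this

/-- sign -/
def ep {N : ℕ} (i j : Fin N) : ℤ := if i < j then 1 else if j < i then -1 else 0

lemma ep_symm {N : ℕ} (i j : Fin N) : ep i j = - ep j i := by
  unfold ep; split_ifs <;> first | rfl | omega

lemma ep_self {N : ℕ} (i : Fin N) : ep i i = 0 := by simp [ep]

lemma ep_sq {N : ℕ} (i j : Fin N) : ep i j * ep i j = if i = j then 0 else 1 := by
  unfold ep
  rcases lt_trichotomy i j with h | h | h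
  · simp [h, h.ne]
  · simp [h]
  · simp [h, h.ne', not_lt.2 h.le]

lemma anti_smul {R : Type} [Ring R] {x y : R} (h : x * y + y * x = 0) (m n : ℤ) :
    (m • x) * (n • y) = - ((n • y) * (m • x)) := by
  rw [smul_mul_smul_comm, smul_mul_smul_comm, eq_neg_of_add_eq_zero_left h, mul_comm n m, smul_neg]

noncomputable def carZ (N : ℕ) : CAR (Matrix (Finset (Edge N)) (Finset (Edge N)) ℤ) N where
  a i := cc (ed i i)
  a' i := (cc (ed i i))ᵀ
  b i j := ep i j • cc (ed i j)
  b' i j := ep i j • (cc (ed i j))ᵀ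
  aa i j := eq_neg_of_add_eq_zero_left (cc_anti _ _)
  a'a' i j := eq_neg_of_add_eq_zero_left (ccT_anti _ _)
  aa' i j := by
    rw [eq_sub_iff_add_eq, cc_mixed]; simp [ed_eq]
  bb i j k l := anti_smul (cc_anti _ _) _ _
  b'b' i j k l := anti_smul (ccT_anti _ _) _ _
  bb' i j k l := by
    have h := cc_mixed (ed i j) (ed k l)
    rw [eq_sub_iff_add_eq, smul_mul_smul_comm, smul_mul_smul_comm, mul_comm (ep k l), ← smul_add, h]
    by_cases hij : i = j
    · subst hij
      rw [ep_self]
      by_cases h1 : i = k <;> by_cases h2 : i = l <;> simp [h1, h2]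
    · by_cases h1 : i = k
      · subst h1
        by_cases h2 : j = l
        · subst h2
          simp [ep_sq, hij, Ne.symm hij]
        · have : ¬ j = i := Ne.symm hij
          simp [ed_eq, h2, this]
      · by_cases h2 : i = l
        · subst h2
          by_cases h3 : j = k
          · subst h3
            rw [ep_symm j i]
            simp [ep_sq, hij, ed_eq]
          · simp [ed_eq, h1, h3]
        · simp [ed_eq, h1, h2]
  ba i j k := by simpa using anti_smul (cc_anti (ed i j) (ed k k)) (ep i j) 1
  ba' i j k := by
    have h := cc_mixed (ed i j) (ed k k)
    by_cases hij : i = j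
    · subst hij; simp [ep_self]
    · rw [if_neg (by rw [ed_eq]; rintro (⟨rfl, rfl⟩ | ⟨rfl, rfl⟩) <;> exact hij rfl)] at h
      simpa using anti_smul h (ep i j) 1
  b'a i j k := by
    have h := cc_mixed (ed k k) (ed i j)
    by_cases hij : i = j
    · subst hij; simp [ep_self]
    · rw [if_neg (by rw [ed_eq]; rintro (⟨rfl, rfl⟩ | ⟨rfl, rfl⟩) <;> exact hij rfl), add_comm] at h
      simpa using anti_smul h (ep i j) 1
  b'a' i j k := by simpa using anti_smul (ccT_anti (ed i j) (ed k k)) (ep i j) 1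
  bsymm i j := by rw [ep_symm i j, ed_symm i j, neg_smul]
  b'symm i j := by rw [ep_symm i j, ed_symm i j, neg_smul]

end JW
end

section
open Finset Matrix

namespace JW

lemma sum_ed {N : ℕ} {M : Type} [AddCommGroup M] (f : Edge N → M) :
    ∑ i, ∑ j, (if i = j then (2:ℤ) else 1) • f (ed i j) = (2:ℤ) • ∑ e, f e := by
  rw [← Fintype.sum_prod_type' (f := fun i j => (if i = j then (2:ℤ) else 1) • f (ed i j)),
    ← Finset.sum_fiberwise (s := univ) (g := fun p : Fin N × Fin N => ed p.1 p.2), Finset.smul_sum]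
  refine Finset.sum_congr rfl fun e _ => ?_
  induction e using ed_ind with
  | _ i j h =>
  have : (univ.filter fun p : Fin N × Fin N => ed p.1 p.2 = ed i j) = {(i, j), (j, i)} := by
    ext ⟨k, l⟩; simp [ed_eq]
  rw [this]
  by_cases hij : i = j
  · subst hij; simp
  · rw [Finset.sum_pair (by simp [hij])]
    simp only [hij, Ne.symm hij, if_false, one_smul, ed_symm j i]
    rw [two_smul]

namespace CAR
variable {R R' : Type} [Ring R] [Ring R'] {N : ℕ} (c : CAR R N)

def map (f : R →+* R') : CAR R' N where
  a i := f (c.a i)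
  a' i := f (c.a' i)
  b i j := f (c.b i j)
  b' i j := f (c.b' i j)
  aa i j := by rw [← map_mul, c.aa, map_neg, map_mul]
  a'a' i j := by rw [← map_mul, c.a'a', map_neg, map_mul]
  aa' i j := by rw [← map_mul, c.aa', map_sub, map_mul]; split_ifs <;> simp
  bb i j k l := by rw [← map_mul, c.bb, map_neg, map_mul]
  b'b' i j k l := by rw [← map_mul, c.b'b', map_neg, map_mul]
  bb' i j k l := by rw [← map_mul, c.bb', map_sub, map_sub, map_mul]; split_ifs <;> simp
  ba i j k := by rw [← map_mul, c.ba, map_neg, map_mul]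
  ba' i j k := by rw [← map_mul, c.ba', map_neg, map_mul]
  b'a i j k := by rw [← map_mul, c.b'a, map_neg, map_mul]
  b'a' i j k := by rw [← map_mul, c.b'a', map_neg, map_mul]
  bsymm i j := by rw [c.bsymm, map_neg]
  b'symm i j := by rw [c.b'symm, map_neg]

lemma map_D (f : R →+* R') : (c.map f).D = f c.D := by simp [D, map]
lemma map_D' (f : R →+* R') : (c.map f).D' = f c.D' := by simp [D', map]
lemma map_Ee (f : R →+* R') (i j) : (c.map f).Ee i j = f (c.Ee i j) := by simp [Ee, map]
lemma map_Cas (f : R →+* R') : (c.map f).Cas = f c.Cas := by simp [Cas, map_Ee]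

lemma D_a (k : Fin N) : c.a k * c.D = - (c.D * c.a k) := by
  unfold D
  simp only [mul_sum, sum_mul, ← sum_neg_distrib]
  refine sum_congr rfl fun i _ => sum_congr rfl fun j _ => ?_
  rw [← mul_assoc, ← mul_assoc, ← neg_eq_iff_eq_neg.2 (c.b'a i j k)]
  rw [neg_mul, neg_mul, neg_inj, mul_assoc _ (c.a k), c.aa k j, mul_neg, neg_mul, mul_assoc _ _ (c.a i),
    mul_assoc _ _ (c.a i), c.aa k i]
  noncomm_ring

lemma D_b' (k l : Fin N) : c.b' k l * c.D = - (c.D * c.b' k l) := by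
  unfold D
  simp only [mul_sum, sum_mul, ← sum_neg_distrib]
  refine sum_congr rfl fun i _ => sum_congr rfl fun j _ => ?_
  have h1 := c.b'a k l i
  have h2 := c.b'a k l j
  have h3 := c.b'b' k l i j
  calc c.b' k l * (c.b' i j * c.a j * c.a i) = (c.b' k l * c.b' i j) * c.a j * c.a i := by noncomm_ring
    _ = -(c.b' i j * (c.b' k l * c.a j) * c.a i) := by rw [h3]; noncomm_ring
    _ = (c.b' i j * c.a j * (c.b' k l * c.a i)) := by rw [h2]; noncomm_ring
    _ = _ := by rw [h1]; noncomm_ring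

lemma D_b (k l : Fin N) : c.b k l * c.D + c.D * c.b k l = c.a l * c.a k - c.a k * c.a l := by
  unfold D
  simp only [mul_sum, sum_mul, ← sum_add_distrib]
  have : ∀ i j, c.b k l * (c.b' i j * c.a j * c.a i) + c.b' i j * c.a j * c.a i * c.b k l =
      ((if k = i then if l = j then 1 else 0 else 0)
      - (if k = j then if l = i then 1 else 0 else 0)) * (c.a j * c.a i) := by
    intro i j
    have h1 := c.ba k l i
    have h2 := c.ba k l j
    have h3 := c.bb' k l i j
    rw [sub_eq_add_neg _ (c.b' i j * _), ← sub_eq_iff_eq_add] at h3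
    rw [← h3]
    have e : c.b' i j * c.a j * c.a i * c.b k l = c.b' i j * c.b k l * (c.a j * c.a i) := by
      calc c.b' i j * c.a j * c.a i * c.b k l = c.b' i j * c.a j * -(-(c.a i * c.b k l)) := by noncomm_ring
       _ = c.b' i j * -(c.a j * c.b k l) * c.a i := by rw [← h1]; noncomm_ring
       _ = _ := by rw [← h2]; noncomm_ring
    rw [e]; noncomm_ring
  simp only [this, sub_mul, sum_sub_distrib, ite_mul, zero_mul, one_mul]
  congr 1
  · rw [sum_eq_single k, sum_eq_single l] <;> simp +contextual [eq_comm]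
  · rw [sum_eq_single l, sum_eq_single k] <;> simp +contextual [eq_comm]

lemma D_sq (h2 : ∀ x : R, x + x = 0 → x = 0) : c.D * c.D = 0 := by
  apply h2
  have : c.D * c.D = - (c.D * c.D) := by
    conv_lhs => enter [1]; rw [D]
    conv_rhs => enter [1, 2]; rw [D]
    simp only [mul_sum, sum_mul, ← sum_neg_distrib]
    refine sum_congr rfl fun i _ => sum_congr rfl fun j _ => ?_
    calc c.b' i j * c.a j * c.a i * c.D = c.b' i j * c.a j * (c.a i * c.D) := by noncomm_ring
     _ = - (c.b' i j * (c.a j * c.D) * c.a i) := by rw [D_a]; noncomm_ring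
     _ = (c.b' i j * c.D) * c.a j * c.a i := by rw [D_a]; noncomm_ring
     _ = _ := by rw [D_b']; noncomm_ring
  exact eq_neg_iff_add_eq_zero.1 this

theorem d_sq (h2 : ∀ x : R, x + x = 0 → x = 0) (r : Fin N → R) (z : Fin N → Fin N → R)
    (hr : ∀ i j, r i * r j - r j * r i = - z i j)
    (hrz : ∀ i j k, r i * z j k = z j k * r i) (hzz : ∀ i j k l, z i j * z k l = z k l * z i j)
    (ra : ∀ i j, r i * c.a j = c.a j * r i) (rb : ∀ i j k, r i * c.b j k = c.b j k * r i)
    (rD : ∀ i, r i * c.D = c.D * r i)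
    (za : ∀ i j k, z i j * c.a k = c.a k * z i j) (zb : ∀ i j k l, z i j * c.b k l = c.b k l * z i j)
    (zD : ∀ i j, z i j * c.D = c.D * z i j) :
    (2 * ∑ i, r i * c.a i + ∑ i, ∑ j, z i j * c.b i j - c.D) *
    (2 * ∑ i, r i * c.a i + ∑ i, ∑ j, z i j * c.b i j - c.D) = 0 := by
  set α := ∑ i, r i * c.a i with hα
  set β := ∑ i, ∑ j, z i j * c.b i j with hβ
  have h1 : α * α + α * α = - ∑ i, ∑ j, z i j * (c.a i * c.a j) := by
    have e1 : α * α = ∑ i, ∑ j, r i * r j * (c.a i * c.a j) := by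
      rw [hα, sum_mul]
      refine sum_congr rfl fun i _ => ?_
      rw [mul_sum]
      refine sum_congr rfl fun j _ => ?_
      rw [mul_assoc, ← mul_assoc (c.a i), ← ra j i]; noncomm_ring
    have e2 : α * α = - ∑ i, ∑ j, r j * r i * (c.a i * c.a j) := by
      rw [e1, sum_comm, ← sum_neg_distrib]
      refine sum_congr rfl fun i _ => ?_
      rw [← sum_neg_distrib]
      refine sum_congr rfl fun j _ => ?_
      rw [c.aa j i]; noncomm_ring
    conv_lhs => enter [2]; rw [e2]
    rw [e1]
    simp only [← sum_neg_distrib, ← sum_add_distrib]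
    refine sum_congr rfl fun i _ => sum_congr rfl fun j _ => ?_
    rw [← sub_eq_add_neg, ← sub_mul, hr, neg_mul]
  have h3 : α * β + β * α = 0 := by
    have k : ∀ k, r k * c.a k * β + β * (r k * c.a k) = 0 := by
      intro k
      rw [hβ]
      simp only [mul_sum, sum_mul, ← sum_add_distrib]
      refine sum_eq_zero fun i _ => sum_eq_zero fun j _ => ?_
      rw [mul_assoc, ← mul_assoc (c.a k), ← za, mul_assoc (z i j), ← mul_assoc (r k), hrz,
        mul_assoc (z i j) (c.b i j), ← mul_assoc (c.b i j), ← rb, mul_assoc (r k), c.ba]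
      noncomm_ring
    clear_value β
    rw [hα, mul_sum, sum_mul, ← sum_add_distrib]
    exact sum_eq_zero fun i _ => k i
  have h4 : β * β = 0 := by
    apply h2
    have k : ∀ k l, z k l * c.b k l * β + β * (z k l * c.b k l) = 0 := by
      intro k l
      rw [hβ]
      simp only [mul_sum, sum_mul, ← sum_add_distrib]
      refine sum_eq_zero fun i _ => sum_eq_zero fun j _ => ?_
      rw [mul_assoc, ← mul_assoc (c.b k l), ← zb, mul_assoc (z i j), ← mul_assoc (z k l), hzz,
        mul_assoc (z i j) (c.b i j), ← mul_assoc (c.b i j), ← zb, mul_assoc (z k l), c.bb]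
      noncomm_ring
    have : β * β + β * β = ∑ i, ∑ j, (z i j * c.b i j * β + β * (z i j * c.b i j)) := by
      simp only [sum_add_distrib, ← mul_sum, ← sum_mul]; rfl
    rw [this]
    exact sum_eq_zero fun i _ => sum_eq_zero fun j _ => k i j
  have h5 : α * c.D + c.D * α = 0 := by
    rw [hα, sum_mul, mul_sum, ← sum_add_distrib]
    refine sum_eq_zero fun i _ => ?_
    rw [mul_assoc, D_a, ← mul_assoc c.D, ← rD]; noncomm_ring
  have h6 : β * c.D + c.D * β = - ∑ i, ∑ j, z i j * (c.a i * c.a j + c.a i * c.a j) := by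
    rw [hβ]
    simp only [mul_sum, sum_mul, ← sum_neg_distrib, ← sum_add_distrib]
    refine sum_congr rfl fun i _ => sum_congr rfl fun j _ => ?_
    rw [← mul_assoc, ← zD, mul_assoc, mul_assoc, ← mul_add, D_b, c.aa j i]; noncomm_ring
  have h7 := c.D_sq h2
  have : (2 * α + β - c.D) * (2 * α + β - c.D) = 2 * (α * α + α * α) + 2 * (α * β + β * α) + β * β
    - 2 * (α * c.D + c.D * α) - (β * c.D + c.D * β) + c.D * c.D := by noncomm_ring
  rw [this, h1, h3, h4, h5, h6, h7]
  simp only [mul_add, sum_add_distrib]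
  noncomm_ring

end CAR
end JW
end

section
open Finset Matrix

namespace JW
set_option linter.unusedSectionVars false

section act
variable (K : Type) [Field K] {X M : Type} [Fintype X] [DecidableEq X] [AddCommGroup M] [Module K M]

/-- integer matrices acting on vectors -/
def act : Matrix X X ℤ →+* Module.End K (X → M) where
  toFun A :=
    { toFun := fun v S => ∑ T, A S T • v T
      map_add' := fun v w => by funext S; simp [sum_add_distrib]
      map_smul' := fun r v => by
        funext S
        simp only [Pi.smul_apply, RingHom.id_apply, smul_sum]
        exact sum_congr rfl fun T _ => smul_comm _ _ _ }
  map_one' := by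
    refine LinearMap.ext fun v => funext fun S => ?_
    change ∑ T, (1 : Matrix X X ℤ) S T • v T = v S
    rw [sum_eq_single S] <;> simp +contextual [Matrix.one_apply, eq_comm]
  map_mul' A B := by
    refine LinearMap.ext fun v => funext fun S => ?_
    change ∑ T, (A * B) S T • v T = ∑ T, A S T • ∑ U, B T U • v U
    simp only [Matrix.mul_apply, sum_smul, smul_sum, smul_smul]
    rw [sum_comm]
  map_zero' := by
    refine LinearMap.ext fun v => funext fun S => ?_
    change ∑ T, (0 : Matrix X X ℤ) S T • v T = 0
    simp
  map_add' A B := by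
    refine LinearMap.ext fun v => funext fun S => ?_
    change ∑ T, (A + B) S T • v T = ∑ T, A S T • v T + ∑ T, B S T • v T
    simp [add_smul, sum_add_distrib]

lemma act_apply (A : Matrix X X ℤ) (v : X → M) (S : X) : act K A v S = ∑ T, A S T • v T := rfl

/-- pointwise operators -/
def pt : Module.End K M →+* Module.End K (X → M) where
  toFun f :=
    { toFun := fun v S => f (v S)
      map_add' := fun v w => by funext S; simp
      map_smul' := fun r v => by funext S; simp }
  map_one' := rfl
  map_mul' f g := rfl
  map_zero' := rfl
  map_add' f g := rfl

lemma pt_apply (f : Module.End K M) (v : X → M) (S : X) : pt K f v S = f (v S) := rfl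

lemma act_pt (A : Matrix X X ℤ) (f : Module.End K M) : act K A * pt K f = pt K f * act K A := by
  refine LinearMap.ext fun v => funext fun S => ?_
  simp only [Module.End.mul_apply, act_apply, pt_apply, map_sum, map_zsmul]

end act

section weyl
variable {R : Type} [Ring R] {N : ℕ}

lemma weyl_comm (x d u v : Fin N → R) (i j : Fin N)
    (xx : x i * x j = x j * x i) (dd : ∀ k l, d k * d l = d l * d k)
    (dx : ∀ k l, d k * x l = x l * d k + if k = l then 1 else 0)
    (ux : ∀ k l, u k * x l = x l * u k) (vx : ∀ k l, v k * x l = x l * v k)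
    (ud : ∀ k l, u k * d l = d l * u k) (vd : ∀ k l, v k * d l = d l * v k)
    (uv : ∀ k l, u k * v l = v l * u k) :
    (x i - ∑ k, u k * d k) * (x j - ∑ k, v k * d k) - (x j - ∑ k, v k * d k) * (x i - ∑ k, u k * d k)
      = v i - u j := by
  have h1 : (∑ k, u k * d k) * x j = x j * (∑ k, u k * d k) + u j := by
    simp only [mul_sum, sum_mul]
    have : ∀ k, u k * d k * x j = x j * (u k * d k) + if k = j then u k else 0 := by
      intro k
      rw [mul_assoc, dx, mul_add, ← mul_assoc, ux, mul_assoc]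
      split_ifs <;> simp
    simp [this, sum_add_distrib]
  have h2 : (∑ k, v k * d k) * x i = x i * (∑ k, v k * d k) + v i := by
    simp only [mul_sum, sum_mul]
    have : ∀ k, v k * d k * x i = x i * (v k * d k) + if k = i then v k else 0 := by
      intro k
      rw [mul_assoc, dx, mul_add, ← mul_assoc, vx, mul_assoc]
      split_ifs <;> simp
    simp [this, sum_add_distrib]
  have h3 : (∑ k, u k * d k) * (∑ k, v k * d k) = (∑ k, v k * d k) * (∑ k, u k * d k) := by
    rw [sum_mul_sum, sum_mul_sum, sum_comm]
    refine sum_congr rfl fun k _ => sum_congr rfl fun l _ => ?_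
    rw [mul_assoc, ← mul_assoc (d l), ← vd, mul_assoc (v k), ← mul_assoc, uv, dd l k, mul_assoc,
      ← mul_assoc (u l), ud, mul_assoc, mul_assoc]
  generalize (∑ k, u k * d k) = A at *
  generalize (∑ k, v k * d k) = B at *
  simp only [sub_mul, mul_sub, h1, h2, h3, xx]
  abel

end weyl

section ops
variable (K : Type) [Field K] (N : ℕ)

abbrev Sy := MvPolynomial (Edge N) K
abbrev Tot := Finset (Edge N) → Sy K N

variable {N}
noncomputable def mo (p : Sy K N) : Module.End K (Sy K N) := LinearMap.mulLeft K p
noncomputable def dv (e : Edge N) : Module.End K (Sy K N) := (MvPolynomial.pderiv e).toLinearMap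


lemma mo_apply (p q : Sy K N) : mo K p q = p * q := rfl
lemma dv_apply (e : Edge N) (q : Sy K N) : dv K e q = MvPolynomial.pderiv e q := rfl

lemma mo_mo (p q : Sy K N) : mo K p * mo K q = mo K q * mo K p := by
  refine LinearMap.ext fun r => ?_
  simp [mo, mul_left_comm]

lemma dv_dv (e f : Edge N) : dv K e * dv K f = dv K f * dv K e := by
  refine LinearMap.ext fun r => ?_
  simp only [Module.End.mul_apply, dv_apply]
  by_cases h : e = f
  · rw [h]
  ext m
  rw [MvPolynomial.coeff_pderiv, MvPolynomial.coeff_pderiv, MvPolynomial.coeff_pderiv,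
    MvPolynomial.coeff_pderiv, add_right_comm]
  simp [Finsupp.single_apply, h, Ne.symm h]
  ring

lemma dv_mo (e f : Edge N) : dv K e * mo K (MvPolynomial.X f) =
    mo K (MvPolynomial.X f) * dv K e + if e = f then 1 else 0 := by
  refine LinearMap.ext fun r => ?_
  simp only [Module.End.mul_apply, dv_apply, mo_apply, LinearMap.add_apply, Derivation.leibniz,
    MvPolynomial.pderiv_X, smul_eq_mul]
  by_cases h : e = f
  · subst h; simp
  · simp [h, Pi.single_apply, Ne.symm h]

noncomputable def uo (i j : Fin N) : Module.End K (Sy K N) :=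
  if j < i then mo K (MvPolynomial.X (ed i j)) else 0

noncomputable def Lo (i : Fin N) : Module.End K (Sy K N) :=
  mo K (MvPolynomial.X (ed i i)) - ∑ j, uo K i j * dv K (ed j j)
noncomputable def Ro (i : Fin N) : Module.End K (Sy K N) :=
  mo K (MvPolynomial.X (ed i i)) - ∑ j, uo K j i * dv K (ed j j)
noncomputable def zo (i j : Fin N) : Module.End K (Sy K N) :=
  ep i j • mo K (MvPolynomial.X (ed i j))

lemma uo_mo (i j : Fin N) (p : Sy K N) : uo K i j * mo K p = mo K p * uo K i j := by
  unfold uo; split_ifs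
  · exact mo_mo K _ _
  · simp

lemma uo_dv (i j k : Fin N) : uo K i j * dv K (ed k k) = dv K (ed k k) * uo K i j := by
  unfold uo; split_ifs with h
  · rw [dv_mo, if_neg, add_zero]
    rw [ed_eq]; rintro (⟨rfl, rfl⟩ | ⟨rfl, rfl⟩) <;> exact lt_irrefl _ h
  · simp

lemma uo_uo (i j k l : Fin N) : uo K i j * uo K k l = uo K k l * uo K i j := by
  rw [uo.eq_def K k l]; split_ifs
  · exact uo_mo K _ _ _
  · simp

lemma zo_uo (i j : Fin N) : zo K i j = uo K j i - uo K i j := by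
  unfold zo uo ep
  rcases lt_trichotomy i j with h | h | h
  · simp [h, not_lt.2 h.le, ed_symm]
  · simp [h]
  · simp [h, not_lt.2 h.le]

lemma dx_aux (k l : Fin N) : dv K (ed k k) * mo K (MvPolynomial.X (ed l l)) =
    mo K (MvPolynomial.X (ed l l)) * dv K (ed k k) + if k = l then 1 else 0 := by
  rw [dv_mo]; simp [ed_eq]

lemma Lo_Lo (i j : Fin N) : Lo K i * Lo K j - Lo K j * Lo K i = zo K i j := by
  rw [zo_uo]
  exact weyl_comm (fun i => mo K (MvPolynomial.X (ed i i))) (fun i => dv K (ed i i))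
    (fun k => uo K i k) (fun k => uo K j k) i j (mo_mo K _ _) (fun _ _ => dv_dv K _ _)
    (fun _ _ => dx_aux K _ _) (fun _ _ => uo_mo K _ _ _) (fun _ _ => uo_mo K _ _ _)
    (fun _ _ => uo_dv K _ _ _) (fun _ _ => uo_dv K _ _ _) (fun _ _ => uo_uo K _ _ _ _)

lemma Lo_Ro (i j : Fin N) : Lo K i * Ro K j = Ro K j * Lo K i := by
  rw [← sub_eq_zero, ← sub_self (uo K i j)]
  exact weyl_comm (fun i => mo K (MvPolynomial.X (ed i i))) (fun i => dv K (ed i i))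
    (fun k => uo K i k) (fun k => uo K k j) i j (mo_mo K _ _) (fun _ _ => dv_dv K _ _)
    (fun _ _ => dx_aux K _ _) (fun _ _ => uo_mo K _ _ _) (fun _ _ => uo_mo K _ _ _)
    (fun _ _ => uo_dv K _ _ _) (fun _ _ => uo_dv K _ _ _) (fun _ _ => uo_uo K _ _ _ _)

lemma Ro_Ro (i j : Fin N) : Ro K i * Ro K j - Ro K j * Ro K i = - zo K i j := by
  rw [zo_uo, neg_sub]
  exact weyl_comm (fun i => mo K (MvPolynomial.X (ed i i))) (fun i => dv K (ed i i))
    (fun k => uo K k i) (fun k => uo K k j) i j (mo_mo K _ _) (fun _ _ => dv_dv K _ _)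
    (fun _ _ => dx_aux K _ _) (fun _ _ => uo_mo K _ _ _) (fun _ _ => uo_mo K _ _ _)
    (fun _ _ => uo_dv K _ _ _) (fun _ _ => uo_dv K _ _ _) (fun _ _ => uo_uo K _ _ _ _)

lemma Ro_uo (i j k : Fin N) : Ro K i * uo K j k = uo K j k * Ro K i := by
  unfold Ro
  simp only [sub_mul, mul_sub, uo_mo, sum_mul, mul_sum]
  congr 1
  refine sum_congr rfl fun l _ => ?_
  rw [mul_assoc, ← uo_dv, ← mul_assoc, uo_uo, mul_assoc]

lemma Lo_uo (i j k : Fin N) : Lo K i * uo K j k = uo K j k * Lo K i := by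
  unfold Lo
  simp only [sub_mul, mul_sub, uo_mo, sum_mul, mul_sum]
  congr 1
  refine sum_congr rfl fun l _ => ?_
  rw [mul_assoc, ← uo_dv, ← mul_assoc, uo_uo, mul_assoc]

lemma Ro_zo (i j k : Fin N) : Ro K i * zo K j k = zo K j k * Ro K i := by
  simp only [zo_uo, sub_mul, mul_sub, Ro_uo]
lemma Lo_zo (i j k : Fin N) : Lo K i * zo K j k = zo K j k * Lo K i := by
  simp only [zo_uo, sub_mul, mul_sub, Lo_uo]
lemma zo_zo (i j k l : Fin N) : zo K i j * zo K k l = zo K k l * zo K i j := by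
  simp only [zo, smul_mul_smul_comm, mo_mo K (MvPolynomial.X (ed i j)), mul_comm (ep i j)]

variable (N)
/-- the CAR algebra acting on the total space -/
noncomputable def carT : CAR (Module.End K (Tot K N)) N := (carZ N).map (act K)

/-- total differential -/
noncomputable def dT : Module.End K (Tot K N) :=
  2 * ∑ i, pt K (Ro K i) * act K ((carZ N).a i) +
    ∑ i, ∑ j, pt K (zo K i j) * act K ((carZ N).b i j) - act K (carZ N).D

lemma end_two [CharZero K] {M : Type} [AddCommGroup M] [Module K M] (x : Module.End K M) (h : x + x = 0) : x = 0 := by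
  rw [← two_smul K] at h
  exact (smul_eq_zero.1 h).resolve_left two_ne_zero

lemma dT_sq [CharZero K] : dT K N * dT K N = 0 := by
  unfold dT
  have e : act K (carZ N).D = (carT K N).D := by
    unfold carT; rw [CAR.map_D]
  rw [e]
  have hD : ∀ f : Module.End K (Sy K N), pt K f * (carT K N).D =
     (carT K N).D * pt K f := fun f => by rw [← e, act_pt]
  exact CAR.d_sq (carT K N) (end_two K) (fun i => pt K (Ro K i)) (fun i j => pt K (zo K i j))
    (fun i j => by simp only [← map_mul, ← map_sub, ← map_neg, Ro_Ro])
    (fun i j k => by simp only [← map_mul, Ro_zo])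
    (fun i j k l => by simp only [← map_mul, zo_zo])
    (fun i j => (act_pt K _ _).symm) (fun i j k => (act_pt K _ _).symm) (fun i => hD _)
    (fun i j k => (act_pt K _ _).symm) (fun i j k l => (act_pt K _ _).symm) (fun i j => hD _)

lemma dT_Lo (k : Fin N) : dT K N * pt K (Lo K k) = pt K (Lo K k) * dT K N := by
  unfold dT
  rw [two_mul]
  simp only [add_mul, sub_mul, mul_add, mul_sub, sum_mul, mul_sum, act_pt, mul_assoc]
  simp only [← mul_assoc, ← map_mul, Lo_Ro, Lo_zo]

end ops
end JW
end

section
open Finset Matrix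

namespace JW
set_option linter.unusedSectionVars false
set_option linter.unusedSimpArgs false

section deg
variable {E : Type} [Fintype E] [LinearOrder E]

lemma Deg.mul {A B : Matrix (Finset E) (Finset E) ℤ} {a b a' b' : ℕ} (hA : Deg A a b)
    (hB : Deg B a' b') : Deg (A * B) (a + a') (b + b') := by
  intro S T h
  rw [Matrix.mul_apply] at h
  obtain ⟨U, -, hU⟩ := exists_ne_zero_of_sum_ne_zero h
  have h1 := hA S U (left_ne_zero_of_mul hU)
  have h2 := hB U T (right_ne_zero_of_mul hU)
  omega

lemma Deg.sum {ι : Type} {s : Finset ι} {A : ι → Matrix (Finset E) (Finset E) ℤ} {a b : ℕ}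
    (hA : ∀ i, Deg (A i) a b) : Deg (∑ i ∈ s, A i) a b := by
  intro S T h
  rw [Matrix.sum_apply] at h
  obtain ⟨U, -, hU⟩ := exists_ne_zero_of_sum_ne_zero h
  exact hA U S T hU

lemma Deg.smul {A : Matrix (Finset E) (Finset E) ℤ} {a b : ℕ} (hA : Deg A a b) (n : ℤ) :
    Deg (n • A) a b := by
  intro S T h
  exact hA S T (fun h' => h (by simp [h']))

lemma ccT_deg (e : E) : Deg (cc e)ᵀ 1 0 := by
  intro S T h
  have := cc_deg e T S h
  omega

end deg

lemma D_deg (N : ℕ) : Deg (carZ N).D 1 2 := by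
  unfold CAR.D
  refine Deg.sum fun i => Deg.sum fun j => ?_
  exact (((ccT_deg _).smul _).mul (cc_deg _)).mul (cc_deg _)

lemma D_empty (N : ℕ) (T : Finset (Edge N)) : (carZ N).D ∅ T = 0 := by
  unfold CAR.D
  simp only [Matrix.sum_apply]
  refine sum_eq_zero fun i _ => sum_eq_zero fun j _ => ?_
  rw [mul_assoc, Matrix.mul_apply]
  refine sum_eq_zero fun U _ => ?_
  have : (carZ N).b' i j ∅ U = 0 := by
    simp only [carZ, Matrix.smul_apply, transpose_apply, cc, of_apply]
    rw [if_neg, smul_zero]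
    rintro ⟨-, h⟩
    exact (insert_ne_empty _ _) h.symm
  rw [this, zero_mul]

section ops
variable (K : Type) [Field K] (N : ℕ)

noncomputable def d0 : Module.End K (Tot K N) := ∑ e, pt K (mo K (MvPolynomial.X e)) * act K (cc e)
noncomputable def d1 : Module.End K (Tot K N) :=
  - (2 * ∑ i, ∑ j, pt K (uo K j i * dv K (ed j j)) * act K (cc (ed i i))) - act K (carZ N).D
noncomputable def sT : Module.End K (Tot K N) := ∑ e, pt K (dv K e) * act K (cc e)ᵀ

lemma dT_eq : dT K N = 2 * d0 K N + d1 K N := by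
  have h := sum_ed (N := N) (fun e => (pt K (mo K (MvPolynomial.X e)) * act K (cc e) : Module.End K (Tot K N)))
  rw [two_smul, ← two_mul] at h
  unfold d0
  rw [← h]
  have : ∀ i j : Fin N, (if i = j then (2:ℤ) else 1) = (if i = j then 2 else 0) + ep i j * ep i j := by
    intro i j; rw [ep_sq]; split_ifs <;> rfl
  simp only [this, add_smul, sum_add_distrib]
  unfold dT d1 Ro
  have e1 : ∀ i j, pt K (zo K i j) * act K ((carZ N).b i j) =
     (ep i j * ep i j) • (pt K (mo K (MvPolynomial.X (ed i j))) * act K (cc (ed i j)) : Module.End K (Tot K N)) := by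
    intro i j
    simp only [zo, carZ, map_zsmul, smul_mul_smul_comm]
  simp only [e1]
  simp only [map_sub, sub_mul, sum_sub_distrib, mul_sub, map_sum, sum_mul]
  have e2 : ∑ i, ∑ j, (if i = j then (2:ℤ) else 0) • (pt K (mo K (MvPolynomial.X (ed i j))) * act K (cc (ed i j)) : Module.End K (Tot K N)) =
     2 * ∑ i, pt K (mo K (MvPolynomial.X (ed i i))) * act K ((carZ N).a i) := by
    rw [mul_sum]
    refine sum_congr rfl fun i _ => ?_
    simp only [ite_smul, zero_smul, sum_ite_eq, mem_univ, if_true, two_smul, two_mul]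
    rfl
  rw [e2]
  simp only [carZ]
  abel

lemma pt_act_mul {X M : Type} [Fintype X] [DecidableEq X] [AddCommGroup M] [Module K M]
    (f g : Module.End K M) (A B : Matrix X X ℤ) :
    (pt K f * act K A) * (pt K g * act K B) = pt K (f * g) * act K (A * B) := by
  rw [mul_assoc, ← mul_assoc (act K A), act_pt, map_mul, map_mul]; simp only [mul_assoc]

lemma act_diag {X M : Type} [Fintype X] [DecidableEq X] [AddCommGroup M] [Module K M]
    (f : X → ℤ) (v : X → M) (S : X) : act K (diagonal f) v S = f S • v S := by
  rw [act_apply, sum_eq_single S]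
  · rw [diagonal_apply_eq]
  · intro T _ h; rw [Matrix.diagonal_apply_ne _ h.symm, zero_smul]
  · simp

lemma d0_sT : d0 K N * sT K N + sT K N * d0 K N =
    ∑ e, pt K (mo K (MvPolynomial.X e) * dv K e) + ∑ e, act K ((cc e)ᵀ * cc e) := by
  unfold d0 sT
  rw [sum_mul_sum, sum_mul_sum, sum_comm, ← sum_add_distrib, ← sum_add_distrib]
  refine sum_congr rfl fun f _ => ?_
  rw [← sum_add_distrib]
  have : ∀ e, pt K (mo K (MvPolynomial.X e)) * act K (cc e) * (pt K (dv K f) * act K (cc f)ᵀ) +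
      pt K (dv K f) * act K (cc f)ᵀ * (pt K (mo K (MvPolynomial.X e)) * act K (cc e)) =
      if e = f then (pt K (mo K (MvPolynomial.X e) * dv K e) + act K ((cc e)ᵀ * cc e) : Module.End K (Tot K N)) else 0 := by
    intro e
    rw [pt_act_mul, pt_act_mul, dv_mo, map_add, add_mul, ← add_assoc, ← mul_add, ← map_add, cc_mixed]
    by_cases h : e = f
    · subst h; simp
    · simp [h, Ne.symm h]
  rw [sum_congr rfl fun e _ => this e]
  simp

lemma num_apply (v : Tot K N) (S : Finset (Edge N)) (m : Edge N →₀ ℕ) :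
    MvPolynomial.coeff m ((∑ e, pt K (mo K (MvPolynomial.X e) * dv K e) + ∑ e, act K ((cc e)ᵀ * cc e) :
      Module.End K (Tot K N)) v S) = (m.degree + S.card : ℕ) * MvPolynomial.coeff m (v S) := by
  simp only [LinearMap.add_apply, LinearMap.sum_apply, Pi.add_apply, Finset.sum_apply,
    MvPolynomial.coeff_add, MvPolynomial.coeff_sum, ccT_cc, pt_apply,
    Module.End.mul_apply, mo_apply, dv_apply]
  push_cast
  rw [add_mul]
  congr 1
  · have : ∀ e, MvPolynomial.coeff m (MvPolynomial.X e * MvPolynomial.pderiv e (v S)) =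
        (m e : K) * MvPolynomial.coeff m (v S) := by
      intro e
      rw [MvPolynomial.coeff_X_mul', MvPolynomial.coeff_pderiv]
      split_ifs with h
      · have h' : 1 ≤ m e := by
          have := Finsupp.mem_support_iff.1 h; omega
        rw [tsub_add_cancel_of_le (Finsupp.single_le_iff.2 h')]
        rw [Finsupp.tsub_apply, Finsupp.single_eq_same, Nat.cast_sub h']
        push_cast; ring
      · rw [Finsupp.notMem_support_iff.1 h]; simp
    rw [sum_congr rfl fun e _ => this e, ← sum_mul, Finsupp.degree_eq_sum]
    push_cast; rfl
  · simp only [act_diag, ite_smul, one_smul, zero_smul]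
    simp [apply_ite]

/-- filtration -/
def Gf (k : ℕ) (v : Tot K N) : Prop := ∀ S m, MvPolynomial.coeff m (v S) ≠ 0 → m.degree + S.card < k

/-- lowers filtration by `r` -/
def Lw (r : ℕ) (O : Module.End K (Tot K N)) : Prop := ∀ k v, Gf K N (k + r) v → Gf K N k (O v)

variable {K N}

lemma Gf.add {k v w} (hv : Gf K N k v) (hw : Gf K N k w) : Gf K N k (v + w) := by
  intro S m h
  by_cases h1 : MvPolynomial.coeff m (v S) = 0
  · by_cases h2 : MvPolynomial.coeff m (w S) = 0
    · simp [h1, h2] at h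
    · exact hw S m h2
  · exact hv S m h1

lemma Gf.neg {k v} (hv : Gf K N k v) : Gf K N k (-v) := by
  intro S m h; exact hv S m (fun h' => h (by simp [h']))

lemma Gf.sum {k} {ι : Type} {s : Finset ι} {v : ι → Tot K N} (hv : ∀ i, Gf K N k (v i)) : Gf K N k (∑ i ∈ s, v i) := by
  classical
  induction s using Finset.induction_on with
  | empty => intro S m h; simp at h
  | insert a s ha ih => rw [sum_insert ha]; exact (hv a).add ih

lemma Lw.add {r O O'} (h : Lw K N r O) (h' : Lw K N r O') : Lw K N r (O + O') :=
  fun k v hv => (h k v hv).add (h' k v hv)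

lemma Lw.neg {r O} (h : Lw K N r O) : Lw K N r (-O) := fun k v hv => (h k v hv).neg

lemma Lw.sum {r} {ι : Type} {s : Finset ι} {O : ι → Module.End K (Tot K N)} (h : ∀ i, Lw K N r (O i)) :
    Lw K N r (∑ i ∈ s, O i) := by
  intro k v hv
  rw [LinearMap.sum_apply]
  exact Gf.sum fun i => h i k v hv

lemma Lw.basic {r : ℕ} {f : Module.End K (Sy K N)} {A : Matrix (Finset (Edge N)) (Finset (Edge N)) ℤ} {a b a' b' : ℕ}
    (hf : ∀ p m, MvPolynomial.coeff m (f p) ≠ 0 → ∃ m', MvPolynomial.coeff m' p ≠ 0 ∧ m.degree + b = m'.degree + a)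
    (hA : Deg A a' b') (h : a + a' + r = b + b') : Lw K N r (pt K f * act K A) := by
  intro k v hv S m hm
  simp only [Module.End.mul_apply, pt_apply, act_apply, map_sum, map_zsmul, MvPolynomial.coeff_sum] at hm
  obtain ⟨T, -, hT⟩ := exists_ne_zero_of_sum_ne_zero hm
  have h1 : A S T ≠ 0 := fun h' => hT (by simp [h'])
  have h2 : MvPolynomial.coeff m (f (v T)) ≠ 0 := fun h' => hT (by
    rw [← MvPolynomial.coeffAddMonoidHom_apply, map_zsmul, MvPolynomial.coeffAddMonoidHom_apply, h', smul_zero])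
  obtain ⟨m', h3, h4⟩ := hf _ _ h2
  have := hA _ _ h1
  have := hv _ _ h3
  omega

lemma sT_lw : Lw K N 0 (sT K N) := by
  refine Lw.sum fun e => ?_
  refine Lw.basic (a := 0) (b := 1) ?_ (ccT_deg e) rfl
  intro p m h
  rw [dv_apply, MvPolynomial.coeff_pderiv] at h
  exact ⟨_, left_ne_zero_of_mul h, by simp⟩

lemma d1_lw : Lw K N 1 (d1 K N) := by
  unfold d1
  rw [two_mul, sub_eq_add_neg]
  have h1 : Lw K N 1 (∑ i, ∑ j, pt K (uo K j i * dv K (ed j j)) * act K (cc (ed i i))) := by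
    refine Lw.sum fun i => Lw.sum fun j => ?_
    refine Lw.basic (a := 1) (b := 1) ?_ (cc_deg _) rfl
    intro p m h
    rw [Module.End.mul_apply, dv_apply] at h
    unfold uo at h
    split_ifs at h
    · rw [mo_apply, MvPolynomial.coeff_X_mul'] at h
      split_ifs at h with h'
      · rw [MvPolynomial.coeff_pderiv] at h
        refine ⟨_, left_ne_zero_of_mul h, ?_⟩
        have h'' : 1 ≤ m (ed j i) := by
          have := Finsupp.mem_support_iff.1 h'; omega
        have := congrArg Finsupp.degree (tsub_add_cancel_of_le (Finsupp.single_le_iff.2 h''))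
        simp only [map_add, Finsupp.degree_single] at this ⊢
        omega
      · exact absurd rfl h
    · exact absurd rfl h
  have h2 : Lw K N 1 (act K (carZ N).D) := by
    have := Lw.basic (K := K) (f := 1) (a := 0) (b := 0) (r := 1) (fun p m h => ⟨m, h, rfl⟩) (D_deg N) rfl
    simpa using this
  exact ((h1.add h1).neg).add h2.neg

lemma coeff0_uo (i j : Fin N) (p : Sy K N) : MvPolynomial.coeff 0 (uo K i j p) = 0 := by
  unfold uo
  split_ifs
  · simp [mo_apply, MvPolynomial.coeff_X_mul']
  · simp

lemma coeff0_Ro (i : Fin N) (p : Sy K N) : MvPolynomial.coeff 0 (Ro K i p) = 0 := by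
  simp [Ro, LinearMap.sum_apply, MvPolynomial.coeff_sum, coeff0_uo, mo_apply, MvPolynomial.coeff_X_mul']

lemma coeff0_Lo (i : Fin N) (p : Sy K N) : MvPolynomial.coeff 0 (Lo K i p) = 0 := by
  simp [Lo, LinearMap.sum_apply, MvPolynomial.coeff_sum, coeff0_uo, mo_apply, MvPolynomial.coeff_X_mul']

lemma coeff0_zo (i j : Fin N) (p : Sy K N) : MvPolynomial.coeff 0 (zo K i j p) = 0 := by
  simp [zo_uo, coeff0_uo]

lemma dT_apply (w : Tot K N) (S : Finset (Edge N)) : dT K N w S =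
    2 * ∑ i, Ro K i (act K ((carZ N).a i) w S) + ∑ i, ∑ j, zo K i j (act K ((carZ N).b i j) w S)
      - act K (carZ N).D w S := by
  simp [dT, two_mul, LinearMap.sum_apply, pt_apply]

lemma coeff0_dT (w : Tot K N) (S : Finset (Edge N)) : MvPolynomial.coeff 0 (dT K N w S) =
    - MvPolynomial.coeff 0 (act K (carZ N).D w S) := by
  rw [dT_apply, two_mul]
  simp [MvPolynomial.coeff_sum, coeff0_Ro, coeff0_zo]

lemma aug_dT (w : Tot K N) : MvPolynomial.coeff 0 (dT K N w ∅) = 0 := by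
  rw [coeff0_dT, act_apply]
  simp [D_empty]

theorem dT_exact [CharZero K] (v : Tot K N) (h : dT K N v = 0) (h0 : MvPolynomial.coeff 0 (v ∅) = 0) :
    ∃ w, dT K N w = v := by
  have key : ∀ k, ∀ v, Gf K N k v → dT K N v = 0 → MvPolynomial.coeff 0 (v ∅) = 0 → ∃ w, dT K N w = v := by
    intro k
    induction k with
    | zero =>
      intro v hv _ _
      refine ⟨0, ?_⟩
      rw [map_zero]
      funext S; ext m
      by_contra hc
      have := hv S m (by simpa using Ne.symm hc)
      omega
    | succ k ih =>
      intro v hv hd h0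
      rcases Nat.eq_zero_or_pos k with rfl | hk
      · refine ⟨0, ?_⟩
        rw [map_zero]
        funext S; ext m
        by_contra hc
        have hc' : MvPolynomial.coeff m (v S) ≠ 0 := by simpa using Ne.symm hc
        have := hv S m hc'
        have h1 : S = ∅ := by rw [← card_eq_zero]; omega
        have h2 : m = 0 := by rw [← Finsupp.degree_eq_zero_iff]; omega
        subst h1; subst h2
        exact hc' h0
      · set w' := dT K N (sT K N v) - (2 * k : K) • v with hw'
        have e1 : w' = (2:K) • ((d0 K N * sT K N + sT K N * d0 K N) v - (k:K) • v) +
            (d1 K N (sT K N v) + sT K N (d1 K N v)) := by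
          have : dT K N (sT K N v) = dT K N (sT K N v) + sT K N (dT K N v) := by rw [hd]; simp
          rw [hw', this, dT_eq]
          simp only [LinearMap.add_apply, Module.End.mul_apply, two_mul, map_add, smul_sub, smul_add, two_smul, add_smul]
          abel
        have g1 : Gf K N k w' := by
          rw [e1]
          refine Gf.add ?_ ((d1_lw k _ (sT_lw _ _ hv)).add (sT_lw _ _ (d1_lw k _ hv)))
          intro S m h
          rw [d0_sT, Pi.smul_apply, Pi.sub_apply, MvPolynomial.coeff_smul, MvPolynomial.coeff_sub, num_apply,
            Pi.smul_apply, MvPolynomial.coeff_smul, smul_eq_mul, smul_eq_mul, ← sub_mul] at h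
          have h1 := right_ne_zero_of_mul (right_ne_zero_of_mul h)
          have h2 := left_ne_zero_of_mul (right_ne_zero_of_mul h)
          have := hv S m h1
          have : m.degree + S.card ≠ k := fun h3 => h2 (by rw [h3]; simp)
          omega
        have g2 : dT K N w' = 0 := by
          rw [hw', map_sub, map_smul, hd, smul_zero, sub_zero]
          exact LinearMap.congr_fun (dT_sq K N) _
        have g3 : MvPolynomial.coeff 0 (w' ∅) = 0 := by
          rw [hw', Pi.sub_apply, MvPolynomial.coeff_sub, aug_dT, Pi.smul_apply, MvPolynomial.coeff_smul, h0]; simp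
        obtain ⟨w, hw⟩ := ih w' g1 g2 g3
        have hk' : (2 * k : K) ≠ 0 := by
          have : (k:K) ≠ 0 := Nat.cast_ne_zero.2 hk.ne'
          exact mul_ne_zero two_ne_zero this
        refine ⟨(2 * k : K)⁻¹ • (sT K N v - w), ?_⟩
        rw [map_smul, map_sub, hw, hw', sub_sub_cancel, smul_smul, inv_mul_cancel₀ hk', one_smul]
  have : ∃ k, Gf K N k v := by
    refine ⟨(∑ S, ((v S).support.sup Finsupp.degree + S.card)) + 1, ?_⟩
    intro S m h
    have h1 : m.degree ≤ (v S).support.sup Finsupp.degree :=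
      Finset.le_sup (f := Finsupp.degree) (MvPolynomial.mem_support_iff.2 h)
    have h2 := Finset.single_le_sum (f := fun S => ((v S).support.sup Finsupp.degree + S.card))
      (fun _ _ => Nat.zero_le _) (mem_univ S)
    omega
  obtain ⟨k, hk⟩ := this
  exact key k v hk h h0

end ops
end JW
end

section
open Finset Matrix

namespace JW
set_option linter.unusedSectionVars false
set_option linter.unusedSimpArgs false

section words
variable {A : Type} [Ring A] (x : ℕ → A)

def Wd : ℕ → (ℕ → ℕ) → A
  | 0, _ => 1
  | k + 1, m => Wd k m * x k ^ m k

lemma Wd_congr (k : ℕ) (m m' : ℕ → ℕ) (h : ∀ j < k, m j = m' j) : Wd x k m = Wd x k m' := by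
  induction k with
  | zero => rfl
  | succ k ih => simp only [Wd]; rw [ih (fun j hj => h j (by omega)), h k (by omega)]

variable (hc : ∀ i j k, (x i * x j - x j * x i) * x k = x k * (x i * x j - x j * x i))

include hc in
lemma x_pow (i k p : ℕ) : x i * x k ^ p = x k ^ p * x i + p • ((x i * x k - x k * x i) * x k ^ (p - 1)) := by
  induction p with
  | zero => simp
  | succ p ih =>
    rw [pow_succ, ← mul_assoc, ih, add_mul]
    rcases Nat.eq_zero_or_pos p with rfl | hp
    · simp
    · obtain ⟨q, rfl⟩ : ∃ q, p = q + 1 := ⟨p - 1, by omega⟩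
      simp only [Nat.add_sub_cancel]
      rw [smul_mul_assoc, mul_assoc _ (x k ^ q), ← pow_succ, succ_nsmul _ (q + 1), mul_assoc (x k ^ (q+1)) (x k)]
      have : x k ^ (q + 1) * x i * x k = x k ^ (q+1) * (x k * x i) + (x i * x k - x k * x i) * x k ^ (q + 1) := by
        have h : Commute (x i * x k - x k * x i) (x k) := hc i k k
        rw [(h.pow_right (q+1)).eq]; noncomm_ring
      rw [this]; abel

include hc in
lemma x_Wd (i k : ℕ) (m : ℕ → ℕ) : x i * Wd x k m = Wd x k m * x i +
    ∑ j ∈ range k, m j • ((x i * x j - x j * x i) * Wd x k (Function.update m j (m j - 1))) := by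
  induction k with
  | zero => simp [Wd]
  | succ k ih =>
    rw [sum_range_succ]
    simp only [Wd]
    rw [← mul_assoc, ih, add_mul, mul_assoc _ (x i), x_pow x hc, mul_add, sum_mul]
    have h1 : Wd x k (Function.update m k (m k - 1)) = Wd x k m :=
      Wd_congr x _ _ _ fun j hj => Function.update_of_ne (by omega) _ _
    have h2 : ∀ j ∈ range k, (m j • ((x i * x j - x j * x i) * Wd x k (Function.update m j (m j - 1)))) * x k ^ m k =
       m j • ((x i * x j - x j * x i) * (Wd x k (Function.update m j (m j - 1)) * x k ^ (Function.update m j (m j - 1)) k)) := by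
      intro j hj
      rw [mem_range] at hj
      rw [Function.update_of_ne (by omega : k ≠ j), smul_mul_assoc, mul_assoc]
    rw [sum_congr rfl h2, h1, Function.update_self]
    have h3 : Commute (Wd x k m) (x i * x k - x k * x i) := by
      have : ∀ l, Commute (x i * x k - x k * x i) (Wd x l m) := by
        intro l
        induction l with
        | zero => exact Commute.one_right _
        | succ l ihl => exact ihl.mul_right (Commute.pow_right (hc i k l) _)
      exact (this k).symm
    rw [mul_smul_comm, ← mul_assoc (Wd x k m) (x i * x k - x k * x i), h3.eq]
    simp only [mul_assoc]
    abel

include hc in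
lemma x_Wd' (i k : ℕ) (m : ℕ → ℕ) (hk : i < k) : x i * Wd x k m = Wd x k (Function.update m i (m i + 1)) +
    ∑ j ∈ range i, m j • ((x i * x j - x j * x i) * Wd x k (Function.update m j (m j - 1))) := by
  induction k, hk using Nat.le_induction with
  | base =>
    simp only [Wd, Nat.succ_eq_add_one]
    rw [← mul_assoc, x_Wd x hc, add_mul, sum_mul]
    congr 1
    · rw [mul_assoc, Function.update_self, pow_succ', Wd_congr x i (Function.update m i (m i + 1)) m
        fun j hj => Function.update_of_ne (by omega) _ _]
    · refine sum_congr rfl fun j hj => ?_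
      rw [mem_range] at hj
      rw [Function.update_of_ne (by omega : i ≠ j), smul_mul_assoc, mul_assoc]
  | succ k hk ih =>
    simp only [Wd, Nat.succ_eq_add_one] at *
    rw [← mul_assoc, ih, add_mul, sum_mul, Function.update_of_ne (by omega)]
    congr 1
    refine sum_congr rfl fun j hj => ?_
    rw [mem_range] at hj
    rw [Function.update_of_ne (by omega : k ≠ j), smul_mul_assoc, mul_assoc]

end words

section psmod
variable (K : Type) [Field K] (N : ℕ)

abbrev Al := PS K (Fin N → K)

variable {N}
noncomputable def xg (i : Fin N) : Al K N :=
  RingQuot.mkAlgHom K (psRel K (Fin N → K)) (TensorAlgebra.ι K (Pi.single i 1))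

lemma mk_iota (v : Fin N → K) : RingQuot.mkAlgHom K (psRel K (Fin N → K)) (TensorAlgebra.ι K v) =
    ∑ i, v i • xg K i := by
  conv_lhs => rw [pi_eq_sum_univ' v]
  simp only [map_sum, map_smul]
  refine sum_congr rfl fun i _ => ?_
  unfold xg
  congr 4

variable {K} in
lemma Al_ind {p : Al K N → Prop} (h1 : ∀ r, p (algebraMap K _ r)) (h2 : ∀ i, p (xg K i))
    (h3 : ∀ a b, p a → p b → p (a * b)) (h4 : ∀ a b, p a → p b → p (a + b)) (a : Al K N) : p a := by
  obtain ⟨t, rfl⟩ := RingQuot.mkAlgHom_surjective K (psRel K (Fin N → K)) a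
  induction t using TensorAlgebra.induction with
  | algebraMap r => rw [AlgHom.commutes]; exact h1 r
  | ι v =>
    rw [mk_iota]
    have : ∀ s : Finset (Fin N), p (∑ i ∈ s, v i • xg K i) := by
      intro s
      induction s using Finset.induction_on with
      | empty => simpa using h1 0
      | insert i s hi ih =>
        rw [sum_insert hi, Algebra.smul_def]
        exact h4 _ _ (h3 _ _ (h1 _) (h2 _)) ih
    exact this _
  | mul a b ha hb => rw [map_mul]; exact h3 _ _ ha hb
  | add a b ha hb => rw [map_add]; exact h4 _ _ ha hb

lemma xg_comm (i j k : Fin N) : (xg K i * xg K j - xg K j * xg K i) * xg K k =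
    xg K k * (xg K i * xg K j - xg K j * xg K i) := by
  rw [← sub_eq_zero]
  have := RingQuot.mkAlgHom_rel K (s := psRel K (Fin N → K)) ⟨Pi.single i 1, Pi.single j 1, Pi.single k 1, rfl, rfl⟩
  simp only [Ring.lie_def, map_sub, map_mul, map_zero] at this
  exact this

lemma xg_central (i j : Fin N) (a : Al K N) : (xg K i * xg K j - xg K j * xg K i) * a =
    a * (xg K i * xg K j - xg K j * xg K i) := by
  induction a using Al_ind with
  | h1 r => exact (Algebra.commutes _ _).symm
  | h2 k => exact xg_comm K i j k
  | h3 a b ha hb => rw [← mul_assoc, ha, mul_assoc, hb, mul_assoc]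
  | h4 a b ha hb => rw [mul_add, add_mul, ha, hb]

variable (N)
noncomputable def piV : (Fin N → K) →ₗ[K] Module.End K (Sy K N) :=
  ∑ i, (LinearMap.proj i).smulRight (Lo K i)

lemma piV_apply (v : Fin N → K) : piV K N v = ∑ i, v i • Lo K i := by
  simp [piV, LinearMap.sum_apply]

noncomputable def piA : Al K N →ₐ[K] Module.End K (Sy K N) :=
  RingQuot.liftAlgHom K (s := psRel K (Fin N → K))
    ⟨TensorAlgebra.lift K (piV K N), by
      rintro a b ⟨x, y, z, rfl, rfl⟩
      simp only [Ring.lie_def, map_sub, map_mul, TensorAlgebra.lift_ι_apply, map_zero]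
      have h1 : piV K N x * piV K N y - piV K N y * piV K N x = ∑ i, ∑ j, (x i * y j) • zo K i j := by
        rw [piV_apply, piV_apply, sum_mul_sum, sum_mul_sum, sum_comm (s := univ) (t := univ) (f := fun j i => y j • Lo K j * x i • Lo K i)]
        simp only [← sum_sub_distrib]
        refine sum_congr rfl fun i _ => sum_congr rfl fun j _ => ?_
        rw [smul_mul_smul_comm, smul_mul_smul_comm, mul_comm (y j), ← Lo_Lo]
        exact (smul_sub _ _ _).symm
      rw [h1, sub_eq_zero, piV_apply]
      refine Commute.eq (Commute.sum_left _ _ _ fun i _ => Commute.sum_left _ _ _ fun j _ =>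
        Commute.sum_right _ _ _ fun k _ => ?_)
      have : Commute (zo K i j) (Lo K k) := (Lo_zo K k i j).symm
      exact (this.smul_left _).smul_right _⟩

variable {N}
lemma piA_xg (i : Fin N) : piA K N (xg K i) = Lo K i := by
  unfold piA xg
  rw [RingQuot.liftAlgHom_mkAlgHom_apply]
  simp only [TensorAlgebra.lift_ι_apply, piV_apply]
  rw [sum_eq_single i] <;> simp +contextual [Pi.single_apply]

lemma psAug_xg (i : Fin N) : psAug K (Fin N → K) (xg K i) = 0 := by
  unfold psAug xg
  rw [RingQuot.liftAlgHom_mkAlgHom_apply]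
  simp

end psmod
end JW
end

section
open Finset Matrix

namespace JW
set_option linter.unusedSectionVars false
set_option linter.unusedSimpArgs false

lemma gneg {M : Type*} [Ring M] (e : ℤ) (x : M) : (-e) • (-x) = e • x := by simp
lemma gneg1 {M : Type*} [Ring M] (x : M) : (-1 : ℤ) • x = -x := by simp
lemma gneg2 {M : Type*} [Ring M] (n : ℕ) (x : M) : n • (-x) = -(n • x) := by simp

lemma gneg3 {M : Type*} [Ring M] (c w z : M) (h : c * w = w * c) : w * ((-c) * z) = -(c * w * z) := by
  rw [h]; noncomm_ring

section phi
variable (K : Type) [Field K] {N : ℕ}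

noncomputable def xN (N : ℕ) (i : ℕ) : Al K N := if h : i < N then xg K ⟨i, h⟩ else 0

lemma xN_fin (i : Fin N) : xN K N i = xg K i := by simp [xN]

lemma xN_comm (i j k : ℕ) : (xN K N i * xN K N j - xN K N j * xN K N i) * xN K N k =
    xN K N k * (xN K N i * xN K N j - xN K N j * xN K N i) := by
  unfold xN
  split_ifs <;> first | exact xg_comm K _ _ _ | simp

noncomputable def cm (i j : Fin N) : Subalgebra.center K (Al K N) :=
  ⟨xg K i * xg K j - xg K j * xg K i, by
    rw [Subalgebra.mem_center_iff]
    intro b; exact (xg_central K i j b).symm⟩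

lemma cm_symm (i j : Fin N) : cm K i j = - cm K j i := by
  apply Subtype.ext
  simp [cm]

noncomputable def zc : Edge N → Subalgebra.center K (Al K N) :=
  Sym2.lift ⟨fun i j => if i = j then 1 else ep i j • cm K i j, by
    intro i j
    dsimp only
    rw [cm_symm K i j, ep_symm i j]
    rw [gneg (ep j i) (cm K j i)]
    by_cases h : i = j
    · rw [if_pos h, if_pos h.symm]
    · rw [if_neg h, if_neg (Ne.symm h)]⟩

lemma zc_diag (i : Fin N) : zc K (ed i i) = 1 := by
  simp [zc, ed]

lemma zc_lt (i j : Fin N) (h : j < i) : zc K (ed i j) = - cm K i j := by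
  simp [zc, ed, h.ne', ep, h, not_lt.2 h.le]
  exact gneg1 (cm K i j)

def dg (m : Edge N →₀ ℕ) (j : ℕ) : ℕ := if h : j < N then m (ed ⟨j, h⟩ ⟨j, h⟩) else 0

noncomputable def Zp (m : Edge N →₀ ℕ) : Subalgebra.center K (Al K N) := ∏ e, zc K e ^ m e

noncomputable def phiM (m : Edge N →₀ ℕ) : Al K N := Wd (xN K N) N (dg m) * (Zp K m : Al K N)

noncomputable def phi : Sy K N →ₗ[K] Al K N := (MvPolynomial.basisMonomials (Edge N) K).constr K (phiM K)

lemma phi_mono (m : Edge N →₀ ℕ) (c : K) : phi K (MvPolynomial.monomial m c) = c • phiM K m := by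
  have : MvPolynomial.monomial m c = c • (MvPolynomial.basisMonomials (Edge N) K m) := by
    simp [MvPolynomial.smul_monomial]
  rw [this, map_smul, phi, Module.Basis.constr_basis]

lemma Zp_add_diag (m : Edge N →₀ ℕ) (i : Fin N) : Zp K (m + Finsupp.single (ed i i) 1) = Zp K m := by
  unfold Zp
  refine prod_congr rfl fun e _ => ?_
  by_cases h : e = ed i i
  · subst h; simp [zc_diag]
  · simp [Finsupp.single_apply, Ne.symm h]

lemma Zp_sub_diag (m : Edge N →₀ ℕ) (i : Fin N) : Zp K (m - Finsupp.single (ed i i) 1) = Zp K m := by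
  unfold Zp
  refine prod_congr rfl fun e _ => ?_
  by_cases h : e = ed i i
  · subst h; simp [zc_diag]
  · simp [Finsupp.single_apply, Ne.symm h]

lemma Zp_add (m : Edge N →₀ ℕ) (e : Edge N) : Zp K (Finsupp.single e 1 + m) = zc K e * Zp K m := by
  unfold Zp
  simp only [Finsupp.add_apply, pow_add, prod_mul_distrib]
  congr 1
  rw [prod_eq_single e] <;> simp +contextual [Finsupp.single_apply, eq_comm]

lemma dg_add (m : Edge N →₀ ℕ) (i : Fin N) :
    dg (Finsupp.single (ed i i) 1 + m) = Function.update (dg m) i (dg m i + 1) := by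
  funext j
  by_cases h : j = i
  · subst h; simp [dg, add_comm]
  · rw [Function.update_of_ne h]
    unfold dg
    split_ifs with h'
    · have : ed i i ≠ ed ⟨j, h'⟩ ⟨j, h'⟩ := by
        rw [Ne, ed_eq]; rintro (⟨h1, h1⟩ | ⟨h1, h1⟩) <;> exact h (by rw [h1])
      simp [Finsupp.single_apply, this]
    · rfl

lemma dg_sub (m : Edge N →₀ ℕ) (i j : Fin N) (hij : i < j) :
    dg (Finsupp.single (ed j i) 1 + (m - Finsupp.single (ed i i) 1)) = Function.update (dg m) i (dg m i - 1) := by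
  have e : ∀ k : Fin N, ed j i ≠ ed k k := by
    intro k; rw [Ne, ed_eq]; rintro (⟨rfl, rfl⟩ | ⟨rfl, rfl⟩) <;> exact lt_irrefl _ hij
  funext j
  by_cases h : j = i
  · subst h; simp [dg, Finsupp.single_apply, e]
  · rw [Function.update_of_ne h]
    unfold dg
    split_ifs with h'
    · have : ed i i ≠ ed ⟨j, h'⟩ ⟨j, h'⟩ := by
        rw [Ne, ed_eq]; rintro (⟨h1, h1⟩ | ⟨h1, h1⟩) <;> exact h (by rw [h1])
      simp [Finsupp.single_apply, this, e]
    · rfl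

lemma phi_Lo (i : Fin N) (p : Sy K N) : phi K (Lo K i p) = xg K i * phi K p := by
  have : phi K ∘ₗ Lo K i = LinearMap.mulLeft K (xg K i) ∘ₗ phi K := by
    apply (MvPolynomial.basisMonomials (Edge N) K).ext
    intro m
    simp only [LinearMap.comp_apply, MvPolynomial.coe_basisMonomials, LinearMap.mulLeft_apply, phi_mono, one_smul]
    unfold Lo
    simp only [LinearMap.sub_apply, LinearMap.sum_apply, Module.End.mul_apply, dv_apply, mo_apply,
      MvPolynomial.pderiv_monomial, one_mul, map_sub, map_sum]
    have e1 : phi K (MvPolynomial.X (ed i i) * MvPolynomial.monomial m 1) =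
        Wd (xN K N) N (Function.update (dg m) i (dg m i + 1)) * (Zp K m : Al K N) := by
      rw [MvPolynomial.X, MvPolynomial.monomial_mul, phi_mono, phiM, dg_add, add_comm (Finsupp.single (ed i i) 1) m, Zp_add_diag]
      simp
    have e2 : ∀ j : Fin N, phi K (uo K i j (MvPolynomial.monomial (m - Finsupp.single (ed j j) 1) (m (ed j j) : K))) =
       (fun j : ℕ => if j < i then - ((dg m j • ((xN K N i * xN K N j - xN K N j * xN K N i) *
          Wd (xN K N) N (Function.update (dg m) j (dg m j - 1)))) * (Zp K m : Al K N)) else 0) j := by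
      intro j
      unfold uo
      by_cases h : j < i
      · have h' : (j:ℕ) < i := h
        simp only [h, h', if_true]
        rw [mo_apply, MvPolynomial.X, MvPolynomial.monomial_mul, phi_mono, phiM, dg_sub m j i h, Zp_add,
          Zp_sub_diag, zc_lt K i j h, one_mul]
        have : dg m (j:ℕ) = m (ed j j) := by simp [dg]
        rw [this, xN_fin, xN_fin, smul_mul_assoc, Nat.cast_smul_eq_nsmul]
        refine Eq.trans ?_ (gneg2 _ _)
        congr 1
        exact gneg3 _ _ _ (xg_central K i j _)
      · have h' : ¬ (j:ℕ) < i := h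
        simp [h, h']
    rw [e1, sum_congr rfl fun j _ => e2 j, Fin.sum_univ_eq_sum_range (fun j : ℕ => if j < i then - ((dg m j • ((xN K N i * xN K N j - xN K N j * xN K N i) *
          Wd (xN K N) N (Function.update (dg m) j (dg m j - 1)))) * (Zp K m : Al K N)) else 0) N,
      ← sum_filter]
    have e3 : (range N).filter (· < (i:ℕ)) = range i := by
      ext j; simp only [mem_filter, mem_range]; omega
    rw [e3, phiM, ← mul_assoc, ← xN_fin, x_Wd' (xN K N) (xN_comm K) i N (dg m) i.2, add_mul, sum_mul,
      sum_neg_distrib, sub_neg_eq_add]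
  exact LinearMap.congr_fun this p

lemma phi_one : phi K (1 : Sy K N) = 1 := by
  have : (1 : Sy K N) = MvPolynomial.monomial 0 1 := rfl
  rw [this, phi_mono, phiM, one_smul]
  have : ∀ k, Wd (xN K N) k (dg (0 : Edge N →₀ ℕ)) = 1 := by
    intro k
    induction k with
    | zero => rfl
    | succ k ih => simp [Wd, ih, dg]
  simp [this, Zp]

lemma phi_piA (a : Al K N) (p : Sy K N) : phi K (piA K N a p) = a * phi K p := by
  induction a using Al_ind generalizing p with
  | h1 r => rw [AlgHom.commutes, ← Algebra.smul_def, Module.algebraMap_end_apply, map_smul]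
  | h2 i => rw [piA_xg, phi_Lo]
  | h3 a b ha hb => rw [map_mul, Module.End.mul_apply, ha, hb, mul_assoc]
  | h4 a b ha hb => rw [map_add, LinearMap.add_apply, map_add, ha, hb, add_mul]

lemma coeff0_piA (a : Al K N) (p : Sy K N) : MvPolynomial.coeff 0 (piA K N a p) =
    psAug K (Fin N → K) a * MvPolynomial.coeff 0 p := by
  induction a using Al_ind generalizing p with
  | h1 r => rw [AlgHom.commutes, AlgHom.commutes, Module.algebraMap_end_apply, MvPolynomial.coeff_smul]; rfl
  | h2 i => rw [piA_xg, psAug_xg, coeff0_Lo, zero_mul]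
  | h3 a b ha hb => rw [map_mul, Module.End.mul_apply, ha, hb, map_mul, mul_assoc]
  | h4 a b ha hb => rw [map_add, LinearMap.add_apply, MvPolynomial.coeff_add, ha, hb, map_add, add_mul]

lemma piA_surj (p : Sy K N) : ∃ a, piA K N a 1 = p := by
  have hz : ∀ i j : Fin N, i ≠ j → ∀ p : Sy K N, (∃ a, piA K N a 1 = p) → ∃ a, piA K N a 1 = MvPolynomial.X (ed i j) * p := by
    rintro i j hij p ⟨a, rfl⟩
    refine ⟨ep i j • (xg K i * xg K j - xg K j * xg K i) * a, ?_⟩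
    have : ep i j * ep i j = 1 := by rw [ep_sq, if_neg hij]
    rw [map_mul, map_zsmul, map_sub, map_mul, map_mul, piA_xg, piA_xg, Lo_Lo, zo, smul_smul, this, one_smul]
    rfl
  have hadd : ∀ p q : Sy K N, (∃ a, piA K N a 1 = p) → (∃ a, piA K N a 1 = q) → ∃ a, piA K N a 1 = p + q := by
    rintro p q ⟨a, rfl⟩ ⟨b, rfl⟩
    exact ⟨a + b, by simp⟩
  have hsum : ∀ f : Fin N → Sy K N, (∀ i, ∃ a, piA K N a 1 = f i) → ∃ a, piA K N a 1 = ∑ i, f i := by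
    intro f hf
    choose a ha using hf
    exact ⟨∑ i, a i, by simp [LinearMap.sum_apply, ha]⟩
  have hm : ∀ n, ∀ m : Edge N →₀ ℕ, m.degree ≤ n → ∀ c : K, ∃ a, piA K N a 1 = MvPolynomial.monomial m c := by
    intro n
    induction n with
    | zero =>
      intro m hm c
      have : m = 0 := by rw [← Finsupp.degree_eq_zero_iff]; omega
      subst this
      refine ⟨algebraMap K _ c, ?_⟩
      rw [AlgHom.commutes, Module.algebraMap_end_apply, MvPolynomial.smul_eq_C_mul, mul_one]; rfl
    | succ n ih =>
      intro m hm c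
      by_cases h0 : m = 0
      · exact ih m (by simp [h0]) c
      obtain ⟨e, he⟩ := Finsupp.ne_iff.1 h0
      have he' : 1 ≤ m e := by simp at he; omega
      have e1 := tsub_add_cancel_of_le (Finsupp.single_le_iff.2 he')
      set m' := m - Finsupp.single e 1 with hm'
      have hd : m'.degree ≤ n := by
        have := congrArg Finsupp.degree e1
        simp only [map_add, Finsupp.degree_single] at this
        omega
      have e2 : MvPolynomial.monomial m c = MvPolynomial.X e * MvPolynomial.monomial m' c := by
        rw [MvPolynomial.X, MvPolynomial.monomial_mul, one_mul, add_comm, e1]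
      rw [e2]
      clear_value m'
      clear e1 e2 he he'
      induction e using ed_ind with
      | _ i j hij =>
      rcases hij.eq_or_lt with rfl | hij
      · obtain ⟨a, ha⟩ := ih m' hd c
        have : MvPolynomial.X (ed i i) * MvPolynomial.monomial m' c = Lo K i (MvPolynomial.monomial m' c) +
            ∑ j, uo K i j (MvPolynomial.monomial (m' - Finsupp.single (ed j j) 1) (c * (m' (ed j j)))) := by
          simp [Lo, LinearMap.sum_apply, mo_apply, dv_apply]
        rw [this]
        refine hadd _ _ ⟨xg K i * a, by rw [map_mul, piA_xg, Module.End.mul_apply, ha]⟩ (hsum _ fun j => ?_)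
        unfold uo
        split_ifs with h
        · refine hz i j h.ne' _ (ih _ (le_trans ?_ hd) _)
          exact Finsupp.degree_mono tsub_le_self
        · exact ⟨0, by simp⟩
      · exact hz i j hij.ne _ (ih _ hd _)
  induction p using MvPolynomial.induction_on' with
  | monomial m c => exact hm _ m le_rfl c
  | add p q hp hq => exact hadd _ _ hp hq

lemma piA_inj (a b : Al K N) (h : piA K N a 1 = piA K N b 1) : a = b := by
  have := congrArg (phi K) h
  simpa [phi_piA, phi_one] using this

end phi
end JW
end

section
open Finset Matrix

namespace JW
set_option linter.unusedSectionVars false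
set_option linter.unusedSimpArgs false

section Res
variable (K : Type) [Field K] (N : ℕ)

def Sm : Type := Sy K N
noncomputable instance : AddCommGroup (Sm K N) := inferInstanceAs (AddCommGroup (Sy K N))
noncomputable instance : Module K (Sm K N) := inferInstanceAs (Module K (Sy K N))
noncomputable instance : Module (Al K N) (Sm K N) :=
  letI : Module (Module.End K (Sy K N)) (Sm K N) := inferInstanceAs (Module (Module.End K (Sy K N)) (Sy K N))
  Module.compHom (Sm K N) (piA K N).toRingHom

lemma Sm_smul (a : Al K N) (p : Sm K N) : a • p = (piA K N a : Sy K N →ₗ[K] Sy K N) (p : Sy K N) := rfl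

noncomputable def SmEquiv : Al K N ≃ₗ[Al K N] Sm K N :=
  LinearEquiv.ofBijective (LinearMap.toSpanSingleton (Al K N) (Sm K N) (1 : Sy K N))
    ⟨fun a b h => piA_inj K a b h, fun p => piA_surj K p⟩

abbrev Tn (N n : ℕ) := {T : Finset (Edge N) // T.card = n}

abbrev Pn (n : ℕ) := Tn N n → Sm K N

instance (n : ℕ) : Module.Projective (Al K N) (Pn K N n) :=
  Module.Projective.of_equiv (LinearEquiv.piCongrRight fun _ : Tn N n => SmEquiv K N)

variable {K N}

noncomputable def ext' (n : ℕ) (v : Pn K N n) : Tot K N := fun S => if h : S.card = n then v ⟨S, h⟩ else (0 : Sy K N)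

def re (n : ℕ) (w : Tot K N) : Pn K N n := fun S => w S.1

lemma re_ext (n : ℕ) (v : Pn K N n) : re n (ext' n v) = v := by
  funext S; simp [re, ext', S.2]

lemma Deg_act {A : Matrix (Finset (Edge N)) (Finset (Edge N)) ℤ} {a b : ℕ} (h : Deg A a b) (w : Tot K N) (S : Finset (Edge N))
    (hw : ∀ T : Finset (Edge N), S.card + b = T.card + a → w T = 0) : act K A w S = 0 := by
  rw [act_apply]
  refine sum_eq_zero fun T _ => ?_
  by_cases hA : A S T = 0
  · rw [hA, zero_smul]
  · rw [hw T (h S T hA), smul_zero]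

lemma dT_loc (w : Tot K N) (S : Finset (Edge N)) (hw : ∀ T : Finset (Edge N), T.card = S.card + 1 → w T = 0) :
    dT K N w S = 0 := by
  rw [dT_apply]
  have h1 : ∀ i, act K ((carZ N).a i) w S = 0 := fun i =>
    Deg_act (cc_deg (ed i i)) w S fun T hT => hw T (by omega)
  have h2 : ∀ i j, act K ((carZ N).b i j) w S = 0 := fun i j =>
    Deg_act ((cc_deg (ed i j)).smul (ep i j)) w S fun T hT => hw T (by omega)
  have h3 : act K ((carZ N).D) w S = 0 := Deg_act (D_deg N) w S fun T hT => hw T (by omega)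
  simp [h1, h2, h3]

lemma dT_loc' (w w' : Tot K N) (S : Finset (Edge N)) (hw : ∀ T : Finset (Edge N), T.card = S.card + 1 → w T = w' T) :
    dT K N w S = dT K N w' S := by
  rw [← sub_eq_zero, ← Pi.sub_apply, ← map_sub]
  exact dT_loc _ _ fun T hT => by rw [Pi.sub_apply, hw T hT, sub_self]

lemma re_dT (n : ℕ) (w : Tot K N) : re n (dT K N (ext' (n+1) (re (n+1) w))) = re n (dT K N w) := by
  funext S
  refine dT_loc' _ _ _ fun T hT => ?_
  rw [S.2] at hT
  simp [ext', re, hT]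

lemma ext_dT (n : ℕ) (v : Pn K N (n+1)) : ext' n (re n (dT K N (ext' (n+1) v))) = dT K N (ext' (n+1) v) := by
  funext S
  by_cases h : S.card = n
  · simp [ext', re, h]
  · refine Eq.trans (dif_neg h) (dT_loc (ext' (n+1) v) S fun T hT => ?_).symm
    exact dif_neg (by omega)

lemma ext_add (n : ℕ) (v w : Pn K N n) : ext' n (v + w) = ext' n v + ext' n w := by
  funext S; by_cases h : S.card = n
  · simp [ext', h]; rfl
  · simp [ext', h]

lemma dT_piA (a : Al K N) (w : Tot K N) : dT K N (pt K (piA K N a) w) = pt K (piA K N a) (dT K N w) := by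
  induction a using Al_ind generalizing w with
  | h1 r =>
    have : ∀ w : Tot K N, pt K (piA K N (algebraMap K _ r)) w = r • w := by
      intro w; funext S; rw [pt_apply, AlgHom.commutes, Module.algebraMap_end_apply]; rfl
    rw [this, this, map_smul]
  | h2 i => rw [piA_xg]; exact LinearMap.congr_fun (dT_Lo K N i) w
  | h3 a b ha hb => simp only [map_mul, Module.End.mul_apply, ha, hb]
  | h4 a b ha hb => simp only [map_add, LinearMap.add_apply, ha, hb]

lemma ext_smul (n : ℕ) (a : Al K N) (v : Pn K N n) : ext' n (a • v) = pt K (piA K N a) (ext' n v) := by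
  funext S; by_cases h : S.card = n
  · simp [ext', h, pt_apply]; rfl
  · simp [ext', h, pt_apply]

variable (K N)
noncomputable def dP (n : ℕ) : Pn K N (n+1) →ₗ[Al K N] Pn K N n where
  toFun v := re n (dT K N (ext' (n+1) v))
  map_add' v w := by rw [ext_add, map_add]; rfl
  map_smul' a v := by rw [ext_smul, dT_piA]; rfl

noncomputable def aP : Pn K N 0 →ₗ[Al K N] K where
  toFun v := MvPolynomial.coeff 0 (v ⟨∅, rfl⟩ : Sy K N)
  map_add' _ _ := MvPolynomial.coeff_add _ _ _
  map_smul' a _ := coeff0_piA K a _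

lemma dP_apply (n : ℕ) (v : Pn K N (n+1)) : dP K N n v = re n (dT K N (ext' (n+1) v)) := rfl
lemma aP_apply (v : Pn K N 0) : aP K N v = MvPolynomial.coeff 0 (v ⟨∅, rfl⟩ : Sy K N) := rfl

lemma ext_zero (n : ℕ) : ext' n (0 : Pn K N n) = 0 := by
  funext S; by_cases h : S.card = n
  · simp [ext', h]; rfl
  · simp [ext', h]

lemma dP_dP [CharZero K] (n : ℕ) (v : Pn K N (n+1+1)) : dP K N n (dP K N (n+1) v) = 0 := by
  rw [dP_apply, dP_apply, re_dT]
  have := LinearMap.congr_fun (dT_sq K N) (ext' (n+1+1) v)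
  rw [Module.End.mul_apply] at this
  rw [this]; rfl

lemma dP_ex [CharZero K] (n : ℕ) (v : Pn K N (n+1)) (h : dP K N n v = 0) : ∃ w, dP K N (n+1) w = v := by
  obtain ⟨w, hw⟩ := dT_exact (ext' (n+1) v) (by
    rw [← ext_dT]; rw [← dP_apply, h, ext_zero]) (by simp [ext'])
  refine ⟨re (n+1+1) w, ?_⟩
  rw [dP_apply, re_dT, hw, re_ext]

lemma aP_ex [CharZero K] (v : Pn K N 0) (h : aP K N v = 0) : ∃ w, dP K N 0 w = v := by
  obtain ⟨w, hw⟩ := dT_exact (ext' 0 v) (by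
    funext S
    refine dT_loc _ _ fun T hT => ?_
    simp [ext', hT]) (by rw [aP_apply] at h; simpa [ext'] using h)
  refine ⟨re (0+1) w, ?_⟩
  rw [dP_apply, re_dT, hw, re_ext]

lemma aP_dP (v : Pn K N 1) : aP K N (dP K N 0 v) = 0 := by
  rw [aP_apply, dP_apply]; exact aug_dT _

lemma aP_surj : Function.Surjective (aP K N) := fun c => ⟨fun _ => (MvPolynomial.C c : Sy K N), MvPolynomial.coeff_zero_C c⟩

end Res
end JW
end

section
open Finset Matrix

namespace JW
set_option linter.unusedSectionVars false
set_option linter.unusedSimpArgs false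

section Res
open CategoryTheory
variable (K : Type) [Field K] [CharZero K] (N : ℕ)

noncomputable def cpx : ChainComplex (ModuleCat (Al K N)) ℕ :=
  ChainComplex.of (fun n => ModuleCat.of (Al K N) (Pn K N n)) (fun n => ModuleCat.ofHom (dP K N n)) (by
    intro n
    refine ModuleCat.hom_ext (LinearMap.ext fun v => ?_)
    exact dP_dP K N n v)

lemma cpx_d (n : ℕ) : (cpx K N).d (n+1) n = ModuleCat.ofHom (dP K N n) := by
  simp [cpx]

noncomputable def cpxπ : cpx K N ⟶ (ChainComplex.single₀ (ModuleCat (Al K N))).obj (ModuleCat.of (Al K N) K) :=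
  ((cpx K N).toSingle₀Equiv _).symm ⟨ModuleCat.ofHom (aP K N), by
    rw [cpx_d]
    refine ModuleCat.hom_ext (LinearMap.ext fun v => ?_)
    exact aP_dP K N v⟩

lemma cpx_quasi : QuasiIso (cpxπ K N) where
  quasiIsoAt m := by
    induction m with
    | zero =>
      rw [ChainComplex.quasiIsoAt₀_iff, ShortComplex.quasiIso_iff_of_zeros' _ rfl rfl rfl]
      constructor
      · rw [ShortComplex.moduleCat_exact_iff]
        intro v hv
        obtain ⟨w, hw⟩ := aP_ex K N v (by
          simpa [cpxπ, ChainComplex.toSingle₀Equiv] using! hv)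
        exact ⟨w, by simpa [cpx_d] using! hw⟩
      · rw [ModuleCat.epi_iff_surjective]
        simpa [cpxπ, ChainComplex.toSingle₀Equiv] using! aP_surj K N
    | succ m _ =>
      rw [quasiIsoAt_iff_exactAt' (hL := ChainComplex.exactAt_succ_single_obj ..),
          HomologicalComplex.exactAt_iff' _ (m + 2) (m + 1) m (by simp) (by simp)]
      rw [ShortComplex.moduleCat_exact_iff]
      intro v hv
      obtain ⟨w, hw⟩ := dP_ex K N m v (by simpa [cpx_d] using! hv)
      exact ⟨w, by simpa [cpx_d] using! hw⟩

noncomputable def reso : ProjectiveResolution (ModuleCat.of (Al K N) K) where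
  complex := cpx K N
  projective n := by
    change Projective (ModuleCat.of (Al K N) (Pn K N n))
    rw [← IsProjective.iff_projective]
    infer_instance
  π := cpxπ K N
  quasiIso := cpx_quasi K N

end Res
end JW
end

section
open Finset Matrix

namespace JW
set_option linter.unusedSectionVars false
set_option linter.unusedSimpArgs false

section Gen
open CategoryTheory
variable {K : Type} [Field K]

lemma fin_hom (S : ShortComplex (ModuleCat.{0} K)) {U : Type} [AddCommGroup U] [Module K U] [FiniteDimensional K U]
    (e : S.X₂ ≃ₗ[K] U) (p : U →ₗ[K] U) (hp : IsIdempotentElem p)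
    (h1 : ∀ u, S.g.hom (e.symm (p u)) = 0) (h2 : ∀ x, p (e (S.f.hom x)) = 0)
    (h3 : ∀ v, S.g.hom v = 0 → ∃ x, e v = p (e v) + e (S.f.hom x)) :
    (Module.finrank K S.homology : K) = LinearMap.trace K U p := by
  rw [(LinearMap.IsIdempotentElem.isProj_range p hp).trace]
  congr 1
  have e1 : Module.finrank K S.homology = Module.finrank K
      (LinearMap.ker S.g.hom ⧸ LinearMap.range S.moduleCatToCycles) :=
    (S.moduleCatHomologyIso).toLinearEquiv.finrank_eq
  rw [e1]
  have hk : LinearMap.ker (((p ∘ₗ e.toLinearMap).rangeRestrict) ∘ₗ (LinearMap.ker S.g.hom).subtype) =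
      LinearMap.range S.moduleCatToCycles := by
    ext v
    rw [LinearMap.mem_ker, LinearMap.mem_range, LinearMap.comp_apply, ← Subtype.coe_inj]
    simp only [LinearMap.codRestrict_apply, LinearMap.coe_comp, Function.comp_apply, Submodule.subtype_apply, LinearEquiv.coe_coe, ZeroMemClass.coe_zero]
    constructor
    · intro h
      obtain ⟨x, hx⟩ := h3 v.1 v.2
      refine ⟨x, Subtype.ext (e.injective ?_)⟩
      rw [hx]
      change e (S.f.hom x) = _
      erw [h]; simp
    · rintro ⟨x, rfl⟩
      exact h2 x
  have hs : Function.Surjective (((p ∘ₗ e.toLinearMap).rangeRestrict) ∘ₗ (LinearMap.ker S.g.hom).subtype) := by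
    rintro ⟨_, u, rfl⟩
    refine ⟨⟨e.symm (p (e u)), h1 _⟩, Subtype.ext ?_⟩
    simp only [LinearMap.codRestrict_apply, LinearMap.coe_comp, Function.comp_apply, Submodule.subtype_apply, LinearEquiv.coe_coe, LinearEquiv.apply_symm_apply]
    exact LinearMap.congr_fun hp _
  rw [← hk, (LinearMap.quotKerEquivOfSurjective _ hs).finrank_eq, LinearMap.range_comp_of_range_eq_top _ e.range]

end Gen

section Dual
open CategoryTheory
variable (K : Type) [Field K] [CharZero K] (N : ℕ)

lemma Al_smul_K (a : Al K N) (c : K) : a • c = psAug K (Fin N → K) a * c := rfl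

noncomputable def sm1 : Sm K N := (1 : Sy K N)
noncomputable def c0 (p : Sm K N) : K := MvPolynomial.coeff 0 (p : Sy K N)
lemma c0_one : c0 K N (sm1 K N) = 1 := MvPolynomial.coeff_zero_one
lemma c0_zero : c0 K N 0 = 0 := MvPolynomial.coeff_zero 0
lemma c0_add (p q) : c0 K N (p + q) = c0 K N p + c0 K N q := MvPolynomial.coeff_add _ _ _
lemma c0_smul (a : Al K N) (p) : c0 K N (a • p) = psAug K (Fin N → K) a * c0 K N p := coeff0_piA K a _
lemma sm1_surj (p : Sm K N) : ∃ a : Al K N, a • sm1 K N = p := piA_surj K p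
lemma coeff_int (z : ℤ) : MvPolynomial.coeff 0 (z • (1 : Sy K N)) = (z : K) := by
  rw [MvPolynomial.coeff_smul, MvPolynomial.coeff_zero_one]; simp

noncomputable def sgl (n : ℕ) (T : Tn N n) : Pn K N n := Pi.single T (sm1 K N)

noncomputable def efun (n : ℕ) : (ModuleCat.of (Al K N) (Pn K N n) ⟶ ModuleCat.of (Al K N) K) →ₗ[K] (Tn N n → K) where
  toFun f T := f.hom (sgl K N n T)
  map_add' f g := rfl
  map_smul' c f := by
    funext T
    change (algebraMap K (Al K N) c) • (f.hom (sgl K N n T) : K) = c * _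
    rw [Al_smul_K, AlgHom.commutes]; rfl

noncomputable def epre (n : ℕ) (c : Tn N n → K) : Pn K N n →ₗ[Al K N] K where
  toFun v := ∑ T, c T * c0 K N (v T)
  map_add' v w := by
    rw [← sum_add_distrib]
    exact sum_congr rfl fun T _ => by rw [← mul_add, Pi.add_apply, c0_add]
  map_smul' a v := by
    rw [RingHom.id_apply, Al_smul_K, mul_sum]
    refine sum_congr rfl fun T _ => ?_
    rw [Pi.smul_apply, c0_smul]; ring

lemma epre_sgl (n : ℕ) (c : Tn N n → K) (T : Tn N n) : epre K N n c (sgl K N n T) = c T := by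
  change ∑ T', c T' * c0 K N (sgl K N n T T') = c T
  rw [sum_eq_single T]
  · rw [sgl, Pi.single_eq_same, c0_one, mul_one]
  · intro T' _ h
    rw [sgl, Pi.single_eq_of_ne h, c0_zero, mul_zero]
  · simp

noncomputable def eequiv (n : ℕ) : (ModuleCat.of (Al K N) (Pn K N n) ⟶ ModuleCat.of (Al K N) K) ≃ₗ[K] (Tn N n → K) :=
  LinearEquiv.ofBijective (efun K N n) ⟨by
    rw [injective_iff_map_eq_zero]
    intro f hf
    apply ModuleCat.hom_ext
    refine LinearMap.pi_ext' fun T => LinearMap.ext fun p => ?_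
    obtain ⟨a, rfl⟩ := sm1_surj K N p
    have h1 : f.hom (sgl K N n T) = (0 : K) := congrFun hf T
    have h2 : (LinearMap.single (Al K N) (fun _ : Tn N n => Sm K N) T) (sm1 K N) = sgl K N n T := rfl
    rw [map_smul, map_smul, LinearMap.comp_apply, LinearMap.comp_apply, h2, h1]
    simp, fun c => ⟨ModuleCat.ofHom (epre K N n c), funext fun T => epre_sgl K N n c T⟩⟩

lemma eequiv_apply (n : ℕ) (f) (T : Tn N n) : eequiv K N n f T = f.hom (sgl K N n T) := rfl

lemma eequiv_symm (n : ℕ) (f) : (f : ModuleCat.of (Al K N) (Pn K N n) ⟶ ModuleCat.of (Al K N) K) = 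
    ModuleCat.ofHom (epre K N n (eequiv K N n f)) := by
  apply (eequiv K N n).injective
  funext T
  exact (epre_sgl K N n _ T).symm

/-- the integer matrix `D` with coefficients in `K` -/
noncomputable def DK : Matrix (Finset (Edge N)) (Finset (Edge N)) K := ((carZ N).D).map (Int.cast)

lemma eequiv_d (n : ℕ) (f : ModuleCat.of (Al K N) (Pn K N n) ⟶ ModuleCat.of (Al K N) K) (T : Tn N (n+1)) :
    eequiv K N (n+1) (ModuleCat.ofHom (dP K N n) ≫ f) T = - ∑ S : Tn N n, DK K N S.1 T.1 * eequiv K N n f S := by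
  rw [eequiv_apply]
  have h : (ModuleCat.ofHom (dP K N n) ≫ f).hom (sgl K N (n+1) T) = epre K N n (eequiv K N n f) (dP K N n (sgl K N (n+1) T)) := by
    conv_lhs => rw [eequiv_symm K N n f]
    rfl
  rw [h]
  change ∑ S, eequiv K N n f S * c0 K N (dP K N n (sgl K N (n+1) T) S) = _
  rw [← sum_neg_distrib]
  refine sum_congr rfl fun S _ => ?_
  have h2 : c0 K N (dP K N n (sgl K N (n+1) T) S) = - DK K N S.1 T.1 := by
    rw [dP_apply]
    refine Eq.trans (coeff0_dT _ _) ?_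
    rw [act_apply, sum_eq_single T.1]
    · have : ext' (n+1) (sgl K N (n+1) T) T.1 = 1 := by
        refine Eq.trans (dif_pos T.2) ?_
        exact Pi.single_eq_same _ _
      rw [this]
      exact congrArg Neg.neg (coeff_int K N _)
    · intro T' _ hT
      have : ext' (n+1) (sgl K N (n+1) T) T' = 0 := by
        by_cases h : T'.card = n+1
        · refine Eq.trans (dif_pos h) ?_
          exact Pi.single_eq_of_ne (fun h' => hT (congrArg Subtype.val h')) _
        · exact dif_neg h
      rw [this, smul_zero]
    · simp
  rw [h2]; ring

end Dual
end JW
end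

section
open Finset Matrix

namespace JW
set_option linter.unusedSectionVars false
set_option linter.unusedSimpArgs false

section ExtC
open CategoryTheory
variable (K : Type) [Field K] [CharZero K] (N : ℕ)

variable {K N} in
def xx (n : ℕ) (c : Tn N n → K) : Finset (Edge N) → K := fun S => if h : S.card = n then c ⟨S, h⟩ else 0
variable {K N} in
def rr (n : ℕ) (y : Finset (Edge N) → K) : Tn N n → K := fun S => y S.1

lemma rr_xx (n : ℕ) (c : Tn N n → K) : rr n (xx n c) = c := by
  funext S; simp [rr, xx, S.2]

lemma xx_rr (n : ℕ) (y : Finset (Edge N) → K) (h : ∀ S : Finset (Edge N), S.card ≠ n → y S = 0) : xx n (rr n y) = y := by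
  funext S
  by_cases hS : S.card = n
  · simp [rr, xx, hS]
  · simp [rr, xx, hS, h]

lemma xx_inj (n : ℕ) : Function.Injective (xx (K := K) (N := N) n) := fun a b h => by
  rw [← rr_xx K N n a, h, rr_xx]

lemma mulVec_xx (A : Matrix (Finset (Edge N)) (Finset (Edge N)) K) (n : ℕ) (c : Tn N n → K) (S : Finset (Edge N)) :
    (A *ᵥ xx n c) S = ∑ T : Tn N n, A S T.1 * c T := by
  have h := Fintype.sum_subtype_add_sum_subtype (fun T : Finset (Edge N) => T.card = n) (fun T => A S T * xx n c T)
  refine Eq.trans h.symm ?_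
  rw [sum_eq_zero (s := (univ : Finset {T : Finset (Edge N) // ¬ T.card = n})), add_zero]
  · refine sum_congr rfl fun T _ => ?_
    congr 1
    exact congrFun (rr_xx K N n c) T
  · intro T _
    have : xx n c T.1 = 0 := dif_neg T.2
    rw [this, mul_zero]

lemma DK_deg (S T : Finset (Edge N)) (h : DK K N S T ≠ 0) : T.card = S.card + 1 := by
  have := D_deg N S T (by intro h'; apply h; rw [DK, map_apply, h', Int.cast_zero])
  omega

lemma xx_d (n : ℕ) (f : ModuleCat.of (Al K N) (Pn K N n) ⟶ ModuleCat.of (Al K N) K) :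
    xx (n+1) (eequiv K N (n+1) (ModuleCat.ofHom (dP K N n) ≫ f)) = - ((DK K N)ᵀ *ᵥ xx n (eequiv K N n f)) := by
  funext T
  rw [Pi.neg_apply, mulVec_xx]
  by_cases hT : T.card = n + 1
  · have := eequiv_d K N n f ⟨T, hT⟩
    simp only [xx, hT, dite_true, transpose_apply]
    exact this
  · simp only [xx, hT, dite_false]
    rw [sum_eq_zero, neg_zero]
    intro S _
    rw [transpose_apply]
    by_cases h : DK K N S.1 T = 0
    · rw [h, zero_mul]
    · exact absurd (DK_deg K N S.1 T h) (by rw [S.2]; exact hT)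

noncomputable def cox : CochainComplex (ModuleCat K) ℕ := (cpx K N).linearYonedaObj K (ModuleCat.of (Al K N) K)

noncomputable def ee (n : ℕ) : (cox K N).X n ≃ₗ[K] (Tn N n → K) := eequiv K N n

lemma xx_dd (n : ℕ) (f : (cox K N).X n) : xx (n+1) (ee K N (n+1) (((cox K N).d n (n+1)).hom f)) =
    - ((DK K N)ᵀ *ᵥ xx n (ee K N n f)) := by
  refine Eq.trans ?_ (xx_d K N n f)
  rw [← cpx_d]; rfl

theorem ext_dim (n : ℕ) (P G : Matrix (Finset (Edge N)) (Finset (Edge N)) K)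
    (hP : P + (DK K N * (DK K N)ᵀ + (DK K N)ᵀ * DK K N) * G = 1) (hPP : P * P = P)
    (h1 : (DK K N)ᵀ * P = 0) (h2 : P * (DK K N)ᵀ = 0) (h3 : G * (DK K N)ᵀ = (DK K N)ᵀ * G)
    (hPd : ∀ S T, P S T ≠ 0 → S.card = T.card) (hGd : ∀ S T, G S T ≠ 0 → S.card = T.card) :
    (Module.finrank K
      (((Ext K (ModuleCat (Al K N)) n).obj
          (Opposite.op (ModuleCat.of (Al K N) K))).obj
        (ModuleCat.of (Al K N) K)) : K) = ∑ S : Tn N n, P S.1 S.1 := by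
  rw [((reso K N).isoExt n (ModuleCat.of (Al K N) K)).toLinearEquiv.finrank_eq]
  change (Module.finrank K ((cox K N).homology n) : K) = _
  set i := (ComplexShape.up ℕ).prev n with hi
  have e1 : (cox K N).homology n ≅ ((cox K N).sc' i n (n+1)).homology :=
    ShortComplex.homologyMapIso ((cox K N).isoSc' i n (n+1) rfl (by simp))
  rw [e1.toLinearEquiv.finrank_eq]
  set p := Matrix.toLin' (P.submatrix (Subtype.val : Tn N n → Finset (Edge N)) (Subtype.val : Tn N n → Finset (Edge N))) with hp
  have sup : ∀ (A : Matrix (Finset (Edge N)) (Finset (Edge N)) K), (∀ S T, A S T ≠ 0 → S.card = T.card) →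
      ∀ c : Tn N n → K, xx n (rr n (A *ᵥ xx n c)) = A *ᵥ xx n c := by
    intro A hA c
    refine xx_rr K N n _ fun S hS => ?_
    rw [mulVec_xx]
    refine sum_eq_zero fun T _ => ?_
    by_cases h : A S T.1 = 0
    · rw [h, zero_mul]
    · exact absurd ((hA _ _ h).trans T.2) hS
  have pa : ∀ c, xx n (p c) = P *ᵥ xx n c := by
    intro c
    rw [← sup P hPd c]
    congr 1
    funext S
    rw [rr, mulVec_xx]; rfl
  have hfi : ∀ x : (cox K N).X i, i + 1 = n ∨ ((cox K N).d i n).hom x = 0 := by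
    intro x
    by_cases h : i + 1 = n
    · exact Or.inl h
    · right
      rw [(cox K N).shape i n h]; rfl
  have H0 : IsIdempotentElem p := by
    apply LinearMap.ext
    intro c
    apply xx_inj
    rw [Module.End.mul_apply, pa, pa, mulVec_mulVec, hPP]
  have H1 : ∀ u, ((cox K N).d n (n+1)).hom ((ee K N n).symm (p u)) = 0 := by
    intro u
    apply (ee K N (n+1)).injective
    apply xx_inj
    refine (xx_dd K N n _).trans ?_
    rw [LinearEquiv.apply_symm_apply, pa, mulVec_mulVec, h1, zero_mulVec, map_zero, neg_zero]
    funext S; simp [xx]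
  have H2 : ∀ x, p (ee K N n (((cox K N).d i n).hom x)) = 0 := by
    intro x
    apply xx_inj
    rw [pa]
    have z : xx n (0 : Tn N n → K) = 0 := by funext S; simp [xx]
    rcases hfi x with h | h
    · clear_value i
      subst h
      rw [xx_dd, mulVec_neg, mulVec_mulVec, h2, zero_mulVec, neg_zero, z]
    · rw [h, map_zero, z, mulVec_zero]
  have H3 : ∀ v, ((cox K N).d n (n+1)).hom v = 0 →
      ∃ x : (cox K N).X i, ee K N n v = p (ee K N n v) + ee K N n (((cox K N).d i n).hom x) := by
    intro v hv
    have hv' : (DK K N)ᵀ *ᵥ xx n (ee K N n v) = 0 := by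
      have := xx_dd K N n v
      rw [hv, map_zero] at this
      rw [← neg_eq_zero, ← this]
      funext S; simp [xx]
    set y := xx n (ee K N n v) with hy
    have key : y = P *ᵥ y + (DK K N)ᵀ *ᵥ (DK K N *ᵥ (G *ᵥ y)) := by
      conv_lhs => rw [← one_mulVec y, ← hP]
      rw [add_mulVec, add_mul, add_mulVec, mul_assoc, ← h3, ← mulVec_mulVec y _ (G * _), ← mulVec_mulVec y G, hv']
      simp [mulVec_mulVec, mul_assoc]
    have hs : ∀ S : Finset (Edge N), S.card + 1 ≠ n → (DK K N *ᵥ (G *ᵥ y)) S = 0 := by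
      intro S hS
      rw [hy, ← sup G hGd, mulVec_xx]
      refine sum_eq_zero fun T _ => ?_
      by_cases h : DK K N S T.1 = 0
      · rw [h, zero_mul]
      · exact absurd ((DK_deg K N _ _ h).symm.trans T.2) hS
    have xadd : ∀ a b : Tn N n → K, xx n (a + b) = xx n a + xx n b := by
      intro a b; funext S; by_cases h : S.card = n <;> simp [xx, h]
    by_cases h : i + 1 = n
    · clear_value i
      subst h
      refine ⟨(ee K N i).symm (- rr i (DK K N *ᵥ (G *ᵥ y))), ?_⟩
      apply xx_inj
      rw [xadd, pa, xx_dd, LinearEquiv.apply_symm_apply]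
      have : xx i (- rr i (DK K N *ᵥ (G *ᵥ y))) = - (DK K N *ᵥ (G *ᵥ y)) := by
        change xx i (rr i (- (DK K N *ᵥ (G *ᵥ y)))) = _
        rw [xx_rr]
        intro S hS
        rw [Pi.neg_apply, hs S (by omega), neg_zero]
      rw [this, mulVec_neg, neg_neg]
      exact key
    · refine ⟨0, ?_⟩
      rw [map_zero, map_zero, add_zero]
      apply xx_inj
      rw [pa]
      have : DK K N *ᵥ (G *ᵥ y) = 0 := by
        funext S
        apply hs
        intro h'
        apply h
        rw [hi, ← h']; simp
      rw [this, mulVec_zero, add_zero] at key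
      exact key
  rw [fin_hom ((cox K N).sc' i n (n+1)) (ee K N n) p H0 H1 H2 H3, hp, Matrix.trace_toLin'_eq]; rfl

end ExtC
end JW
end

section
open Finset Matrix

namespace JW
set_option linter.unusedSectionVars false
set_option linter.unusedSimpArgs false

section Hodge
variable {X : Type} [Fintype X] [DecidableEq X]

lemma pos_aux (D : Matrix X X ℚ) (v : X → ℚ) (h : (D * Dᵀ + Dᵀ * D) *ᵥ v = 0) : D *ᵥ v = 0 ∧ Dᵀ *ᵥ v = 0 := by
  have h1 : v ⬝ᵥ ((D * Dᵀ + Dᵀ * D) *ᵥ v) = (Dᵀ *ᵥ v) ⬝ᵥ (Dᵀ *ᵥ v) + (D *ᵥ v) ⬝ᵥ (D *ᵥ v) := by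
    rw [add_mulVec, dotProduct_add, ← mulVec_mulVec, ← mulVec_mulVec, dotProduct_mulVec v D, dotProduct_mulVec v Dᵀ,
      vecMul_transpose, ← mulVec_transpose]
  rw [h, dotProduct_zero] at h1
  have h2 : ∀ w : X → ℚ, 0 ≤ w ⬝ᵥ w := fun w => sum_nonneg fun i _ => mul_self_nonneg _
  have a1 := h2 (Dᵀ *ᵥ v)
  have a2 := h2 (D *ᵥ v)
  exact ⟨dotProduct_self_eq_zero.1 (by linarith), dotProduct_self_eq_zero.1 (by linarith)⟩

lemma pos_mat (D M : Matrix X X ℚ) (h : (D * Dᵀ + Dᵀ * D) * M = 0) : D * M = 0 ∧ Dᵀ * M = 0 := by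
  have : ∀ j, D *ᵥ (M.col j) = 0 ∧ Dᵀ *ᵥ (M.col j) = 0 := by
    intro j
    apply pos_aux
    funext i
    exact congrFun (congrFun h i) j
  constructor
  · ext i j; exact congrFun (this j).1 i
  · ext i j; exact congrFun (this j).2 i

lemma sq_mat (D M : Matrix X X ℚ) (h : (D * Dᵀ + Dᵀ * D) * ((D * Dᵀ + Dᵀ * D) * M) = 0) : (D * Dᵀ + Dᵀ * D) * M = 0 := by
  set L := D * Dᵀ + Dᵀ * D with hL
  have hs : Lᵀ = L := by rw [hL, transpose_add, transpose_mul, transpose_mul, transpose_transpose]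
  have h1 : (L * M)ᵀ * (L * M) = 0 := by rw [transpose_mul, hs, mul_assoc, h, mul_zero]
  ext i j
  have h2 : (L * M).col j ⬝ᵥ (L * M).col j = 0 := congrFun (congrFun h1 j) j
  exact congrFun (dotProduct_self_eq_zero.1 h2) i

theorem hodge (D : Matrix X X ℚ) (hD : D * D = 0) : ∃ P G : Matrix X X ℚ,
    P + (D * Dᵀ + Dᵀ * D) * G = 1 ∧ (D * Dᵀ + Dᵀ * D) * P = 0 ∧ P * P = P ∧ D * P = 0 ∧ Dᵀ * P = 0 ∧
    (∀ B, Commute (D * Dᵀ + Dᵀ * D) B → Commute P B ∧ Commute G B) := by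
  set L := D * Dᵀ + Dᵀ * D with hL
  have hne : minpoly ℚ L ≠ 0 := minpoly.ne_zero (Matrix.isIntegral L)
  obtain ⟨q, hq, hq0⟩ := Polynomial.exists_eq_pow_rootMultiplicity_mul_and_not_dvd _ hne 0
  rw [Polynomial.C_0, sub_zero] at hq hq0
  rw [Polynomial.X_dvd_iff] at hq0
  have h0 : ∀ k, L ^ k * Polynomial.aeval L q = 0 → L * Polynomial.aeval L q = 0 := by
    intro k
    induction k with
    | zero => intro h; rw [pow_zero, one_mul] at h; rw [h, mul_zero]
    | succ k ih =>
      intro h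
      rcases k with _ | k
      · simpa using h
      · apply ih
        rw [pow_succ', mul_assoc]
        apply sq_mat D
        rw [← hL, ← h, pow_succ', pow_succ']; simp only [mul_assoc]
  have h1 : L * Polynomial.aeval L q = 0 := by
    apply h0
    have := minpoly.aeval ℚ L
    rw [hq, map_mul, map_pow, Polynomial.aeval_X] at this
    exact this
  set c := q.coeff 0
  have hPL : L * (c⁻¹ • Polynomial.aeval L q) = 0 := by rw [mul_smul_comm, h1, smul_zero]
  have hPG : c⁻¹ • Polynomial.aeval L q + L * ((-c⁻¹) • Polynomial.aeval L q.divX) = 1 := by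
    have e := congrArg (Polynomial.aeval L) (Polynomial.X_mul_divX_add q)
    rw [map_add, map_mul, Polynomial.aeval_X, Polynomial.aeval_C] at e
    rw [← e, smul_add, mul_smul_comm, neg_smul]
    rw [Algebra.algebraMap_eq_smul_one, smul_smul, inv_mul_cancel₀ hq0, one_smul]
    abel
  have hc : ∀ B, Commute L B → Commute (c⁻¹ • Polynomial.aeval L q) B ∧ Commute ((-c⁻¹) • Polynomial.aeval L q.divX) B := by
    intro B hB
    have : ∀ p : Polynomial ℚ, Commute (Polynomial.aeval L p) B := by
      intro p
      induction p using Polynomial.induction_on' with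
      | add p q hp hq => rw [map_add]; exact hp.add_left hq
      | monomial n a =>
        rw [Polynomial.aeval_monomial]
        exact Commute.mul_left (Algebra.commutes a B) (hB.pow_left n)
    exact ⟨(this _).smul_left _, (this _).smul_left _⟩
  refine ⟨_, _, hPG, hPL, ?_, (pos_mat D _ hPL).1, (pos_mat D _ hPL).2, hc⟩
  have h3 := (hc L rfl).1
  have := congrArg (fun x => x * (c⁻¹ • Polynomial.aeval L q)) hPG
  simp only [add_mul, one_mul] at this
  rw [mul_assoc, ((hc _ h3.symm).2).eq, ← mul_assoc, hPL, zero_mul, add_zero] at this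
  exact this

end Hodge

section Glob
variable (N : ℕ)

lemma carZ_D' : (carZ N).D' = ((carZ N).D)ᵀ := by
  simp only [CAR.D, CAR.D', transpose_sum, transpose_mul, mul_assoc]
  rfl

lemma mat_two {X : Type} [Fintype X] [DecidableEq X] (x : Matrix X X ℤ) (h : x + x = 0) : x = 0 := by
  ext i j
  have := congrFun (congrFun h i) j
  simp only [Matrix.add_apply, Matrix.zero_apply] at this ⊢
  omega

lemma carZ_sq : (carZ N).D * (carZ N).D = 0 := (carZ N).D_sq mat_two

noncomputable def LZ : Matrix (Finset (Edge N)) (Finset (Edge N)) ℤ := (carZ N).D * ((carZ N).D)ᵀ + ((carZ N).D)ᵀ * (carZ N).D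

lemma LZ_eq : LZ N = 2 * (N * (∑ i, (carZ N).Ee i i) - (carZ N).Cas) := by
  rw [LZ, ← carZ_D', (carZ N).casimir mat_two]

noncomputable def LQ : Matrix (Finset (Edge N)) (Finset (Edge N)) ℚ := (Int.castRingHom ℚ).mapMatrix (LZ N)

noncomputable def DQ : Matrix (Finset (Edge N)) (Finset (Edge N)) ℚ := (Int.castRingHom ℚ).mapMatrix (carZ N).D

lemma LQ_eq : LQ N = DQ N * (DQ N)ᵀ + (DQ N)ᵀ * DQ N := by
  rw [LQ, LZ, map_add, map_mul, map_mul]; rfl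

lemma hodgeQ : ∃ P G : Matrix (Finset (Edge N)) (Finset (Edge N)) ℚ,
    P + LQ N * G = 1 ∧ LQ N * P = 0 ∧ P * P = P ∧ DQ N * P = 0 ∧ (DQ N)ᵀ * P = 0 ∧
    (∀ B, Commute (LQ N) B → Commute P B ∧ Commute G B) := by
  rw [LQ_eq]
  refine hodge (DQ N) ?_
  rw [DQ, ← map_mul, carZ_sq, map_zero]

lemma DegT {A : Matrix (Finset (Edge N)) (Finset (Edge N)) ℤ} {a b : ℕ} (h : Deg A a b) : Deg Aᵀ b a :=
  fun S T hA => (h T S hA).symm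

lemma LZ_deg (S T : Finset (Edge N)) (h : LZ N S T ≠ 0) : S.card = T.card := by
  by_contra hc
  apply h
  have h1 := Deg.mul (D_deg N) (DegT N (D_deg N))
  have h2 := Deg.mul (DegT N (D_deg N)) (D_deg N)
  rw [LZ, Matrix.add_apply]
  have e1 : ((carZ N).D * ((carZ N).D)ᵀ) S T = 0 := by
    by_contra h; have := h1 S T h; omega
  have e2 : (((carZ N).D)ᵀ * (carZ N).D) S T = 0 := by
    by_contra h; have := h2 S T h; omega
  rw [e1, e2, add_zero]

lemma LQ_card (φ : ℕ → ℚ) : Commute (LQ N) (diagonal fun S => φ S.card) := by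
  ext S T
  rw [mul_diagonal, diagonal_mul, mul_comm]
  by_cases h : LZ N S T = 0
  · have : LQ N S T = 0 := by simp [LQ, h]
    rw [this, mul_zero, mul_zero]
  · rw [LZ_deg N S T h]

theorem ext_dimQ (K : Type) [Field K] [CharZero K] (n : ℕ) (P G : Matrix (Finset (Edge N)) (Finset (Edge N)) ℚ)
    (h1 : P + LQ N * G = 1) (h3 : P * P = P) (h4 : (DQ N)ᵀ * P = 0)
    (h5 : ∀ B, Commute (LQ N) B → Commute P B ∧ Commute G B) :
    (Module.finrank K
      (((Ext K (ModuleCat (Al K N)) n).obj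
          (Opposite.op (ModuleCat.of (Al K N) K))).obj
        (ModuleCat.of (Al K N) K)) : ℚ) = ∑ S : Tn N n, P S.1 S.1 := by
  have hD : DK K N = (algebraMap ℚ K).mapMatrix (DQ N) := by
    ext S T; simp [DK, DQ]
  have hDT : (DK K N)ᵀ = (algebraMap ℚ K).mapMatrix (DQ N)ᵀ := by
    rw [hD]; rfl
  have hDL : Commute (LQ N) (DQ N)ᵀ := by
    have : (DQ N)ᵀ * (DQ N)ᵀ = 0 := by
      rw [← transpose_mul, DQ, ← map_mul, carZ_sq, map_zero, transpose_zero]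
    rw [LQ_eq, commute_iff_eq, add_mul, mul_add, mul_assoc, this, ← mul_assoc _ _ (DQ N), this]
    simp [mul_assoc]
  have hcd : ∀ A : Matrix (Finset (Edge N)) (Finset (Edge N)) ℚ, Commute A (diagonal fun S => (S.card : ℚ)) →
      ∀ S T, (algebraMap ℚ K).mapMatrix A S T ≠ 0 → S.card = T.card := by
    intro A hA S T hne
    have := congrFun (congrFun hA.eq S) T
    rw [mul_diagonal, diagonal_mul, mul_comm] at this
    have hA0 : A S T ≠ 0 := by
      intro h; apply hne; simp [h]
    exact_mod_cast (mul_right_cancel₀ hA0 this).symm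
  have := ext_dim K N n ((algebraMap ℚ K).mapMatrix P) ((algebraMap ℚ K).mapMatrix G)
    (by rw [hDT, hD, ← map_mul, ← map_mul, ← map_add, ← LQ_eq, ← map_mul, ← map_add, h1, map_one])
    (by rw [← map_mul, h3]) (by rw [hDT, ← map_mul, h4, map_zero])
    (by rw [hDT, ← map_mul, (h5 _ hDL).1.eq, h4, map_zero])
    (by rw [hDT, ← map_mul, ← map_mul, (h5 _ hDL).2.eq])
    (hcd P (h5 _ (LQ_card N (fun k => (k:ℚ)))).1) (hcd G (h5 _ (LQ_card N (fun k => (k:ℚ)))).2)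
  apply (algebraMap ℚ K).injective
  rw [map_natCast, this, map_sum]
  rfl

end Glob
end JW
end

section
open Finset Matrix

namespace JW
set_option linter.unusedSectionVars false
set_option linter.unusedSimpArgs false

section Poly
variable {N : ℕ}
open MvPolynomial

noncomputable def th (i : Fin N) : Derivation ℚ (MvPolynomial (Fin N) ℚ) (MvPolynomial (Fin N) ℚ) := (X i : MvPolynomial (Fin N) ℚ) • pderiv i

lemma th_mono (i : Fin N) (m : Fin N →₀ ℕ) (r : ℚ) : th i (monomial m r) = (m i : ℚ) • monomial m r := by
  rw [th, Derivation.smul_apply, smul_eq_mul, X_mul_pderiv_monomial, Nat.cast_smul_eq_nsmul]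

lemma th_X (i k : Fin N) : th i (X k : MvPolynomial (Fin N) ℚ) = if i = k then X k else 0 := by
  rw [X, th_mono]
  rcases eq_or_ne i k with rfl | h
  · simp
  · simp [h, Finsupp.single_apply, Ne.symm h]

lemma der_prod {ι A : Type} [DecidableEq ι] [CommRing A] [Algebra ℚ A] (D : Derivation ℚ A A) (s : Finset ι) (f : ι → A) :
    D (∏ p ∈ s, f p) = ∑ p ∈ s, (∏ p' ∈ s.erase p, f p') * D (f p) := by
  induction s using Finset.induction_on with
  | empty => simp
  | insert a s ha ih =>
    rw [prod_insert ha, D.leibniz, ih, sum_insert ha, erase_insert ha, smul_eq_mul, smul_eq_mul, mul_sum]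
    rw [add_comm]
    refine congrArg₂ (· + ·) rfl (sum_congr rfl fun p hp => ?_)
    rw [erase_insert_of_ne (by rintro rfl; exact ha hp), prod_insert (by simp [ha])]
    ring

def Pp (N : ℕ) : Finset (Fin N × Fin N) := univ.filter fun p => p.1 < p.2

noncomputable def vd (N : ℕ) : MvPolynomial (Fin N) ℚ := (vandermonde (fun i : Fin N => (X i : MvPolynomial (Fin N) ℚ))).det

lemma vd_prod : vd N = ∏ p ∈ Pp N, (X p.2 - X p.1) := by
  rw [vd, det_vandermonde, Pp, prod_filter, ← univ_product_univ, prod_product]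
  refine prod_congr rfl fun i _ => ?_
  rw [← prod_filter]
  refine prod_congr ?_ fun _ _ => rfl
  ext j; simp

lemma sum_pairs {A : Type} [AddCommMonoid A] (g : Fin N → Fin N → A) :
    (∑ i, ∑ j, if i = j then 0 else g i j) = ∑ p ∈ Pp N, (g p.1 p.2 + g p.2 p.1) := by
  have h1 : ∀ i j : Fin N, (if i = j then 0 else g i j) = (if i < j then g i j else 0) + (if j < i then g i j else 0) := by
    intro i j
    rcases lt_trichotomy i j with h | h | h
    · simp [h, h.ne, not_lt.2 h.le]
    · simp [h]
    · simp [h, h.ne', not_lt.2 h.le]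
  simp only [h1, sum_add_distrib]
  rw [Pp, sum_filter, sum_filter, ← univ_product_univ, sum_product, sum_product]
  congr 1
  rw [sum_comm]

lemma key (c : MvPolynomial (Fin N) ℚ) (q : Fin N → Fin N → MvPolynomial (Fin N) ℚ)
    (hq : ∀ i j, i ≠ j → (X i - X j) * q i j = X j * (th i c - th j c)) :
    (∑ i, ∑ j, if i = j then 0 else q i j) * vd N = 2 * (∑ k, th k c * th k (vd N)) - (N - 1) * ((∑ k, th k c) * vd N) := by
  have e1 : ∀ k, th k c * th k (vd N) = ∑ p ∈ Pp N, (∏ p' ∈ (Pp N).erase p, (X p'.2 - X p'.1)) *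
      ((if k = p.2 then X p.2 * th p.2 c else 0) - (if k = p.1 then X p.1 * th p.1 c else 0)) := by
    intro k
    rw [vd_prod, der_prod, mul_sum]
    refine sum_congr rfl fun p _ => ?_
    rw [map_sub, th_X, th_X, mul_left_comm]
    congr 1
    split_ifs with h h' h'
    · rw [← h, ← h']; ring
    · rw [← h]; ring
    · rw [← h']; ring
    · ring
  have e2 : ∑ k, th k c * th k (vd N) = ∑ p ∈ Pp N, (∏ p' ∈ (Pp N).erase p, (X p'.2 - X p'.1)) * (X p.2 * th p.2 c - X p.1 * th p.1 c) := by
    simp only [e1]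
    rw [sum_comm]
    refine sum_congr rfl fun p _ => ?_
    rw [← mul_sum, sum_sub_distrib]
    simp
  have e3 : ((N : MvPolynomial (Fin N) ℚ) - 1) * (∑ k, th k c) * 2 = 2 * ∑ p ∈ Pp N, (th p.1 c + th p.2 c) := by
    rw [← sum_pairs (fun i j => th i c)]
    have : ∀ i : Fin N, (∑ j, if i = j then 0 else th i c) = ((N : MvPolynomial (Fin N) ℚ) - 1) * th i c := by
      intro i
      have : ∀ j, (if i = j then 0 else th i c) = th i c - (if i = j then th i c else 0) := by
        intro j; split_ifs <;> simp
      simp only [this, sum_sub_distrib]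
      simp; ring
    simp only [this]
    rw [← mul_sum]; ring
  have e3' : ((N : MvPolynomial (Fin N) ℚ) - 1) * ((∑ k, th k c) * vd N) = ∑ p ∈ Pp N, (th p.1 c + th p.2 c) * vd N := by
    rw [← sum_mul, ← mul_assoc]
    congr 1
    have h2 : (2 : MvPolynomial (Fin N) ℚ) ≠ 0 := two_ne_zero
    apply mul_left_cancel₀ h2
    rw [← e3]; ring
  rw [sum_pairs, e3', e2, sum_mul, mul_sum, ← sum_sub_distrib]
  refine sum_congr rfl fun p hp => ?_
  have hv : vd N = (X p.2 - X p.1) * (∏ p' ∈ (Pp N).erase p, (X p'.2 - X p'.1)) := by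
    rw [vd_prod, mul_prod_erase _ (fun p' : Fin N × Fin N => (X p'.2 - X p'.1 : MvPolynomial (Fin N) ℚ)) hp]
  have hne : p.1 ≠ p.2 := by simp [Pp] at hp; exact hp.ne
  have q1 := hq _ _ hne
  have q2 := hq _ _ hne.symm
  generalize (∏ p' ∈ (Pp N).erase p, (X p'.2 - X p'.1 : MvPolynomial (Fin N) ℚ)) = r at *
  rw [hv]
  linear_combination (-r) * q1 + r * q2

/-- quadratic operator -/
noncomputable def om (ν : Fin N → ℕ) : ℚ := (2 * N - 1) * (∑ i : Fin N, ((ν i : ℚ) - (i : ℕ))) - ∑ i : Fin N, ((ν i : ℚ) ^ 2 - ((i : ℕ) : ℚ) ^ 2)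

noncomputable def Om (N : ℕ) : MvPolynomial (Fin N) ℚ →ₗ[ℚ] MvPolynomial (Fin N) ℚ :=
  (basisMonomials (Fin N) ℚ).constr ℚ fun ν => monomial ν (om ν)

noncomputable def Ph (g : (Fin N → ℕ) → ℚ) : MvPolynomial (Fin N) ℚ →ₗ[ℚ] ℚ :=
  (basisMonomials (Fin N) ℚ).constr ℚ fun ν => g ν

lemma Ph_mono (g : (Fin N → ℕ) → ℚ) (ν : Fin N →₀ ℕ) (r : ℚ) : Ph g (monomial ν r) = r * g ν := by
  have := (basisMonomials (Fin N) ℚ).constr_basis ℚ (fun ν : Fin N →₀ ℕ => g ν) ν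
  rw [coe_basisMonomials] at this
  have h2 : monomial ν r = r • monomial ν (1 : ℚ) := by simp [smul_monomial]
  rw [h2, map_smul, Ph, this, smul_eq_mul]

lemma Om_mono (ν : Fin N →₀ ℕ) (r : ℚ) : Om N (monomial ν r) = om ν • monomial ν r := by
  have := (basisMonomials (Fin N) ℚ).constr_basis ℚ (fun ν : Fin N →₀ ℕ => monomial ν (om ν)) ν
  rw [coe_basisMonomials] at this
  have h2 : monomial ν r = r • monomial ν (1 : ℚ) := by simp [smul_monomial]
  rw [h2, map_smul, Om, this, smul_monomial, smul_monomial, smul_monomial, smul_eq_mul, smul_eq_mul, smul_eq_mul]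
  congr 1; ring

lemma Om_eq (p : MvPolynomial (Fin N) ℚ) : Om N p = (2 * N - 1 : ℚ) • (∑ i, th i p - (∑ i : Fin N, ((i : ℕ) : ℚ)) • p)
    - (∑ i, th i (th i p) - (∑ i : Fin N, ((i : ℕ) : ℚ) ^ 2) • p) := by
  have : Om N = (2 * N - 1 : ℚ) • (∑ i, (th i).toLinearMap - (∑ i : Fin N, ((i : ℕ) : ℚ)) • LinearMap.id)
    - (∑ i, (th i).toLinearMap ∘ₗ (th i).toLinearMap - (∑ i : Fin N, ((i : ℕ) : ℚ) ^ 2) • LinearMap.id) := by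
    refine (basisMonomials (Fin N) ℚ).ext fun ν => ?_
    rw [coe_basisMonomials, Om_mono]
    simp only [LinearMap.sub_apply, LinearMap.smul_apply, LinearMap.sum_apply, LinearMap.comp_apply, LinearMap.id_apply,
      Derivation.coeFn_coe, th_mono, map_smul, smul_smul, ← sum_smul, ← sub_smul, om, sum_sub_distrib]
    simp only [pow_two]
  rw [this]
  simp [LinearMap.sum_apply]

lemma vd_mono : vd N = ∑ σ : Equiv.Perm (Fin N), monomial (Finsupp.equivFunOnFinite.symm fun i => ((σ i : Fin N) : ℕ)) ((Equiv.Perm.sign σ : ℤ) : ℚ) := by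
  rw [vd, ← det_transpose, det_apply']
  refine sum_congr rfl fun σ _ => ?_
  rw [monomial_eq, Finsupp.prod_fintype _ _ (by simp)]
  simp [vandermonde_apply]

lemma th_vd1 : ∑ i, th i (vd N) = (∑ i : Fin N, ((i : ℕ) : ℚ)) • vd N := by
  conv_lhs => simp only [vd_mono, map_sum, th_mono]
  rw [sum_comm, vd_mono, smul_sum]
  refine sum_congr rfl fun σ _ => ?_
  rw [← sum_smul]
  congr 1
  exact Equiv.sum_comp σ fun i : Fin N => ((i : ℕ) : ℚ)

lemma th_vd2 : ∑ i, th i (th i (vd N)) = (∑ i : Fin N, ((i : ℕ) : ℚ) ^ 2) • vd N := by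
  conv_lhs => simp only [vd_mono, map_sum, th_mono, Derivation.map_smul, smul_smul]
  rw [sum_comm, vd_mono, smul_sum]
  refine sum_congr rfl fun σ _ => ?_
  rw [← sum_smul]
  congr 1
  simp only [← pow_two]
  exact Equiv.sum_comp σ fun i : Fin N => ((i : ℕ) : ℚ) ^ 2

lemma Om_vd (c : MvPolynomial (Fin N) ℚ) (q : Fin N → Fin N → MvPolynomial (Fin N) ℚ)
    (hq : ∀ i j, i ≠ j → (X i - X j) * q i j = X j * (th i c - th j c)) :
    Om N (c * vd N) = (N * ∑ i, th i c - ∑ i, th i (th i c) - (∑ i, ∑ j, if i = j then 0 else q i j)) * vd N := by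
  rw [Om_eq, sub_mul, key c q hq]
  simp only [Derivation.leibniz, smul_eq_mul, map_add, sum_add_distrib, ← mul_sum, th_vd1, th_vd2]
  simp only [MvPolynomial.smul_eq_C_mul, map_sub, map_mul, map_natCast, map_one, map_ofNat]
  simp only [mul_comm (vd N), ← sum_mul, fun i => mul_comm (th i (vd N)) (th i c)]
  ring

lemma Ph_Om (g : (Fin N → ℕ) → ℚ) (hg : ∀ ν, om ν ≠ 0 → g ν = 0) (p : MvPolynomial (Fin N) ℚ) : Ph g (Om N p) = 0 := by
  have : (Ph g ∘ₗ Om N) = 0 := by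
    refine (basisMonomials (Fin N) ℚ).ext fun ν => ?_
    rw [coe_basisMonomials, LinearMap.comp_apply, Om_mono, map_smul, Ph_mono]
    by_cases h : om ν = 0
    · simp [h]
    · simp [hg _ h]
  exact LinearMap.congr_fun this p

lemma Om_coeff (p : MvPolynomial (Fin N) ℚ) (ν : Fin N →₀ ℕ) : coeff ν (Om N p) = om ν * coeff ν p := by
  have : (lcoeff ℚ ν ∘ₗ Om N) = om ν • lcoeff ℚ ν := by
    refine (basisMonomials (Fin N) ℚ).ext fun μ => ?_
    rw [coe_basisMonomials, LinearMap.comp_apply, Om_mono, map_smul, LinearMap.smul_apply]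
    simp only [lcoeff_apply, coeff_monomial]
    split_ifs with h
    · rw [h]
    · simp
  exact LinearMap.congr_fun this p

lemma Ph_congr (g g' : (Fin N → ℕ) → ℚ) (hg : ∀ ν, om ν = 0 → g ν = g' ν) (p : MvPolynomial (Fin N) ℚ) (hp : Om N p = 0) :
    Ph g p = Ph g' p := by
  rw [p.as_sum, map_sum, map_sum]
  refine sum_congr rfl fun ν hν => ?_
  rw [Ph_mono, Ph_mono, hg]
  have := Om_coeff p ν
  rw [hp, coeff_zero] at this
  exact (mul_eq_zero.1 this.symm).resolve_right (by simpa using hν)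

end Poly
end JW
end

section
open Finset Matrix

namespace JW
set_option linter.unusedSectionVars false
set_option linter.unusedSimpArgs false

section Wt
variable {N : ℕ}

noncomputable def wtf (S : Finset (Edge N)) (i : Fin N) : ℕ := ∑ j, if ed i j ∈ S then 1 else 0

noncomputable def wef (e : Edge N) (i : Fin N) : ℕ := ∑ j, if ed i j = e then 1 else 0

lemma wtf_insert (S : Finset (Edge N)) (e : Edge N) (h : e ∉ S) (i : Fin N) : wtf (insert e S) i = wtf S i + wef e i := by
  rw [wtf, wtf, wef, ← sum_add_distrib]
  refine sum_congr rfl fun j _ => ?_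
  by_cases h1 : ed i j = e
  · rw [h1]; simp [h]
  · simp [h1]

lemma wef_same (a i : Fin N) : wef (ed a a) i = if i = a then 1 else 0 := by
  simp only [wef, ed_eq]
  by_cases h : i = a <;> simp [h]

lemma wef_ne (a b i : Fin N) (h : a ≠ b) : wef (ed a b) i = (if i = a then 1 else 0) + (if i = b then 1 else 0) := by
  simp only [wef, ed_eq]
  by_cases h1 : i = a
  · subst h1; simp [h]
  · by_cases h2 : i = b
    · subst h2; simp [h1]
    · simp [h1, h2]

def Wdd (A : Matrix (Finset (Edge N)) (Finset (Edge N)) ℤ) (f g : Fin N → ℕ) : Prop :=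
  ∀ S T, A S T ≠ 0 → ∀ k, wtf S k + g k = wtf T k + f k

lemma Wdd.mul {A B : Matrix (Finset (Edge N)) (Finset (Edge N)) ℤ} {f g f' g' : Fin N → ℕ} (hA : Wdd A f g) (hB : Wdd B f' g') :
    Wdd (A * B) (f + f') (g + g') := by
  intro S T h k
  rw [Matrix.mul_apply] at h
  obtain ⟨U, -, hU⟩ := exists_ne_zero_of_sum_ne_zero h
  have h1 := hA S U (left_ne_zero_of_mul hU) k
  have h2 := hB U T (right_ne_zero_of_mul hU) k
  simp only [Pi.add_apply]
  omega

lemma cc_wd (e : Edge N) : Wdd (cc e) 0 (wef e) := by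
  intro S T h k
  simp only [cc, of_apply] at h
  have : e ∉ S ∧ T = insert e S := by by_contra h'; rw [if_neg h'] at h; exact h rfl
  rw [this.2, wtf_insert _ _ this.1]; simp

lemma ccT_wd (e : Edge N) : Wdd (cc e)ᵀ (wef e) 0 := fun S T h k => (cc_wd e T S h k).symm

lemma Ee_wd (i j : Fin N) : Wdd ((carZ N).Ee i j) (fun k => if k = i then 1 else 0) (fun k => if k = j then 1 else 0) := by
  intro S T h k
  by_cases h1 : ((carZ N).a' i * (carZ N).a j) S T = 0
  · rw [CAR.Ee, Matrix.add_apply, h1, zero_add, Matrix.sum_apply] at h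
    obtain ⟨l, -, hl⟩ := exists_ne_zero_of_sum_ne_zero h
    have e1 : ((carZ N).b' i l * (carZ N).b j l) S T = ep i l * ep j l * ((cc (ed i l))ᵀ * cc (ed j l)) S T := by
      have : (carZ N).b' i l * (carZ N).b j l = (ep i l * ep j l) • ((cc (ed i l))ᵀ * cc (ed j l)) := smul_mul_smul_comm _ _ _ _
      rw [this, Matrix.smul_apply, smul_eq_mul]
    rw [e1] at hl
    have h2 := (ccT_wd (ed i l)).mul (cc_wd (ed j l)) S T (right_ne_zero_of_mul hl) k
    have n1 : i ≠ l := by rintro rfl; simp [ep_self] at hl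
    have n2 : j ≠ l := by rintro rfl; simp [ep_self] at hl
    simp only [Pi.add_apply, Pi.zero_apply, wef_ne _ _ _ n1, wef_ne _ _ _ n2] at h2
    simp only
    omega
  · have h2 := (ccT_wd (ed i i)).mul (cc_wd (ed j j)) S T h1 k
    simp only [Pi.add_apply, Pi.zero_apply, wef_same] at h2
    simp only
    omega

lemma Ee_deg (i j : Fin N) : Deg ((carZ N).Ee i j) 1 1 := by
  intro S T h
  by_cases h1 : ((carZ N).a' i * (carZ N).a j) S T = 0
  · rw [CAR.Ee, Matrix.add_apply, h1, zero_add] at h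
    exact Deg.sum (fun k => Deg.mul (Deg.smul (ccT_deg _) _) (Deg.smul (cc_deg _) _)) S T h
  · exact Deg.mul (ccT_deg _) (cc_deg _) S T h1

lemma Ee_diag (i : Fin N) : (carZ N).Ee i i = diagonal fun S => (wtf S i : ℤ) := by
  have e1 : ∀ l, (carZ N).b' i l * (carZ N).b i l = (if i = l then (0:ℤ) else 1) • ((cc (ed i l))ᵀ * cc (ed i l)) := by
    intro l
    rw [← ep_sq]
    exact smul_mul_smul_comm _ _ _ _
  have e2 : (carZ N).a' i * (carZ N).a i = (cc (ed i i))ᵀ * cc (ed i i) := rfl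
  have e3 : (carZ N).Ee i i = ∑ l, (cc (ed i l))ᵀ * cc (ed i l) := by
    rw [CAR.Ee, e2, ← add_sum_erase univ _ (mem_univ i), ← add_sum_erase univ (fun l => (cc (ed i l))ᵀ * cc (ed i l)) (mem_univ i), e1 i,
      if_pos rfl, zero_smul, zero_add]
    congr 1
    refine sum_congr rfl fun l hl => ?_
    rw [e1, if_neg (by rintro rfl; simp at hl), one_smul]
  rw [e3]
  ext S T
  rw [Matrix.sum_apply]
  simp only [ccT_cc, diagonal_apply]
  by_cases h : S = T
  · simp only [h, if_true, wtf]; push_cast; rfl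
  · simp [h]

noncomputable def EQ (i j : Fin N) : Matrix (Finset (Edge N)) (Finset (Edge N)) ℚ := (Int.castRingHom ℚ).mapMatrix ((carZ N).Ee i j)

lemma EQ_diag (i : Fin N) : EQ i i = diagonal fun S => (wtf S i : ℚ) := by
  ext S T
  simp only [EQ, Ee_diag, RingHom.mapMatrix_apply, Matrix.map_apply, diagonal_apply]
  split_ifs <;> simp

lemma EQ_wd (i j : Fin N) (S T : Finset (Edge N)) (h : (EQ i j) S T ≠ 0) (k : Fin N) :
    wtf S k + (if k = j then 1 else 0) = wtf T k + (if k = i then 1 else 0) :=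
  Ee_wd i j S T (by rintro h'; simp [EQ, h'] at h) k

lemma EQ_card (i j : Fin N) (φ : ℕ → ℚ) : Commute (EQ i j) (diagonal fun S => φ S.card) := by
  ext S T
  rw [mul_diagonal, diagonal_mul, mul_comm]
  by_cases h : (carZ N).Ee i j S T = 0
  · have : EQ i j S T = 0 := by simp [EQ, h]
    rw [this, mul_zero, mul_zero]
  · rw [show S.card = T.card by have := Ee_deg i j S T h; omega]

lemma EQ_EQ (i j : Fin N) (h : i ≠ j) : EQ i j * EQ j i = EQ j i * EQ i j + (EQ i i - EQ j j) := by
  have := (carZ N).E_E i j j i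
  simp only [if_true, CAR.br] at this
  simp only [EQ, ← map_mul, ← map_sub, ← map_add]
  rw [← this]; congr 1; abel

lemma LQ_E : LQ N = 2 * (N * (∑ i : Fin N, EQ i i) - ∑ i : Fin N, ∑ j : Fin N, EQ i j * EQ j i) := by
  rw [LQ, LZ_eq, map_mul, map_sub, map_mul, map_natCast, map_ofNat, CAR.Cas]
  simp only [map_sum, map_mul]
  rfl

lemma LQ_EQ (k l : Fin N) : Commute (LQ N) (EQ k l) := by
  have h1 := (carZ N).E_tr k l
  have h2 := (carZ N).E_Cas k l
  have h3 : Commute (LZ N) ((carZ N).Ee k l) := by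
    rw [LZ_eq]
    refine Commute.mul_left (Nat.cast_commute 2 _) (Commute.sub_left (Commute.mul_left (Nat.cast_commute N _) ?_) ?_)
    · exact (sub_eq_zero.1 h1).symm
    · exact (sub_eq_zero.1 h2).symm
  exact h3.map (Int.castRingHom ℚ).mapMatrix

open MvPolynomial

noncomputable def wt (S : Finset (Edge N)) : Fin N →₀ ℕ := Finsupp.equivFunOnFinite.symm (wtf S)

lemma wt_apply (S : Finset (Edge N)) (i : Fin N) : wt S i = wtf S i := rfl

/-- character -/
noncomputable def ch (f : Matrix (Finset (Edge N)) (Finset (Edge N)) ℚ) : MvPolynomial (Fin N) ℚ := ∑ S, monomial (wt S) (f S S)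

lemma ch_add (f g : Matrix (Finset (Edge N)) (Finset (Edge N)) ℚ) : ch (f + g) = ch f + ch g := by
  simp [ch, sum_add_distrib]

lemma ch_sub (f g : Matrix (Finset (Edge N)) (Finset (Edge N)) ℚ) : ch (f - g) = ch f - ch g := by
  simp [ch, sum_sub_distrib]

lemma ch_sum {ι : Type} (s : Finset ι) (f : ι → Matrix (Finset (Edge N)) (Finset (Edge N)) ℚ) : ch (∑ i ∈ s, f i) = ∑ i ∈ s, ch (f i) := by
  simp only [ch, Matrix.sum_apply, map_sum]
  rw [sum_comm]

lemma ch_nat (n : ℕ) (f : Matrix (Finset (Edge N)) (Finset (Edge N)) ℚ) : ch ((n : Matrix (Finset (Edge N)) (Finset (Edge N)) ℚ) * f) = (n : MvPolynomial (Fin N) ℚ) * ch f := by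
  rw [← nsmul_eq_mul, ← nsmul_eq_mul]
  simp only [ch, smul_sum, Matrix.smul_apply, map_nsmul]

lemma ch_th (f : Matrix (Finset (Edge N)) (Finset (Edge N)) ℚ) (i : Fin N) : ch (EQ i i * f) = th i (ch f) := by
  rw [ch, ch, map_sum]
  refine sum_congr rfl fun S _ => ?_
  rw [EQ_diag, diagonal_mul, th_mono, smul_monomial, wt_apply, smul_eq_mul]

lemma ch_swap (A : Matrix (Finset (Edge N)) (Finset (Edge N)) ℚ) (i j : Fin N) : X i * ch (A * EQ i j) = X j * ch (EQ i j * A) := by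
  simp only [ch, Matrix.mul_apply, map_sum, mul_sum]
  rw [sum_comm]
  refine sum_congr rfl fun S _ => sum_congr rfl fun T _ => ?_
  by_cases h : EQ i j S T = 0
  · simp [h]
  · have := EQ_wd i j S T h
    rw [X, X, monomial_mul, monomial_mul, mul_comm (A T S)]
    congr 2
    ext k
    have := this k
    simp only [Finsupp.add_apply, Finsupp.single_apply, wt_apply, eq_comm (b := k)]
    omega

lemma ch_q (f : Matrix (Finset (Edge N)) (Finset (Edge N)) ℚ) (hf : ∀ k l, Commute f (EQ k l)) (i j : Fin N) (h : i ≠ j) :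
    (X i - X j) * ch (EQ j i * EQ i j * f) = X j * (th i (ch f) - th j (ch f)) := by
  have h1 := ch_swap (f * EQ j i) i j
  rw [mul_assoc, ((hf j i).mul_right (hf i j)).eq, (hf j i).eq, ← mul_assoc (EQ i j) (EQ j i) f, EQ_EQ i j h, add_mul, ch_add, sub_mul, ch_sub, ch_th, ch_th] at h1
  linear_combination h1

theorem freud (f : Matrix (Finset (Edge N)) (Finset (Edge N)) ℚ) (hf : ∀ k l, Commute f (EQ k l)) :
    ch (LQ N * f) * vd N = 2 * Om N (ch f * vd N) := by
  rw [Om_vd (ch f) (fun i j => ch (EQ j i * EQ i j * f)) (ch_q f hf), ← mul_assoc]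
  congr 1
  have e : LQ N * f = ((2 : ℕ) : Matrix (Finset (Edge N)) (Finset (Edge N)) ℚ) * (N * (∑ i : Fin N, EQ i i * f) - (∑ i : Fin N, EQ i i * (EQ i i * f) + ∑ i : Fin N, ∑ j : Fin N, if i = j then 0 else EQ j i * EQ i j * f)) := by
    rw [LQ_E, Nat.cast_ofNat, mul_assoc, sub_mul, mul_assoc, sum_mul]
    congr 3
    rw [← sum_add_distrib, sum_comm, sum_mul]
    refine sum_congr rfl fun i _ => ?_
    rw [← add_sum_erase univ _ (mem_univ i), ← add_sum_erase univ (fun j => if i = j then 0 else EQ j i * EQ i j * f) (mem_univ i), if_pos rfl, zero_add, add_mul, sum_mul,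
      mul_assoc]
    congr 1
    refine sum_congr rfl fun j hj => ?_
    rw [if_neg (by rintro rfl; simp at hj)]
  rw [e, ch_nat, ch_sub, ch_nat, ch_add, ch_sum, ch_sum, ch_sum]
  simp only [ch_th, ch_sum]
  have : ∀ i j : Fin N, ch (if i = j then 0 else EQ j i * EQ i j * f) = if i = j then 0 else ch (EQ j i * EQ i j * f) := by
    intro i j; split_ifs
    · simp [ch]
    · rfl
  simp only [this]
  push_cast; ring

end Wt
end JW
end

section
open Finset Matrix

namespace JW
set_option linter.unusedSectionVars false
set_option linter.unusedSimpArgs false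

section Tr
variable {N : ℕ}
open MvPolynomial

noncomputable def g1 (ν : Fin N → ℕ) : ℚ := ∏ i : Fin N, ((ν i).choose i : ℚ)
noncomputable def g0 (ν : Fin N → ℕ) : ℚ := if om ν = 0 then g1 ν else 0

lemma det_shift (w : Fin N → ℕ) : (Matrix.of fun i j : Fin N => (((w j + i : ℕ).choose j : ℕ) : ℚ)).det = 1 := by
  have h1 := Matrix.det_eval_matrixOfPolynomials_eq_det_vandermonde (fun i : Fin N => ((i : ℕ) : ℚ))
    (fun j => (descPochhammer ℚ j).comp (Polynomial.X + Polynomial.C (w j : ℚ)))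
    (fun j => by rw [Polynomial.natDegree_comp, Polynomial.natDegree_X_add_C, mul_one, descPochhammer_natDegree])
    (fun j => (monic_descPochhammer ℚ j).comp_X_add_C _)
  have h2 : (Matrix.of fun i j : Fin N => Polynomial.eval ((i : ℕ) : ℚ) ((descPochhammer ℚ j).comp (Polynomial.X + Polynomial.C (w j : ℚ)))) =
      (Matrix.of fun i j : Fin N => ((j : ℕ).factorial : ℚ) * (Matrix.of fun i j : Fin N => (((w j + i : ℕ).choose j : ℕ) : ℚ)) i j) := by
    ext i j
    simp only [of_apply, Polynomial.eval_comp, Polynomial.eval_add, Polynomial.eval_X, Polynomial.eval_C]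
    rw [← Nat.cast_add, descPochhammer_eval_eq_descFactorial, Nat.descFactorial_eq_factorial_mul_choose, add_comm]
    push_cast; rfl
  rw [h2, det_mul_row (fun j : Fin N => ((j : ℕ).factorial : ℚ))] at h1
  have h3 : (vandermonde (fun i : Fin N => ((i : ℕ) : ℚ))).det = ∏ j : Fin N, ((j : ℕ).factorial : ℚ) := by
    rcases N with _ | n
    · simp
    · rw [det_vandermonde_id_eq_superFactorial, ← Nat.prod_range_succ_factorial, Fin.prod_univ_eq_prod_range (fun j => (j.factorial : ℚ))]
      push_cast; rfl
  rw [h3] at h1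
  have h4 : (∏ j : Fin N, ((j : ℕ).factorial : ℚ)) ≠ 0 := prod_ne_zero_iff.2 fun j _ => by exact_mod_cast (Nat.factorial_ne_zero _)
  exact mul_left_cancel₀ h4 (by rw [← h1, mul_one])

lemma Ph_vd (g : (Fin N → ℕ) → ℚ) (w : Fin N →₀ ℕ) (c : ℚ) : Ph g (monomial w c * vd N) =
    c * ∑ σ : Equiv.Perm (Fin N), ((Equiv.Perm.sign σ : ℤ) : ℚ) * g (fun i => w i + (σ i : Fin N)) := by
  rw [vd_mono, mul_sum, map_sum, mul_sum]
  refine sum_congr rfl fun σ _ => ?_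
  rw [monomial_mul, Ph_mono, mul_assoc]
  rfl

lemma Ph_one (w : Fin N →₀ ℕ) (c : ℚ) : Ph g1 (monomial w c * vd N) = c := by
  rw [Ph_vd]
  have := det_shift w
  rw [det_apply'] at this
  simp only [g1]
  simp only [of_apply] at this
  rw [this, mul_one]

lemma Ph_ch (g : (Fin N → ℕ) → ℚ) (f : Matrix (Finset (Edge N)) (Finset (Edge N)) ℚ) : Ph g (ch f * vd N) = ∑ S, Ph g (monomial (wt S) (f S S) * vd N) := by
  rw [ch, sum_mul, map_sum]

lemma sum_Tn (n : ℕ) (F : Finset (Edge N) → ℚ) : ∑ S : Tn N n, F S.1 = ∑ S, if S.card = n then F S else 0 := by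
  rw [← sum_filter]
  exact (Finset.sum_subtype _ (by simp) F).symm

theorem trace_eq (n : ℕ) (P G : Matrix (Finset (Edge N)) (Finset (Edge N)) ℚ) (h1 : P + LQ N * G = 1) (h2 : LQ N * P = 0)
    (h5 : ∀ B, Commute (LQ N) B → Commute P B ∧ Commute G B) :
    ∑ S : Tn N n, P S.1 S.1 = ∑ S : Finset (Edge N), if S.card = n then
      ∑ σ : Equiv.Perm (Fin N), ((Equiv.Perm.sign σ : ℤ) : ℚ) * g0 (fun i => wtf S i + (σ i : Fin N)) else 0 := by
  obtain ⟨J, hJ⟩ : ∃ J : Matrix (Finset (Edge N)) (Finset (Edge N)) ℚ, J = diagonal fun S => if S.card = n then (1 : ℚ) else 0 := ⟨_, rfl⟩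
  have cJ : ∀ k l, Commute J (EQ k l) := fun k l => by
    rw [hJ]; exact (EQ_card k l (fun m => if m = n then (1 : ℚ) else 0)).symm
  have cP : ∀ k l, Commute (P * J) (EQ k l) := fun k l => ((h5 _ (LQ_EQ k l)).1).mul_left (cJ k l)
  have cG : ∀ k l, Commute (G * J) (EQ k l) := fun k l => ((h5 _ (LQ_EQ k l)).2).mul_left (cJ k l)
  have hP : Om N (ch (P * J) * vd N) = 0 := by
    have := freud (P * J) cP
    rw [← mul_assoc, h2, zero_mul] at this
    have h0 : ch (0 : Matrix (Finset (Edge N)) (Finset (Edge N)) ℚ) = 0 := by simp [ch]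
    rw [h0, zero_mul] at this
    exact (mul_eq_zero.1 this.symm).resolve_left two_ne_zero
  have hG : Ph g0 (ch J * vd N) = Ph g0 (ch (P * J) * vd N) := by
    have e : J = P * J + LQ N * (G * J) := by rw [← mul_assoc, ← add_mul, h1, one_mul]
    conv_lhs => rw [e]
    rw [ch_add, add_mul, freud (G * J) cG, map_add, two_mul, map_add, Ph_Om, add_zero, add_zero]
    intro ν h; simp [g0, h]
  have hc : Ph g1 (ch (P * J) * vd N) = Ph g0 (ch (P * J) * vd N) := Ph_congr _ _ (fun ν h => by simp [g0, h]) _ hP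
  rw [← hG, Ph_ch, Ph_ch] at hc
  simp only [Ph_one] at hc
  rw [sum_Tn n fun S => P S S]
  refine Eq.trans ?_ (hc.trans ?_)
  · refine sum_congr rfl fun S _ => ?_
    rw [hJ, mul_diagonal]; simp
  · refine sum_congr rfl fun S _ => ?_
    rw [Ph_vd, hJ, diagonal_apply_eq, ite_mul, one_mul, zero_mul]
    rfl

lemma s2map (σ : Equiv.Perm (Fin N)) (e : Sym2 (Fin N)) : Sym2.map σ.symm (Sym2.map σ e) = e := by
  simp [Sym2.map_map]

/-- relabelling -/
noncomputable def eP (σ : Equiv.Perm (Fin N)) : Edge N ≃ Edge N := ⟨Sym2.map σ, Sym2.map σ.symm, s2map σ, s2map σ.symm⟩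

lemma eP_ed (σ : Equiv.Perm (Fin N)) (i j : Fin N) : eP σ (ed i j) = ed (σ i) (σ j) := rfl

lemma wtf_eP (σ : Equiv.Perm (Fin N)) (S : Finset (Edge N)) (i : Fin N) : wtf ((eP σ).finsetCongr S) (σ i) = wtf S i := by
  rw [wtf, wtf, ← Equiv.sum_comp σ]
  refine sum_congr rfl fun j _ => ?_
  rw [← eP_ed]
  simp [Equiv.finsetCongr_apply]

lemma om_perm (σ : Equiv.Perm (Fin N)) (l : Fin N → ℕ) : om (fun i => l (σ i)) = om l := by
  simp only [om, sum_sub_distrib]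
  rw [Equiv.sum_comp σ fun i => (l i : ℚ), Equiv.sum_comp σ fun i => (l i : ℚ) ^ 2]

theorem trace_dt (n : ℕ) (P G : Matrix (Finset (Edge N)) (Finset (Edge N)) ℚ) (h1 : P + LQ N * G = 1) (h2 : LQ N * P = 0)
    (h5 : ∀ B, Commute (LQ N) B → Commute P B ∧ Commute G B) :
    ∑ S : Tn N n, P S.1 S.1 = ∑ S : Finset (Edge N), if S.card = n ∧ om (fun k : Fin N => wtf S k + k) = 0 then
      (dt N (fun k => wtf S k + k) : ℚ) else 0 := by
  rw [trace_eq n P G h1 h2 h5]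
  have e1 : ∀ S : Finset (Edge N), (if S.card = n then
      ∑ σ : Equiv.Perm (Fin N), ((Equiv.Perm.sign σ : ℤ) : ℚ) * g0 (fun i => wtf S i + (σ i : Fin N)) else 0) =
      ∑ σ : Equiv.Perm (Fin N), if S.card = n then ((Equiv.Perm.sign σ : ℤ) : ℚ) * g0 (fun i => wtf S i + (σ i : Fin N)) else 0 := by
    intro S; split_ifs <;> simp
  have e2 : ∀ S : Finset (Edge N), (if S.card = n ∧ om (fun k : Fin N => wtf S k + k) = 0 then
      (dt N (fun k => wtf S k + k) : ℚ) else 0) =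
      ∑ σ : Equiv.Perm (Fin N), if S.card = n then ((Equiv.Perm.sign σ : ℤ) : ℚ) * g0 (fun i => wtf S (σ i) + (σ i : Fin N)) else 0 := by
    intro S
    have : ∀ σ : Equiv.Perm (Fin N), om (fun i => wtf S (σ i) + (σ i : Fin N)) = om (fun k : Fin N => wtf S k + k) :=
      fun σ => om_perm σ (fun k : Fin N => wtf S k + k)
    simp only [g0, this, ite_and]
    split_ifs
    · rw [dt, det_apply']
      simp only [g1, of_apply]
      push_cast; rfl
    · simp
    · simp
  simp only [e1, e2]
  rw [sum_comm, sum_comm (s := univ (α := Finset (Edge N)))]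
  refine sum_congr rfl fun σ _ => ?_
  rw [← Equiv.sum_comp (eP σ).finsetCongr (fun S => if S.card = n then ((Equiv.Perm.sign σ : ℤ) : ℚ) * g0 (fun i => wtf S (σ i) + (σ i : Fin N)) else 0)]
  refine sum_congr rfl fun S _ => ?_
  simp only [wtf_eP]
  rw [Equiv.finsetCongr_apply, card_map]

end Tr
end JW
end

section
open Finset Matrix

namespace JW
set_option linter.unusedSectionVars false
set_option linter.unusedSimpArgs false

section Comb
variable {N : ℕ}

lemma sum_max (h : Fin N → ℤ) (hm : Monotone h) : ∑ i, ∑ j, max (h i) (h j) = ∑ k : Fin N, (2 * (k : ℕ) + 1) * h k := by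
  have e : ∀ i j : Fin N, max (h i) (h j) = (if j < i then h i else 0) + (if i < j then h j else 0) + (if i = j then h i else 0) := by
    intro i j
    rcases lt_trichotomy i j with hh | hh | hh
    · simp [hh, hh.ne, not_lt.2 hh.le, hm hh.le]
    · simp [hh]
    · simp [hh, hh.ne', not_lt.2 hh.le, hm hh.le]
  simp only [e, sum_add_distrib]
  rw [sum_comm (f := fun i j => if i < j then h j else 0)]
  rw [← sum_add_distrib, ← sum_add_distrib]
  refine sum_congr rfl fun k _ => ?_
  have c : (∑ j : Fin N, if j < k then h k else 0) = (k : ℕ) * h k := by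
    rw [← sum_filter, sum_const, nsmul_eq_mul]
    congr 2
    have : (univ.filter fun j => j < k) = Iio k := by ext; simp
    rw [this, Fin.card_Iio]
  rw [c]
  simp
  ring

lemma sort_eq (g : Fin N → ℤ) (h1 : ∑ i, g i ^ 2 ≤ ∑ i, ∑ j, max (g i) (g j)) (h2 : ∑ i, g i ^ 2 = ∑ k : Fin N, (2 * ((k : ℕ) : ℤ) + 1) ^ 2) :
    Function.Injective g ∧ (∀ i, 0 < g i) ∧ ∑ i, g i ^ 2 = ∑ i, ∑ j, max (g i) (g j) := by
  set τ := Tuple.sort g with hτ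
  have hm : Monotone (fun k => g (τ k)) := Tuple.monotone_sort g
  have e1 : ∑ i, ∑ j, max (g i) (g j) = ∑ k : Fin N, (2 * ((k : ℕ) : ℤ) + 1) * g (τ k) := by
    rw [← sum_max _ hm, ← Equiv.sum_comp τ]
    refine sum_congr rfl fun i _ => ?_
    rw [← Equiv.sum_comp τ]
  have e2 : ∑ i, g i ^ 2 = ∑ i, g (τ i) ^ 2 := (Equiv.sum_comp τ fun i => g i ^ 2).symm
  have e3 : ∑ k : Fin N, (g (τ k) - (2 * ((k : ℕ) : ℤ) + 1)) ^ 2 = 2 * (∑ i, g i ^ 2 - ∑ i, ∑ j, max (g i) (g j)) := by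
    have : ∀ k : Fin N, (g (τ k) - (2 * ((k : ℕ) : ℤ) + 1)) ^ 2 = g (τ k) ^ 2 + (2 * ((k : ℕ) : ℤ) + 1) ^ 2 - 2 * ((2 * ((k : ℕ) : ℤ) + 1) * g (τ k)) := by
      intro k; ring
    simp only [this, sum_sub_distrib, sum_add_distrib, ← mul_sum]
    rw [← e1, ← h2, ← e2]; ring
  have e4 : ∑ k : Fin N, (g (τ k) - (2 * ((k : ℕ) : ℤ) + 1)) ^ 2 = 0 :=
    le_antisymm (by rw [e3]; linarith) (sum_nonneg fun k _ => sq_nonneg _)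
  have e5 : ∀ k, g (τ k) = 2 * ((k : ℕ) : ℤ) + 1 := by
    intro k
    have := (sum_eq_zero_iff_of_nonneg (fun k _ => sq_nonneg _)).1 e4 k (mem_univ k)
    have := pow_eq_zero_iff (two_ne_zero) |>.1 this
    linarith
  refine ⟨?_, ?_, by linarith⟩
  · intro i j hij
    obtain ⟨a, rfl⟩ := τ.surjective i
    obtain ⟨b, rfl⟩ := τ.surjective j
    rw [e5, e5] at hij
    congr 1
    ext; omega
  · intro i
    obtain ⟨a, rfl⟩ := τ.surjective i
    rw [e5]; positivity

noncomputable def uu (S : Finset (Edge N)) (i : Fin N) : ℤ := 2 * wtf S i + 2 * (i : ℕ) + 1 - 2 * N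

noncomputable def dd (S : Finset (Edge N)) (i j : Fin N) : ℤ := (if ed i j ∈ S then 2 else 0) - (if i < j then 2 else if i = j then 1 else 0)

lemma uu_eq (S : Finset (Edge N)) (i : Fin N) : uu S i = ∑ j, dd S i j := by
  simp only [dd, sum_sub_distrib]
  have e1 : (∑ j, if ed i j ∈ S then (2:ℤ) else 0) = 2 * wtf S i := by
    rw [wtf]; push_cast; rw [mul_sum]; simp
  have e2 : ∀ j, (if i < j then (2 : ℤ) else if i = j then 1 else 0) = (if i < j then 2 else 0) + (if i = j then 1 else 0) := by
    intro j; split_ifs <;> first | rfl | omega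
  have e3 : (∑ j : Fin N, if i < j then (2 : ℤ) else 0) = ((N - 1 - (i : ℕ) : ℕ) : ℤ) * 2 := by
    rw [← sum_filter, sum_const, nsmul_eq_mul]
    congr 2
    have : (univ.filter fun j => i < j) = Ioi i := by ext; simp
    rw [this, Fin.card_Ioi]
  simp only [e2, sum_add_distrib]
  rw [e1, e3, uu]
  simp
  have := i.2
  omega

lemma tt_le (S : Finset (Edge N)) (i j : Fin N) : uu S i * dd S i j + uu S j * dd S j i ≤ 2 * max |uu S i| |uu S j| := by
  have a1 := le_max_left |uu S i| |uu S j|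
  have a2 := le_max_right |uu S i| |uu S j|
  have b1 := le_abs_self (uu S i)
  have b2 := le_abs_self (uu S j)
  have b3 := neg_le_abs (uu S i)
  have b4 := neg_le_abs (uu S j)
  simp only [dd, ed_symm j i]
  rcases lt_trichotomy i j with hh | hh | hh
  · simp only [hh, hh.ne, hh.ne', not_lt.2 hh.le, if_true, if_false]
    split_ifs <;> linarith
  · subst hh
    simp only [lt_irrefl, if_true, if_false]
    split_ifs <;> linarith
  · simp only [hh, hh.ne, hh.ne', not_lt.2 hh.le, if_true, if_false]
    split_ifs <;> linarith

lemma good_mem (S : Finset (Edge N)) (h : ∑ i, uu S i ^ 2 = ∑ k : Fin N, (2 * ((k : ℕ) : ℤ) + 1) ^ 2) :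
    (∀ i j, ed i j ∈ S ↔ 0 < uu S i + uu S j) ∧ Monotone (uu S) := by
  have e1 : ∑ i, ∑ j, (uu S i * dd S i j + uu S j * dd S j i) = 2 * ∑ i, |uu S i| ^ 2 := by
    simp only [sum_add_distrib]
    rw [sum_comm (f := fun i j => uu S j * dd S j i), ← two_mul]
    congr 1
    refine sum_congr rfl fun i _ => ?_
    rw [← mul_sum, ← uu_eq, sq_abs, sq]
  have e2 : ∑ i, |uu S i| ^ 2 ≤ ∑ i, ∑ j, max |uu S i| |uu S j| := by
    have : ∑ i, ∑ j, (uu S i * dd S i j + uu S j * dd S j i) ≤ ∑ i, ∑ j, 2 * max |uu S i| |uu S j| :=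
      sum_le_sum fun i _ => sum_le_sum fun j _ => tt_le S i j
    rw [e1] at this
    simp only [← mul_sum] at this
    linarith
  obtain ⟨hi, hp, he⟩ := sort_eq (fun i => |uu S i|) e2 (by simpa only [sq_abs] using h)
  have e3 : ∀ i j, uu S i * dd S i j + uu S j * dd S j i = 2 * max |uu S i| |uu S j| := by
    have : ∑ i, ∑ j, (uu S i * dd S i j + uu S j * dd S j i) = ∑ i, ∑ j, 2 * max |uu S i| |uu S j| := by
      rw [e1, he]; simp only [mul_sum]
    have h1 := (sum_eq_sum_iff_of_le (fun i _ => sum_le_sum fun j _ => tt_le S i j)).1 this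
    intro i j
    exact (sum_eq_sum_iff_of_le (fun j _ => tt_le S i j)).1 (h1 i (mem_univ i)) j (mem_univ j)
  have key : ∀ i j, i < j → (ed i j ∈ S → |uu S i| < uu S j) ∧ (ed i j ∉ S → |uu S j| < - uu S i) := by
    intro i j hij
    have h1 := e3 i j
    have hne : |uu S i| ≠ |uu S j| := fun h => hij.ne (hi h)
    have a1 := le_max_left |uu S i| |uu S j|
    have a2 := le_max_right |uu S i| |uu S j|
    have p1 := hp i
    have p2 := hp j
    have b2 := le_abs_self (uu S j)
    have b3 := neg_le_abs (uu S i)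
    simp only [dd, ed_symm j i, hij, hij.ne, hij.ne', not_lt.2 hij.le, if_true, if_false] at h1
    constructor
    · intro hm
      simp only [hm, if_true] at h1
      have : uu S j = |uu S j| := by linarith
      exact lt_of_le_of_ne (by linarith) (by rw [this]; exact hne)
    · intro hm
      simp only [hm, if_false] at h1
      have : - uu S i = |uu S i| := by linarith
      exact lt_of_le_of_ne (by linarith) (by rw [this]; exact hne.symm)
  have key2 : ∀ i j, i < j → (ed i j ∈ S ↔ 0 < uu S i + uu S j) := by
    intro i j hij
    obtain ⟨k1, k2⟩ := key i j hij
    constructor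
    · intro hm
      have := k1 hm
      have := neg_le_abs (uu S i)
      linarith
    · intro hm
      by_contra hc
      have := k2 hc
      have := le_abs_self (uu S j)
      linarith
  refine ⟨?_, ?_⟩
  · intro i j
    rcases lt_trichotomy i j with hh | hh | hh
    · exact key2 i j hh
    · subst hh
      have h1 := e3 i i
      have p1 := hp i
      simp only [dd, lt_irrefl, if_true, if_false, max_self] at h1 p1
      split_ifs at h1 with hm
      · simp only [hm, true_iff]; linarith
      · simp only [hm, false_iff]; linarith
    · rw [ed_symm, add_comm]; exact key2 j i hh
  · refine (show StrictMono (uu S) from fun i j hij => ?_).monotone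
    obtain ⟨k1, k2⟩ := key i j hij
    by_cases hm : ed i j ∈ S
    · have := k1 hm
      have := le_abs_self (uu S i)
      linarith
    · have := k2 hm
      have := neg_le_abs (uu S j)
      linarith

lemma om_uu (S : Finset (Edge N)) (h : om (fun k : Fin N => wtf S k + k) = 0) :
    ∑ i, uu S i ^ 2 = ∑ k : Fin N, (2 * ((k : ℕ) : ℤ) + 1) ^ 2 := by
  have e0 : ∑ k : Fin N, (2 * ((k : ℕ) : ℚ) + 1) ^ 2 = ∑ k : Fin N, (2 * N - 1 - 2 * ((k : ℕ) : ℚ)) ^ 2 := by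
    rw [← Equiv.sum_comp Fin.revPerm]
    refine sum_congr rfl fun k _ => ?_
    have : ((Fin.revPerm k : Fin N) : ℕ) + k + 1 = N := by simp [Fin.val_rev]; omega
    have : (((Fin.revPerm k : Fin N) : ℕ) : ℚ) + (k : ℕ) + 1 = N := by exact_mod_cast this
    rw [← this]; ring
  have e1 : ∑ i, (uu S i : ℚ) ^ 2 = ∑ k : Fin N, (2 * N - 1 - 2 * ((k : ℕ) : ℚ)) ^ 2 - 4 * om (fun k : Fin N => wtf S k + k) := by
    rw [om, mul_sum, ← sum_sub_distrib, mul_sum, ← sum_sub_distrib]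
    refine sum_congr rfl fun k _ => ?_
    simp only [uu]; push_cast; ring
  rw [h, mul_zero, sub_zero, ← e0] at e1
  exact_mod_cast e1

end Comb
end JW
end

section
open Finset Matrix

namespace JW
set_option linter.unusedSectionVars false
set_option linter.unusedSimpArgs false

section Fin
variable (N : ℕ)

open Classical in
noncomputable def Sof (lam : YoungDiagram) : Finset (Edge N) :=
  univ.filter fun e => ∃ i j : Fin N, e = ed i j ∧ ((i.rev : ℕ), (j.rev : ℕ)) ∈ lam

/-- self-conjugate diagrams in the box -/
def Box (lam : YoungDiagram) : Prop := lam.transpose = lam ∧ lam.rowLen N = 0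

variable {N}
variable {lam : YoungDiagram} (h : Box N lam)
include h

lemma Box.symm {i j : ℕ} : (i, j) ∈ lam ↔ (j, i) ∈ lam := by
  conv_rhs => rw [← h.1]
  rw [YoungDiagram.mem_transpose]; rfl

lemma Box.lt {i j : ℕ} (hm : (i, j) ∈ lam) : i < N := by
  by_contra hc
  have : (N, 0) ∈ lam := lam.up_left_mem (not_lt.1 hc) (Nat.zero_le _) hm
  rw [YoungDiagram.mem_iff_lt_rowLen, h.2] at this
  exact lt_irrefl _ this

lemma Box.lt' {i j : ℕ} (hm : (i, j) ∈ lam) : j < N := h.lt (h.symm.1 hm)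

lemma mem_Sof (i j : Fin N) : ed i j ∈ Sof N lam ↔ ((i.rev : ℕ), (j.rev : ℕ)) ∈ lam := by
  simp only [Sof, mem_filter, mem_univ, true_and, ed_eq]
  constructor
  · rintro ⟨a, b, (⟨rfl, rfl⟩ | ⟨rfl, rfl⟩), hm⟩
    · exact hm
    · exact h.symm.1 hm
  · intro hm
    exact ⟨i, j, Or.inl ⟨rfl, rfl⟩, hm⟩

lemma Box.rowLen_le (r : ℕ) : lam.rowLen r ≤ N := by
  by_contra hc
  have : (r, N) ∈ lam := by rw [YoungDiagram.mem_iff_lt_rowLen]; omega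
  exact lt_irrefl _ (h.lt' this)

lemma sum_row (r : ℕ) (F : ℕ → ℤ) : (∑ j : Fin N, if (r, (j : ℕ)) ∈ lam then F j else 0) = ∑ c ∈ range (lam.rowLen r), F c := by
  rw [Fin.sum_univ_eq_sum_range (fun j => if (r, j) ∈ lam then F j else 0), ← sum_filter]
  refine sum_congr ?_ fun _ _ => rfl
  ext c
  simp only [mem_filter, mem_range, YoungDiagram.mem_iff_lt_rowLen]
  have := h.rowLen_le r
  omega

lemma wtf_Sof (i : Fin N) : wtf (Sof N lam) i = lam.rowLen (i.rev : ℕ) := by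
  have : (wtf (Sof N lam) i : ℤ) = lam.rowLen (i.rev : ℕ) := by
    rw [wtf]
    push_cast
    simp only [mem_Sof h]
    rw [← Equiv.sum_comp Fin.revPerm]
    simp only [Fin.revPerm_apply, Fin.rev_rev]
    rw [sum_row h _ fun _ => 1]; simp
  exact_mod_cast this

lemma sum_cells (F : ℕ → ℕ → ℤ) : (∑ i : Fin N, ∑ j : Fin N, if ((i : ℕ), (j : ℕ)) ∈ lam then F i j else 0) = ∑ c ∈ lam.cells, F c.1 c.2 := by
  have : lam.cells = (range N ×ˢ range N).filter fun c => c ∈ lam := by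
    ext ⟨a, b⟩
    simp only [mem_filter, mem_product, mem_range, YoungDiagram.mem_cells]
    exact ⟨fun hm => ⟨⟨h.lt hm, h.lt' hm⟩, hm⟩, fun hm => hm.2⟩
  rw [this, sum_filter, sum_product, Fin.sum_univ_eq_sum_range (fun i => ∑ j : Fin N, if (i, (j : ℕ)) ∈ lam then F i j else 0)]
  refine sum_congr rfl fun i _ => ?_
  rw [Fin.sum_univ_eq_sum_range (fun j => if (i, j) ∈ lam then F i j else 0)]

lemma card_Sof : 2 * (Sof N lam).card = lam.card + lam.diagRank := by
  have h1 := sum_ed (fun e : Edge N => if e ∈ Sof N lam then (1 : ℤ) else 0)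
  simp only [mem_Sof h] at h1
  have h2 : (∑ e : Edge N, if e ∈ Sof N lam then (1 : ℤ) else 0) = (Sof N lam).card := by simp
  rw [h2, ← Equiv.sum_comp Fin.revPerm] at h1
  have h3 : ∀ i : Fin N, (∑ j : Fin N, (if Fin.revPerm i = j then (2:ℤ) else 1) • (if ((((Fin.revPerm i).rev : Fin N) : ℕ), (j.rev : ℕ)) ∈ lam then (1:ℤ) else 0)) =
      ∑ j : Fin N, if ((i : ℕ), (j : ℕ)) ∈ lam then (if (i : ℕ) = j then (2 : ℤ) else 1) else 0 := by
    intro i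
    rw [← Equiv.sum_comp Fin.revPerm]
    refine sum_congr rfl fun j _ => ?_
    simp only [Fin.revPerm_apply, Fin.rev_rev, Fin.rev_inj, Fin.val_inj]
    split_ifs <;> simp
  simp only [h3] at h1
  rw [sum_cells h fun a b => if a = b then (2:ℤ) else 1] at h1
  have h4 : ∀ c : ℕ × ℕ, (if c.1 = c.2 then (2:ℤ) else 1) = 1 + if c.1 = c.2 then 1 else 0 := by
    intro c; split_ifs <;> rfl
  simp only [h4, sum_add_distrib] at h1
  rw [← sum_filter] at h1
  simp only [sum_const, smul_eq_mul, nsmul_eq_mul, mul_one] at h1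
  rw [YoungDiagram.card, YoungDiagram.diagRank]
  omega

lemma om_Sof : om (fun k : Fin N => wtf (Sof N lam) k + k) = 0 := by
  have e1 : ∑ i : Fin N, ∑ j : Fin N, (if ((i : ℕ), (j : ℕ)) ∈ lam then ((j : ℕ) : ℤ) - (i : ℕ) else 0) = 0 := by
    have : ∑ i : Fin N, ∑ j : Fin N, (if ((i : ℕ), (j : ℕ)) ∈ lam then ((j : ℕ) : ℤ) - (i : ℕ) else 0) =
      - ∑ i : Fin N, ∑ j : Fin N, (if ((i : ℕ), (j : ℕ)) ∈ lam then ((j : ℕ) : ℤ) - (i : ℕ) else 0) := by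
      conv_lhs => rw [sum_comm]
      rw [← sum_neg_distrib]
      refine sum_congr rfl fun i _ => ?_
      rw [← sum_neg_distrib]
      refine sum_congr rfl fun j _ => ?_
      simp only [h.symm (i := (j : ℕ)) (j := (i : ℕ))]
      split_ifs <;> ring
    linarith
  have e2 : ∀ i : Fin N, 2 * (∑ j : Fin N, (if ((i : ℕ), (j : ℕ)) ∈ lam then ((j : ℕ) : ℤ) - (i : ℕ) else 0)) =
      (lam.rowLen i : ℤ) * ((lam.rowLen i : ℤ) - 1 - 2 * (i : ℕ)) := by
    intro i
    rw [sum_row h i fun j => ((j : ℕ) : ℤ) - (i : ℕ)]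
    generalize lam.rowLen i = L
    induction L with
    | zero => simp
    | succ L ih => rw [sum_range_succ, mul_add, ih]; push_cast; ring
  have e3 : ∑ i : Fin N, (lam.rowLen i : ℤ) * ((lam.rowLen i : ℤ) - 1 - 2 * (i : ℕ)) = 0 := by
    simp only [← e2, ← mul_sum, e1, mul_zero]
  have e4 : ∑ i : Fin N, (lam.rowLen i : ℚ) * ((lam.rowLen i : ℚ) - 1 - 2 * (i : ℕ)) = 0 := by exact_mod_cast e3
  rw [om, mul_sum, ← sum_sub_distrib, ← neg_eq_zero, ← sum_neg_distrib, ← Equiv.sum_comp Fin.revPerm, ← e4]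
  refine sum_congr rfl fun i _ => ?_
  rw [wtf_Sof h]
  simp only [Fin.revPerm_apply, Fin.rev_rev]
  have : ((i.rev : Fin N) : ℕ) + i + 1 = N := by rw [Fin.val_rev]; omega
  have : (((i.rev : Fin N) : ℕ) : ℚ) + (i : ℕ) + 1 = N := by exact_mod_cast this
  rw [← this]; push_cast; ring

lemma dt_Sof : (dt N (fun k => wtf (Sof N lam) k + k) : ℚ) = ssytCount N lam := by
  have := ssyt_dt N lam h.2
  have e : (fun k : Fin N => wtf (Sof N lam) k + k) = fun j : Fin N => lam.rowLen (N - 1 - j) + j := by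
    funext k
    rw [wtf_Sof h, Fin.val_rev, show N - ((k : ℕ) + 1) = N - 1 - k by omega]
  rw [e, ← this]; simp

omit h

lemma Sof_inj {lam mu : YoungDiagram} (h1 : Box N lam) (h2 : Box N mu) (he : Sof N lam = Sof N mu) : lam = mu := by
  have key : ∀ {lam mu : YoungDiagram}, Box N lam → Box N mu → Sof N lam = Sof N mu → ∀ a b, (a, b) ∈ lam → (a, b) ∈ mu := by
    intro lam mu h1 h2 he a b hm
    have ha := h1.lt hm
    have hb := h1.lt' hm
    have := mem_Sof h1 (Fin.rev ⟨a, ha⟩) (Fin.rev ⟨b, hb⟩)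
    rw [he, mem_Sof h2] at this
    simp only [Fin.rev_rev] at this
    exact this.2 hm
  ext ⟨a, b⟩
  exact ⟨key h1 h2 he a b, key h2 h1 he.symm a b⟩

lemma Sof_surj (S : Finset (Edge N)) (hS : om (fun k : Fin N => wtf S k + k) = 0) : ∃ lam, Box N lam ∧ Sof N lam = S := by
  classical
  obtain ⟨g1, g2⟩ := good_mem S (om_uu S hS)
  let lam : YoungDiagram :=
    { cells := (univ : Finset (Fin N × Fin N)).filter (fun p => ed p.1.rev p.2.rev ∈ S) |>.image fun p => ((p.1 : ℕ), (p.2 : ℕ))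
      isLowerSet := by
        rintro ⟨a, b⟩ ⟨c, d⟩ ⟨h1, h2⟩ hm
        simp only [coe_image, coe_filter, mem_univ, true_and, Set.mem_image, Set.mem_ofPred_eq, Prod.exists, Prod.mk.injEq] at hm ⊢
        obtain ⟨i, j, hij, rfl, rfl⟩ := hm
        simp only at h1 h2
        refine ⟨⟨c, by omega⟩, ⟨d, by omega⟩, ?_, rfl, rfl⟩
        rw [g1] at hij ⊢
        have k1 : uu S i.rev ≤ uu S (Fin.rev ⟨c, by omega⟩) := g2 (Fin.rev_le_rev.2 h1)
        have k2 : uu S j.rev ≤ uu S (Fin.rev ⟨d, by omega⟩) := g2 (Fin.rev_le_rev.2 h2)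
        linarith }
  have hm : ∀ a b, (a, b) ∈ lam ↔ ∃ i j : Fin N, ed i.rev j.rev ∈ S ∧ (i : ℕ) = a ∧ (j : ℕ) = b := by
    intro a b
    rw [← YoungDiagram.mem_cells]
    simp [lam]
  have hB : Box N lam := by
    constructor
    · ext ⟨a, b⟩
      rw [YoungDiagram.mem_cells, YoungDiagram.mem_cells, YoungDiagram.mem_transpose]
      rw [Prod.swap, hm, hm]
      constructor
      · rintro ⟨i, j, h1, h2, h3⟩; exact ⟨j, i, by rwa [ed_symm], h3, h2⟩
      · rintro ⟨i, j, h1, h2, h3⟩; exact ⟨j, i, by rwa [ed_symm], h3, h2⟩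
    · by_contra hc
      have : (N, 0) ∈ lam := by rw [YoungDiagram.mem_iff_lt_rowLen]; omega
      rw [hm] at this
      obtain ⟨i, j, -, h1, -⟩ := this
      omega
  refine ⟨lam, hB, ?_⟩
  ext e
  induction e using ed_ind with
  | _ i j hij =>
  rw [mem_Sof hB, hm]
  constructor
  · rintro ⟨a, b, h1, h2, h3⟩
    rw [Fin.val_inj] at h2 h3
    rw [h2, h3, Fin.rev_rev, Fin.rev_rev] at h1
    exact h1
  · intro h1
    exact ⟨i.rev, j.rev, by simpa using h1, rfl, rfl⟩

theorem sum_good (n : ℕ) : ((∑ᶠ lam ∈ {lam : YoungDiagram | lam.transpose = lam ∧ lam.card + lam.diagRank = 2 * n}, ssytCount N lam : ℕ) : ℚ) =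
    ∑ S : Finset (Edge N), if S.card = n ∧ om (fun k : Fin N => wtf S k + k) = 0 then (dt N (fun k => wtf S k + k) : ℚ) else 0 := by
  classical
  have e1 : ∑ᶠ lam ∈ {lam : YoungDiagram | lam.transpose = lam ∧ lam.card + lam.diagRank = 2 * n}, ssytCount N lam =
      ∑ᶠ lam ∈ {lam : YoungDiagram | Box N lam ∧ lam.card + lam.diagRank = 2 * n}, ssytCount N lam := by
    refine finsum_mem_inter_support_eq _ _ _ ?_
    ext lam
    simp only [Set.mem_inter_iff, Set.mem_ofPred_eq, Function.mem_support, Box]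
    constructor
    · rintro ⟨⟨a, b⟩, c⟩
      refine ⟨⟨⟨a, ?_⟩, b⟩, c⟩
      by_contra hc
      exact c (ssyt_zero N lam hc)
    · rintro ⟨⟨⟨a, _⟩, b⟩, c⟩
      exact ⟨⟨a, b⟩, c⟩
  have e2 : ∑ᶠ lam ∈ {lam : YoungDiagram | Box N lam ∧ lam.card + lam.diagRank = 2 * n}, ssytCount N lam =
      ∑ᶠ S ∈ {S : Finset (Edge N) | S.card = n ∧ om (fun k : Fin N => wtf S k + k) = 0}, (dt N (fun k => wtf S k + k)).toNat := by
    refine finsum_mem_eq_of_bijOn (Sof N) ⟨?_, ?_, ?_⟩ ?_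
    · rintro lam ⟨h1, h2⟩
      refine ⟨?_, om_Sof h1⟩
      have := card_Sof h1
      omega
    · rintro lam ⟨h1, h2⟩ mu ⟨h3, h4⟩ he
      exact Sof_inj h1 h3 he
    · rintro S ⟨h1, h2⟩
      obtain ⟨lam, hB, rfl⟩ := Sof_surj S h2
      refine ⟨lam, ⟨hB, ?_⟩, rfl⟩
      have := card_Sof hB
      omega
    · rintro lam ⟨h1, h2⟩
      have : dt N (fun k => wtf (Sof N lam) k + k) = ssytCount N lam := by exact_mod_cast dt_Sof h1
      rw [this, Int.toNat_natCast]
  rw [e1, e2, finsum_mem_eq_finite_toFinset_sum _ (Set.toFinite _), ← sum_filter, Nat.cast_sum]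
  refine sum_congr (by ext S; simp) fun S hS => ?_
  simp only [mem_filter, mem_univ, true_and] at hS
  obtain ⟨lam, hB, rfl⟩ := Sof_surj S hS.2
  have : dt N (fun k => wtf (Sof N lam) k + k) = ssytCount N lam := by exact_mod_cast dt_Sof hB
  rw [this, Int.toNat_natCast, Int.cast_natCast]

end Fin
end JW
end

open CategoryTheory in
/-- **Józefiak–Weyman theorem, dimension form**: for the parastatistics algebra
`A = T(K^N)/⟨[[x,y],z]⟩` over a field `K` of characteristic zero, and `K` the `A`-module
given by the augmentation, the `K`-dimension of `Ext^n_A(K, K)` equals the number of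
semistandard Young tableaux with entries in `{0,…,N-1}` whose shape is a self-conjugate
Young diagram `λ` with `(|λ| + r(λ))/2 = n`. -/
theorem jozefiak_weyman_dimension (K : Type) [Field K] [CharZero K] (N : ℕ) (hN : 0 < N)
    (n : ℕ) :
    Module.finrank K
      (((Ext K (ModuleCat (PS K (Fin N → K))) n).obj
          (Opposite.op (ModuleCat.of (PS K (Fin N → K)) K))).obj
        (ModuleCat.of (PS K (Fin N → K)) K)) =
    ∑ᶠ lam ∈ {lam : YoungDiagram | lam.transpose = lam ∧ lam.card + lam.diagRank = 2 * n},
      ssytCount N lam := by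
  obtain ⟨P, G, h1, h2, h3, -, h4, h5⟩ := JW.hodgeQ N
  have e1 := JW.ext_dimQ N K n P G h1 h3 h4 h5
  rw [JW.trace_dt n P G h1 h2 h5, ← JW.sum_good n] at e1
  exact_mod_cast e1
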